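/- Let n ≥ 1. The following three statements are equivalent: (i) for all probability densities u, v on ℝⁿ with (u dx, T_t v dx) ∈ Π_𝒮 for all t ≥ 0 and all t ≥ 0, d/dt 𝒜(u dx, T_t v dx) ≤ (n/2)(1 − exp(−(1/n)[H(u dx|dx) − H(T_t v dx|dx)])); (ii) for all such u, v, d/dt|_{t=0} 𝒜(u dx, T_t v dx) ≤ (n/2)(1 − exp(−(1/n)[H(u dx|dx) − H(v dx|dx)])); (iii) for all such u, v and all t ≥ 0, 𝒜(u dx, T_t v dx) − 𝒜(u dx, v dx) ≤ (n/2)·t·(1 − exp(−(1/n)[H(u dx|dx) − H(T_t v dx|dx)])). -/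

import Mathlib

open MeasureTheory Filter Set
open scoped ENNReal NNReal

noncomputable section

abbrev Eucl (n : ℕ) : Type := EuclideanSpace ℝ (Fin n)

/-- Heat semigroup `T_t` on `ℝⁿ` (generator `Δ/2`), with `T_0 f = f`. -/
noncomputable def heat (n : ℕ) (t : ℝ) (f : Eucl n → ℝ) (x : Eucl n) : ℝ :=
  if t = 0 then f x
  else ∫ y : Eucl n, f y * Real.exp (-‖x - y‖ ^ 2 / (2 * t)) / (2 * Real.pi * t) ^ ((n : ℝ) / 2)

/-- Relative entropy `H(ρ dx | dx) = ∫ ρ log ρ dx` of a density `ρ`. -/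
noncomputable def entDens (n : ℕ) (ρ : Eucl n → ℝ) : ℝ :=
  ∫ x : Eucl n, ρ x * Real.log (ρ x)

/-- The measure `ρ dx`. -/
noncomputable def densMeas (n : ℕ) (ρ : Eucl n → ℝ) : Measure (Eucl n) :=
  (volume : Measure (Eucl n)).withDensity fun x => ENNReal.ofReal (ρ x)

/-- The measure `R₀₁(dx dy) = e^{-|x-y|²/2} (2π)^{-n/2} dx dy` on `ℝⁿ × ℝⁿ`. -/
noncomputable def R01 (n : ℕ) : Measure (Eucl n × Eucl n) :=
  (volume : Measure (Eucl n × Eucl n)).withDensity fun p =>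
    ENNReal.ofReal (Real.exp (-‖p.1 - p.2‖ ^ 2 / 2) / (2 * Real.pi) ^ ((n : ℝ) / 2))

open Classical in
/-- Relative entropy `H(p|r) = ∫ log (dp/dr) dp`, `+∞` if not absolutely continuous
(or not integrable; the paper's definition requires an integrability condition as well). -/
noncomputable def relEnt {X : Type} [MeasurableSpace X] (p r : Measure X) : EReal :=
  if p ≪ r ∧ Integrable (fun x => Real.log (p.rnDeriv r x).toReal) p
  then ((∫ x, Real.log (p.rnDeriv r x).toReal ∂p : ℝ) : EReal) else ⊤

/-- `π` is a coupling of `μ0` and `μ1`. -/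
def Coupling {X : Type} [MeasurableSpace X] (π : Measure (X × X)) (μ0 μ1 : Measure X) : Prop :=
  IsProbabilityMeasure π ∧ π.map Prod.fst = μ0 ∧ π.map Prod.snd = μ1

/-- Relative entropy of a measure with respect to Lebesgue, `∫ ρ log ρ` for the density `ρ`. -/
noncomputable def entLeb (n : ℕ) (μ : Measure (Eucl n)) : ℝ :=
  ∫ x, (μ.rnDeriv volume x).toReal * Real.log ((μ.rnDeriv volume x).toReal)

/-- Entropic cost (EReal-valued):
`𝒜(μ0,μ1) = inf { H(π|R₀₁) } - (H(μ0|dx)+H(μ1|dx))/2`. -/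
noncomputable def entCostE (n : ℕ) (μ0 μ1 : Measure (Eucl n)) : EReal :=
  (⨅ π : {π : Measure (Eucl n × Eucl n) // Coupling π μ0 μ1}, relEnt (π.1) (R01 n))
    - (((entLeb n μ0 + entLeb n μ1) / 2 : ℝ) : EReal)

/-- Entropic cost, real-valued. -/
noncomputable def entCost (n : ℕ) (μ0 μ1 : Measure (Eucl n)) : ℝ :=
  (entCostE n μ0 μ1).toReal

/-- Squared quadratic Wasserstein distance. -/
noncomputable def W2sq (n : ℕ) (μ0 μ1 : Measure (Eucl n)) : ℝ :=
  (⨅ π : {π : Measure (Eucl n × Eucl n) // Coupling π μ0 μ1},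
      ∫⁻ p, (‖p.1 - p.2‖₊ : ℝ≥0∞) ^ 2 ∂(π.1)).toReal

/-- `f` is (the function of) a Schwartz function. -/
def IsSchwartz (n : ℕ) (f : Eucl n → ℝ) : Prop :=
  ∃ F : SchwartzMap (Eucl n) ℝ, ⇑F = f

/-- The pair `(μ0, μ1)` belongs to `Π_𝒮`: it admits a Schrödinger decomposition
`μ0 = f·T₁g dx`, `μ1 = g·T₁f dx` with `f, g` positive Schwartz functions bounded below
by a Gaussian. -/
def PiS (n : ℕ) (μ0 μ1 : Measure (Eucl n)) : Prop :=
  ∃ f g : Eucl n → ℝ, IsSchwartz n f ∧ IsSchwartz n g ∧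
    (∀ x, 0 < f x) ∧ (∀ x, 0 < g x) ∧
    (∃ α c : ℝ, 0 < α ∧ 0 < c ∧ (∀ x, c * Real.exp (-α * ‖x‖ ^ 2) ≤ f x) ∧
      (∀ x, c * Real.exp (-α * ‖x‖ ^ 2) ≤ g x)) ∧
    μ0 = densMeas n (fun x => f x * heat n 1 g x) ∧
    μ1 = densMeas n (fun x => g x * heat n 1 f x)

/-- Laplacian `Δφ = ∑ᵢ ∂²φ/∂xᵢ²`. -/
noncomputable def lap (n : ℕ) (φ : Eucl n → ℝ) (x : Eucl n) : ℝ :=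
  ∑ i, fderiv ℝ (fun y => fderiv ℝ φ y (EuclideanSpace.single i 1)) x (EuclideanSpace.single i 1)

/-- Squared Hilbert-Schmidt norm of the Hessian, `‖Hess φ‖² = ∑ᵢⱼ (∂ᵢ∂ⱼφ)²`. -/
noncomputable def hessHS (n : ℕ) (φ : Eucl n → ℝ) (x : Eucl n) : ℝ :=
  ∑ i, ∑ j, (fderiv ℝ (fun y => fderiv ℝ φ y (EuclideanSpace.single j 1)) x
    (EuclideanSpace.single i 1)) ^ 2

/-- Divergence `∇·F = ∑ᵢ ∂Fᵢ/∂xᵢ` of a vector field. -/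
noncomputable def diverg (n : ℕ) (F : Eucl n → Eucl n) (x : Eucl n) : ℝ :=
  ∑ i, fderiv ℝ (fun y => F y i) x (EuclideanSpace.single i 1)

/-- Heat semigroup acting componentwise on vector-valued functions. -/
noncomputable def heatV (n : ℕ) (t : ℝ) (F : Eucl n → Eucl n) (x : Eucl n) : Eucl n :=
  (EuclideanSpace.equiv (Fin n) ℝ).symm (fun i => heat n t (fun y => F y i) x)

/-- Entropic interpolation density `μ_s = T_s f · T_{1-s} g`. -/
noncomputable def entInterp (n : ℕ) (f g : Eucl n → ℝ) (s : ℝ) (x : Eucl n) : ℝ :=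
  heat n s f x * heat n (1 - s) g x

/-- The potential `θ_s = (log T_{1-s} g - log T_s f)/2`, whose gradient drives the
transport equation of the entropic interpolation. -/
noncomputable def thetaPot (n : ℕ) (f g : Eucl n → ℝ) (s : ℝ) (x : Eucl n) : ℝ :=
  (Real.log (heat n (1 - s) g x) - Real.log (heat n s f x)) / 2

end

section

open scoped Topology

section

/-- The heat kernel. -/
noncomputable def hk (n : ℕ) (t : ℝ) (x : Eucl n) : ℝ :=
  Real.exp (-‖x‖ ^ 2 / (2 * t)) / (2 * Real.pi * t) ^ ((n : ℝ) / 2)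

lemma hk_pos {n : ℕ} {t : ℝ} (ht : 0 < t) (x : Eucl n) : 0 < hk n t x := by
  unfold hk; positivity

lemma hk_cont (n : ℕ) (t : ℝ) : Continuous (hk n t) := by
  unfold hk; fun_prop

lemma hk_neg {n : ℕ} {t : ℝ} (x : Eucl n) : hk n t (-x) = hk n t x := by
  simp [hk]

lemma hk_sub_comm {n : ℕ} {t : ℝ} (x y : Eucl n) : hk n t (x - y) = hk n t (y - x) := by
  rw [← hk_neg, neg_sub]

lemma hk_integrable {n : ℕ} {t : ℝ} (ht : 0 < t) : Integrable (hk n t) := by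
  have h := (GaussianFourier.integrable_cexp_neg_mul_sq_norm_add (V := Eucl n)
    (b := ((1 / (2 * t) : ℝ) : ℂ)) (by rw [Complex.ofReal_re]; positivity) 0 0).norm
  refine (h.div_const ((2 * Real.pi * t) ^ ((n : ℝ) / 2))).congr ?_
  filter_upwards with x
  unfold hk
  rw [Complex.norm_exp]
  congr 2
  simp only [zero_mul, add_zero]
  rw [← Complex.ofReal_pow, ← Complex.ofReal_neg, ← Complex.ofReal_mul, Complex.ofReal_re]
  ring

lemma hk_integral {n : ℕ} {t : ℝ} (ht : 0 < t) : ∫ x, hk n t x = 1 := by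
  have h := GaussianFourier.integral_rexp_neg_mul_sq_norm (V := Eucl n) (b := 1 / (2 * t))
    (by positivity)
  unfold hk
  rw [integral_div]
  have : ∀ x : Eucl n, -‖x‖ ^ 2 / (2 * t) = -(1 / (2 * t)) * ‖x‖ ^ 2 := by intro x; ring
  simp_rw [this, h]
  rw [finrank_euclideanSpace_fin, show Real.pi / (1 / (2 * t)) = 2 * Real.pi * t by field_simp]
  exact div_self (by positivity)

lemma hk_mul_hk {n : ℕ} {s t : ℝ} (hs : 0 < s) (ht : 0 < t) (x y : Eucl n) :
    hk n s (x - y) * hk n t y =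
      hk n (s + t) x * hk n (s * t / (s + t)) (y - (t / (s + t)) • x) := by
  unfold hk
  have hst : 0 < s + t := by positivity
  rw [div_mul_div_comm, div_mul_div_comm, ← Real.exp_add, ← Real.exp_add,
    ← Real.mul_rpow (by positivity) (by positivity), ← Real.mul_rpow (by positivity) (by positivity)]
  congr 2
  · rw [@norm_sub_sq_real, @norm_sub_sq_real, norm_smul, inner_smul_right, mul_pow,
      Real.norm_eq_abs, sq_abs, real_inner_comm]
    field_simp
    ring
  · field_simp

lemma hk_conv {n : ℕ} {s t : ℝ} (hs : 0 < s) (ht : 0 < t) (x : Eucl n) :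
    ∫ y, hk n s (x - y) * hk n t y = hk n (s + t) x := by
  simp_rw [hk_mul_hk hs ht]
  rw [integral_const_mul, integral_sub_right_eq_self (hk n (s * t / (s + t))),
    hk_integral (by positivity), mul_one]

lemma heat_zero (n : ℕ) (f : Eucl n → ℝ) : heat n 0 f = f := by
  ext x; simp [heat]

lemma heat_eq {n : ℕ} {t : ℝ} (ht : t ≠ 0) (f : Eucl n → ℝ) (x : Eucl n) :
    heat n t f x = ∫ y, f y * hk n t (x - y) := by
  simp only [heat, if_neg ht, hk, mul_div_assoc]

lemma hk_scale {n : ℕ} {t : ℝ} (ht : 0 < t) (z : Eucl n) :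
    hk n t (√t • z) * (√t) ^ n = hk n 1 z := by
  unfold hk
  rw [norm_smul, mul_pow, Real.norm_eq_abs, sq_abs, Real.sq_sqrt ht.le,
    Real.mul_rpow (by positivity) ht.le]
  have : (√t) ^ n = t ^ ((n : ℝ) / 2) := by
    rw [Real.sqrt_eq_rpow, ← Real.rpow_mul_natCast ht.le]; congr 1; ring
  rw [this, mul_one, show -(t * ‖z‖ ^ 2) / (2 * t) = -‖z‖ ^ 2 / (2 * 1) by field_simp]
  field_simp

lemma integral_hk_scale {n : ℕ} {t : ℝ} (ht : 0 < t) (F : Eucl n → ℝ) :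
    ∫ y, F y * hk n t y = ∫ z, F (√t • z) * hk n 1 z := by
  have h := Measure.integral_comp_smul (volume : Measure (Eucl n))
    (fun y => F y * hk n t y) (√t)
  simp only [finrank_euclideanSpace_fin] at h
  simp_rw [← hk_scale ht, ← mul_assoc]
  rw [integral_mul_const, h, abs_of_pos (by positivity), smul_eq_mul]
  field_simp

/-- The standard Gaussian measure. -/
noncomputable def gam (n : ℕ) : Measure (Eucl n) := densMeas n (hk n 1)

lemma densMeas_isProb {n : ℕ} {w : Eucl n → ℝ} (h0 : ∀ x, 0 ≤ w x) (hi : Integrable w)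
    (h1 : ∫ x, w x = 1) : IsProbabilityMeasure (densMeas n w) := by
  constructor
  rw [densMeas, withDensity_apply _ MeasurableSet.univ, Measure.restrict_univ,
    ← ofReal_integral_eq_lintegral_ofReal hi (Eventually.of_forall h0), h1, ENNReal.ofReal_one]

lemma integral_densMeas {n : ℕ} {w : Eucl n → ℝ} (h0 : ∀ x, 0 ≤ w x) (hm : Measurable w)
    (F : Eucl n → ℝ) : ∫ x, F x ∂(densMeas n w) = ∫ x, F x * w x := by
  rw [densMeas, integral_withDensity_eq_integral_toReal_smul (by fun_prop) (by simp)]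
  refine integral_congr_ae (Eventually.of_forall fun x => ?_)
  simp only [ENNReal.toReal_ofReal (h0 x), smul_eq_mul, mul_comm]

lemma integrable_densMeas {n : ℕ} {w : Eucl n → ℝ} (h0 : ∀ x, 0 ≤ w x) (hm : Measurable w)
    {F : Eucl n → ℝ} : Integrable F (densMeas n w) ↔ Integrable (fun x => F x * w x) := by
  rw [densMeas, integrable_withDensity_iff_integrable_smul' (by fun_prop) (by simp)]
  refine integrable_congr (Eventually.of_forall fun x => ?_)
  simp only [ENNReal.toReal_ofReal (h0 x), smul_eq_mul, mul_comm]

instance gam_isProb (n : ℕ) : IsProbabilityMeasure (gam n) :=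
  densMeas_isProb (fun x => (hk_pos one_pos x).le) (hk_integrable one_pos) (hk_integral one_pos)

lemma integral_gam {n : ℕ} (F : Eucl n → ℝ) : ∫ x, F x ∂(gam n) = ∫ x, F x * hk n 1 x :=
  integral_densMeas (fun x => (hk_pos one_pos x).le) (hk_cont n 1).measurable F

lemma integrable_gam {n : ℕ} {F : Eucl n → ℝ} :
    Integrable F (gam n) ↔ Integrable (fun x => F x * hk n 1 x) :=
  integrable_densMeas (fun x => (hk_pos one_pos x).le) (hk_cont n 1).measurable

lemma heat_gam {n : ℕ} {t : ℝ} (ht : 0 ≤ t) (f : Eucl n → ℝ) (x : Eucl n) :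
    heat n t f x = ∫ z, f (x + √t • z) ∂(gam n) := by
  rcases ht.eq_or_lt with rfl | ht
  · simp [heat_zero]
  · rw [heat_eq ht.ne', integral_gam, ← integral_hk_scale ht (fun z => f (x + z)),
      ← integral_add_left_eq_self _ x]
    simp [hk_neg]

/-- Continuous with faster than polynomial decay. -/
def Dec (n : ℕ) (w : Eucl n → ℝ) : Prop :=
  Continuous w ∧ ∀ k : ℕ, ∃ C, 0 ≤ C ∧ ∀ x, |w x| * (1 + ‖x‖) ^ k ≤ C

/-- Gaussian lower bound. -/
def GLB (n : ℕ) (w : Eucl n → ℝ) : Prop :=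
  ∃ α c : ℝ, 0 < α ∧ 0 < c ∧ ∀ x, c * Real.exp (-α * ‖x‖ ^ 2) ≤ w x

lemma GLB.pos {n : ℕ} {w : Eucl n → ℝ} (h : GLB n w) (x : Eucl n) : 0 < w x := by
  obtain ⟨α, c, _, hc, h⟩ := h
  exact lt_of_lt_of_le (by positivity) (h x)

lemma IsSchwartz.dec {n : ℕ} {w : Eucl n → ℝ} (h : IsSchwartz n w) : Dec n w := by
  obtain ⟨F, rfl⟩ := h
  refine ⟨F.continuous, fun k => ?_⟩
  have h := fun x => SchwartzMap.one_add_le_sup_seminorm_apply (𝕜 := ℝ) (m := (k, 0)) (k := k)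
    (n := 0) le_rfl le_rfl F x
  obtain ⟨C, hC⟩ : ∃ C, ∀ x, (1 + ‖x‖) ^ k * ‖iteratedFDeriv ℝ 0 (⇑F) x‖ ≤ C := ⟨_, h⟩
  simp_rw [norm_iteratedFDeriv_zero, Real.norm_eq_abs, mul_comm _ |F _|] at hC
  exact ⟨C, le_trans (by positivity) (hC 0), hC⟩

lemma hk_dec {n : ℕ} {t : ℝ} (ht : 0 < t) : Dec n (hk n t) := by
  refine ⟨hk_cont n t, fun k => ⟨Real.exp (k ^ 2 * t / 2) / (2 * Real.pi * t) ^ ((n : ℝ) / 2),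
    by positivity, fun x => ?_⟩⟩
  rw [abs_of_pos (hk_pos ht x), hk, div_mul_eq_mul_div]
  gcongr
  have h1 : (1 + ‖x‖) ^ k ≤ Real.exp (k * ‖x‖) := by
    rw [Real.exp_nat_mul]
    gcongr
    linarith [Real.add_one_le_exp ‖x‖]
  calc _ ≤ Real.exp (-‖x‖ ^ 2 / (2 * t)) * Real.exp (k * ‖x‖) := by gcongr
    _ ≤ _ := by
      rw [← Real.exp_add]
      gcongr
      have : k ^ 2 * t / 2 - (-‖x‖ ^ 2 / (2 * t) + k * ‖x‖) = (‖x‖ - k * t) ^ 2 / (2 * t) := by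
        field_simp; ring
      have : 0 ≤ (‖x‖ - k * t) ^ 2 / (2 * t) := by positivity
      linarith

lemma Dec.integrable {n : ℕ} {w : Eucl n → ℝ} (h : Dec n w) (k : ℕ) :
    Integrable (fun x => w x * (1 + ‖x‖) ^ k) := by
  obtain ⟨C, hC, hb⟩ := h.2 (k + (n + 1))
  have hi := (integrable_one_add_norm (μ := (volume : Measure (Eucl n))) (r := n + 1)
    (by simp)).const_mul C
  refine hi.mono' (h.1.mul (by fun_prop)).aestronglyMeasurable (Eventually.of_forall fun x => ?_)
  have h0 : 0 < 1 + ‖x‖ := by positivity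
  rw [Real.rpow_neg h0.le, ← div_eq_mul_inv, le_div_iff₀ (by positivity)]
  have := hb x
  rw [pow_add] at this
  rw [norm_mul, Real.norm_eq_abs, Real.norm_eq_abs, abs_of_pos (pow_pos h0 k)]
  rw [show ((n : ℝ) + 1) = ((n + 1 : ℕ) : ℝ) by push_cast; ring, Real.rpow_natCast]
  linarith

lemma Dec.integrable' {n : ℕ} {w : Eucl n → ℝ} (h : Dec n w) : Integrable w := by
  simpa using h.integrable 0

lemma gam_moment (n k : ℕ) : Integrable (fun z => (1 + ‖z‖) ^ k) (gam n) := by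
  rw [integrable_gam]
  simp_rw [mul_comm _ (hk n 1 _)]
  exact (hk_dec one_pos).integrable k

lemma peetre {n : ℕ} (x z : Eucl n) : 1 + ‖x‖ ≤ (1 + ‖x + z‖) * (1 + ‖z‖) := by
  have := norm_sub_le (x + z) z
  rw [add_sub_cancel_right] at this
  nlinarith [norm_nonneg (x + z), norm_nonneg z]

lemma peetre_pow {n : ℕ} (k : ℕ) (x z : Eucl n) :
    (1 + ‖x‖) ^ k ≤ (1 + ‖x + z‖) ^ k * (1 + ‖z‖) ^ k := by
  rw [← mul_pow]
  exact pow_le_pow_left₀ (by positivity) (peetre x z) k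

lemma peetre_smul {n : ℕ} (k : ℕ) {S r : ℝ} (hS : |r| ≤ S) (x z : Eucl n) :
    (1 + ‖x‖) ^ k ≤ (1 + ‖x + r • z‖) ^ k * ((1 + S) ^ k * (1 + ‖z‖) ^ k) := by
  refine (peetre_pow k x (r • z)).trans ?_
  rw [← mul_pow (1 + S)]
  gcongr
  rw [norm_smul, Real.norm_eq_abs]
  nlinarith [norm_nonneg z, abs_nonneg r, mul_le_mul_of_nonneg_right hS (norm_nonneg z)]

lemma Dec.bdd {n : ℕ} {w : Eucl n → ℝ} (h : Dec n w) : ∃ C, 0 ≤ C ∧ ∀ x, |w x| ≤ C := by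
  simpa using h.2 0

lemma heat_cont {n : ℕ} {t : ℝ} (ht : 0 ≤ t) {w : Eucl n → ℝ} (h : Dec n w) :
    Continuous (heat n t w) := by
  have : heat n t w = fun x => ∫ z, w (x + √t • z) ∂(gam n) := by
    ext x; exact heat_gam ht w x
  rw [this]
  obtain ⟨C, _, hb⟩ := h.bdd
  have hc := h.1
  exact continuous_of_dominated (bound := fun _ => C)
    (fun x => Continuous.aestronglyMeasurable (by fun_prop))
    (fun x => Eventually.of_forall fun z => hb _) (integrable_const _)
    (Eventually.of_forall fun z => by fun_prop)

lemma gam_int_shift {n : ℕ} {w : Eucl n → ℝ} (h : Dec n w) (x : Eucl n) (r : ℝ) :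
    Integrable (fun z => w (x + r • z)) (gam n) := by
  obtain ⟨C, _, hb⟩ := h.bdd
  have hc := h.1
  exact (integrable_const C).mono' (Continuous.aestronglyMeasurable (by fun_prop))
    (Eventually.of_forall fun z => hb _)

lemma heat_decay_unif {n : ℕ} {w : Eucl n → ℝ} (h : Dec n w) (T : ℝ) (k : ℕ) :
    ∃ C, 0 ≤ C ∧ ∀ t, 0 ≤ t → t ≤ T → ∀ x, |heat n t w x| * (1 + ‖x‖) ^ k ≤ C := by
  obtain ⟨C, hC, hb⟩ := h.2 k
  refine ⟨C * (1 + √T) ^ k * ∫ z, (1 + ‖z‖) ^ k ∂(gam n), by positivity, fun t ht htT x => ?_⟩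
  rw [heat_gam ht, ← integral_const_mul]
  have h0 : 0 ≤ (1 + ‖x‖) ^ k := by positivity
  calc _ ≤ (∫ z, |w (x + √t • z)| ∂(gam n)) * (1 + ‖x‖) ^ k := by
        gcongr; exact abs_integral_le_integral_abs
    _ = ∫ z, |w (x + √t • z)| * (1 + ‖x‖) ^ k ∂(gam n) := by rw [integral_mul_const]
    _ ≤ _ := by
      refine integral_mono ((gam_int_shift h x _).abs.mul_const _)
        ((gam_moment n k).const_mul _) fun z => ?_
      have h1 := peetre_smul k (S := √T) (r := √t)
        (by rw [abs_of_nonneg (by positivity)]; exact Real.sqrt_le_sqrt htT) x z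
      calc _ ≤ |w (x + √t • z)| * ((1 + ‖x + √t • z‖) ^ k * ((1 + √T) ^ k * (1 + ‖z‖) ^ k)) := by
            gcongr
        _ = |w (x + √t • z)| * (1 + ‖x + √t • z‖) ^ k * ((1 + √T) ^ k * (1 + ‖z‖) ^ k) := by ring
        _ ≤ C * ((1 + √T) ^ k * (1 + ‖z‖) ^ k) := by gcongr; exact hb _
        _ = _ := by ring

lemma heat_dec {n : ℕ} {w : Eucl n → ℝ} (h : Dec n w) {t : ℝ} (ht : 0 ≤ t) :
    Dec n (heat n t w) :=
  ⟨heat_cont ht h, fun k => by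
    obtain ⟨C, hC, hb⟩ := heat_decay_unif h t k
    exact ⟨C, hC, hb t ht le_rfl⟩⟩

lemma norm_add_sq_le {n : ℕ} (x y : Eucl n) : ‖x + y‖ ^ 2 ≤ 2 * ‖x‖ ^ 2 + 2 * ‖y‖ ^ 2 := by
  nlinarith [norm_add_le x y, norm_nonneg x, norm_nonneg y, norm_nonneg (x + y),
    sq_nonneg (‖x‖ - ‖y‖)]

lemma heat_glb_unif {n : ℕ} {w : Eucl n → ℝ} (h : Dec n w) (hl : GLB n w) (T : ℝ) :
    ∃ α c : ℝ, 0 < α ∧ 0 < c ∧ ∀ t, 0 ≤ t → t ≤ T →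
      ∀ x, c * Real.exp (-α * ‖x‖ ^ 2) ≤ heat n t w x := by
  obtain ⟨α, c, hα, hc, hl⟩ := hl
  have hi : Integrable (fun z => Real.exp (-(2 * α * T) * ‖z‖ ^ 2)) (gam n) ∨ T < 0 := by
    rcases lt_or_ge T 0 with hT | hT
    · exact Or.inr hT
    · left
      refine (integrable_const (1 : ℝ)).mono' (Continuous.aestronglyMeasurable (by fun_prop))
        (Eventually.of_forall fun z => ?_)
      rw [Real.norm_eq_abs, Real.abs_exp, Real.exp_le_one_iff]
      have : 0 ≤ 2 * α * T * ‖z‖ ^ 2 := by positivity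
      linarith
  rcases hi with hi | hT
  swap
  · exact ⟨1, 1, one_pos, one_pos, fun t h0 h1 => absurd (h0.trans h1) (not_le.2 hT)⟩
  refine ⟨2 * α, c * ∫ z, Real.exp (-(2 * α * T) * ‖z‖ ^ 2) ∂(gam n), by positivity,
    mul_pos hc (integral_exp_pos hi), fun t ht htT x => ?_⟩
  rw [heat_gam ht, mul_right_comm, ← integral_const_mul]
  refine integral_mono (hi.const_mul _) (gam_int_shift h x _) fun z => ?_
  refine le_trans ?_ (hl _)
  dsimp only
  rw [mul_assoc, ← Real.exp_add]
  gcongr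
  have h1 := norm_add_sq_le x (√t • z)
  rw [norm_smul √t, mul_pow, Real.norm_eq_abs, sq_abs, Real.sq_sqrt ht] at h1
  have h2 : t * ‖z‖ ^ 2 ≤ T * ‖z‖ ^ 2 := by gcongr
  nlinarith

lemma heat_glb {n : ℕ} {w : Eucl n → ℝ} (h : Dec n w) (hl : GLB n w) {t : ℝ} (ht : 0 ≤ t) :
    GLB n (heat n t w) := by
  obtain ⟨α, c, hα, hc, hb⟩ := heat_glb_unif h hl t
  exact ⟨α, c, hα, hc, hb t ht le_rfl⟩

lemma Dec.mul {n : ℕ} {w v : Eucl n → ℝ} (h : Dec n w) (h' : Dec n v) :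
    Dec n (fun x => w x * v x) := by
  refine ⟨h.1.mul h'.1, fun k => ?_⟩
  obtain ⟨C, hC, hb⟩ := h.2 k
  obtain ⟨C', hC', hb'⟩ := h'.bdd
  refine ⟨C * C', by positivity, fun x => ?_⟩
  rw [abs_mul, mul_right_comm]
  exact mul_le_mul (hb x) (hb' x) (abs_nonneg _) hC

lemma GLB.mul {n : ℕ} {w v : Eucl n → ℝ} (h : GLB n w) (h' : GLB n v) :
    GLB n (fun x => w x * v x) := by
  obtain ⟨α, c, hα, hc, hb⟩ := h
  obtain ⟨α', c', hα', hc', hb'⟩ := h'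
  refine ⟨α + α', c * c', by positivity, by positivity, fun x => ?_⟩
  calc _ = (c * Real.exp (-α * ‖x‖ ^ 2)) * (c' * Real.exp (-α' * ‖x‖ ^ 2)) := by
        rw [neg_add, add_mul, Real.exp_add]; ring
    _ ≤ _ := mul_le_mul (hb x) (hb' x) (by positivity) ((by positivity : (0:ℝ) ≤ _).trans (hb x))

/-- Logarithm of a function between a Gaussian and a constant. -/
lemma abs_log_le {C α c a r : ℝ} (hα : 0 < α) (hc : 0 < c) (h1 : c * Real.exp (-α * r ^ 2) ≤ a)
    (h2 : a ≤ C) (hr : 0 ≤ r) :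
    |Real.log a| ≤ (|Real.log C| + |Real.log c| + α) * (1 + r) ^ 2 := by
  have ha : 0 < a := lt_of_lt_of_le (by positivity) h1
  have h3 := Real.log_le_log (by positivity) h1
  rw [Real.log_mul hc.ne' (Real.exp_ne_zero _), Real.log_exp] at h3
  have h4 := Real.log_le_log ha h2
  have h5 := neg_abs_le (Real.log c)
  have h6 := le_abs_self (Real.log C)
  have h7 := abs_nonneg (Real.log c)
  have h8 := abs_nonneg (Real.log C)
  rw [abs_le]
  have : 0 ≤ (|Real.log C| + |Real.log c| + α) * (r ^ 2 + 2 * r) := by positivity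
  have e : (|Real.log C| + |Real.log c| + α) * (1 + r) ^ 2 =
    (|Real.log C| + |Real.log c| + α) * (r ^ 2 + 2 * r) + (|Real.log C| + |Real.log c| + α) := by
    ring
  have e2 : (|Real.log C| + |Real.log c| + α) * (1 + r) ^ 2 =
    (|Real.log C| + |Real.log c|) * (r ^ 2 + 2 * r) + (|Real.log C| + |Real.log c|) + α * r ^ 2
      + α * (2 * r + 1) := by
    ring
  have : 0 ≤ (|Real.log C| + |Real.log c|) * (r ^ 2 + 2 * r) := by positivity
  have : 0 ≤ α * (2 * r + 1) := by positivity
  constructor <;> nlinarith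

lemma log_bound {n : ℕ} {w : Eucl n → ℝ} (h : Dec n w) (hl : GLB n w) :
    ∃ C, 0 ≤ C ∧ ∀ x, |Real.log (w x)| ≤ C * (1 + ‖x‖) ^ 2 := by
  obtain ⟨α, c, hα, hc, hb⟩ := hl
  obtain ⟨C, hC, hC'⟩ := h.bdd
  exact ⟨_, by positivity, fun x => abs_log_le hα hc (hb x) ((le_abs_self _).trans (hC' x))
    (norm_nonneg x)⟩

lemma heat_log_unif {n : ℕ} {w : Eucl n → ℝ} (h : Dec n w) (hl : GLB n w) (T : ℝ) :
    ∃ C, 0 ≤ C ∧ ∀ t, 0 ≤ t → t ≤ T → ∀ x, |Real.log (heat n t w x)| ≤ C * (1 + ‖x‖) ^ 2 := by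
  obtain ⟨α, c, hα, hc, hb⟩ := heat_glb_unif h hl T
  obtain ⟨C, hC, hC'⟩ := heat_decay_unif h T 0
  exact ⟨_, by positivity, fun t h0 h1 x => abs_log_le hα hc (hb t h0 h1 x)
    ((le_abs_self _).trans (by simpa using hC' t h0 h1 x)) (norm_nonneg x)⟩

lemma heat_integrable_prod {n : ℕ} {t : ℝ} (ht : 0 < t) {w : Eucl n → ℝ} (h : Dec n w) :
    Integrable (fun p : Eucl n × Eucl n => w p.2 * hk n t (p.1 - p.2))
      ((volume : Measure (Eucl n)).prod volume) := by
  have h1 := Integrable.mul_prod (h.integrable') (hk_integrable (n := n) ht)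
  have h2 := (measurePreserving_prod_sub (volume : Measure (Eucl n)) volume).integrable_comp_of_integrable h1
  have h3 := h2.swap
  exact h3

lemma heat_integral {n : ℕ} {t : ℝ} (ht : 0 ≤ t) {w : Eucl n → ℝ} (h : Dec n w) :
    ∫ x, heat n t w x = ∫ x, w x := by
  rcases ht.eq_or_lt with rfl | ht
  · rw [heat_zero]
  simp_rw [heat_eq ht.ne']
  rw [integral_integral_swap (heat_integrable_prod ht h)]
  simp_rw [integral_const_mul]
  congr 1; ext y
  rw [integral_sub_right_eq_self (hk n t), hk_integral ht, mul_one]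

lemma heat_heat {n : ℕ} {s t : ℝ} (hs : 0 ≤ s) (ht : 0 ≤ t) {w : Eucl n → ℝ} (h : Dec n w) :
    heat n s (heat n t w) = heat n (s + t) w := by
  rcases hs.eq_or_lt with rfl | hs
  · rw [heat_zero, zero_add]
  rcases ht.eq_or_lt with rfl | ht
  · rw [heat_zero, add_zero]
  ext x
  rw [heat_eq hs.ne', heat_eq (by positivity)]
  simp_rw [heat_eq ht.ne', ← integral_mul_const]
  rw [integral_integral_swap]
  · congr 1; ext y
    simp_rw [mul_assoc]
    rw [integral_const_mul, ← hk_conv hs ht, ← integral_add_right_eq_self _ y]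
    congr 2; ext z
    rw [add_sub_cancel_right, sub_sub, add_comm y z, mul_comm]
  · obtain ⟨C, hC, hb⟩ := (hk_dec (n := n) hs).bdd
    refine (heat_integrable_prod ht h).mul_bdd (c := C) ?_ (Eventually.of_forall fun p => hb _)
    have := hk_cont n s
    exact Continuous.aestronglyMeasurable (by fun_prop)

end

section KL
open InformationTheory

lemma klDiv_withDensity {X : Type*} [MeasurableSpace X] {μ : Measure X} [SigmaFinite μ]
    {A B : X → ℝ} (hA : Measurable A) (hB : Measurable B) (hA0 : ∀ x, 0 < A x)
    (hB0 : ∀ x, 0 < B x)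
    (hPA : IsProbabilityMeasure (μ.withDensity fun x => ENNReal.ofReal (A x)))
    (hPB : IsProbabilityMeasure (μ.withDensity fun x => ENNReal.ofReal (B x)))
    (hi : Integrable (fun x => A x * (Real.log (A x) - Real.log (B x))) μ) :
    klDiv (μ.withDensity fun x => ENNReal.ofReal (A x))
        (μ.withDensity fun x => ENNReal.ofReal (B x)) =
      ENNReal.ofReal (∫ x, A x * (Real.log (A x) - Real.log (B x)) ∂μ) ∧
    0 ≤ ∫ x, A x * (Real.log (A x) - Real.log (B x)) ∂μ := by
  set P := μ.withDensity fun x => ENNReal.ofReal (A x) with hP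
  set Q := μ.withDensity fun x => ENNReal.ofReal (B x) with hQ
  have hμQ : μ ≪ Q := withDensity_absolutelyContinuous' (by fun_prop)
    (Eventually.of_forall fun x => by simpa using hB0 x)
  have hPμ : P ≪ μ := withDensity_absolutelyContinuous _ _
  have hPQ : P ≪ Q := hPμ.trans hμQ
  have hr : llr P Q =ᵐ[P] fun x => Real.log (A x) - Real.log (B x) := by
    have h1 := Measure.rnDeriv_withDensity_right P μ (f := fun x => ENNReal.ofReal (B x))
      (by fun_prop) (Eventually.of_forall fun x => by simpa using hB0 x)
      (Eventually.of_forall fun x => by simp)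
    have h2 := Measure.rnDeriv_withDensity μ (f := fun x => ENNReal.ofReal (A x)) (by fun_prop)
    filter_upwards [hPμ h1, hPμ h2] with x h1 h2
    rw [llr, h1, h2, ENNReal.toReal_mul, ENNReal.toReal_inv, ENNReal.toReal_ofReal (hA0 x).le,
      ENNReal.toReal_ofReal (hB0 x).le, Real.log_mul (inv_ne_zero (hB0 x).ne') (hA0 x).ne',
      Real.log_inv]
    ring
  have hInt : ∀ F : X → ℝ, ∫ x, F x ∂P = ∫ x, A x * F x ∂μ := by
    intro F
    rw [hP, integral_withDensity_eq_integral_toReal_smul (by fun_prop) (by simp)]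
    refine integral_congr_ae (Eventually.of_forall fun x => ?_)
    simp only [ENNReal.toReal_ofReal (hA0 x).le, smul_eq_mul]
  have hL : Integrable (llr P Q) P := by
    rw [integrable_congr hr, hP,
      integrable_withDensity_iff_integrable_smul' (by fun_prop) (by simp)]
    refine hi.congr (Eventually.of_forall fun x => ?_)
    simp only [ENNReal.toReal_ofReal (hA0 x).le, smul_eq_mul]
  have htop : klDiv P Q ≠ ⊤ := klDiv_ne_top_iff.2 ⟨hPQ, hL⟩
  have hval : (klDiv P Q).toReal = ∫ x, A x * (Real.log (A x) - Real.log (B x)) ∂μ := by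
    rw [toReal_klDiv_of_measure_eq hPQ (by simp), integral_congr_ae hr, hInt]
  exact ⟨by rw [← hval, ENNReal.ofReal_toReal htop], by rw [← hval]; positivity⟩

instance R01_sigmaFinite (n : ℕ) : SigmaFinite (R01 n) := by
  unfold R01; infer_instance

/-- The measure with density `f ⊗ g` with respect to the reference measure. -/
noncomputable def schrod (n : ℕ) (f g : Eucl n → ℝ) : Measure (Eucl n × Eucl n) :=
  (R01 n).withDensity fun p => ENNReal.ofReal (f p.1 * g p.2)

lemma coupling_integral_fst {n : ℕ} {μ0 μ1 : Measure (Eucl n)} {π : Measure (Eucl n × Eucl n)}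
    (hπ : Coupling π μ0 μ1) {F : Eucl n → ℝ} (hF : Measurable F) (hi : Integrable F μ0) :
    Integrable (fun p => F p.1) π ∧ ∫ p, F p.1 ∂π = ∫ x, F x ∂μ0 := by
  rw [← hπ.2.1] at hi ⊢
  exact ⟨hi.comp_measurable measurable_fst,
    (integral_map measurable_fst.aemeasurable hF.aestronglyMeasurable).symm⟩

lemma coupling_integral_snd {n : ℕ} {μ0 μ1 : Measure (Eucl n)} {π : Measure (Eucl n × Eucl n)}
    (hπ : Coupling π μ0 μ1) {F : Eucl n → ℝ} (hF : Measurable F) (hi : Integrable F μ1) :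
    Integrable (fun p => F p.2) π ∧ ∫ p, F p.2 ∂π = ∫ x, F x ∂μ1 := by
  rw [← hπ.2.2] at hi ⊢
  exact ⟨hi.comp_measurable measurable_snd,
    (integral_map measurable_snd.aemeasurable hF.aestronglyMeasurable).symm⟩

section sandwich
variable {n : ℕ} {f g : Eucl n → ℝ} {μ0 μ1 : Measure (Eucl n)} {π : Measure (Eucl n × Eucl n)}

lemma llr_schrod (hf : Measurable f) (hg : Measurable g) (hf0 : ∀ x, 0 < f x)
    (hg0 : ∀ x, 0 < g x) [IsProbabilityMeasure π] (hac : π ≪ R01 n) :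
    llr π (schrod n f g) =ᵐ[π] fun p => Real.log (π.rnDeriv (R01 n) p).toReal -
      (Real.log (f p.1) + Real.log (g p.2)) := by
  have h1 := Measure.rnDeriv_withDensity_right π (R01 n)
    (f := fun p => ENNReal.ofReal (f p.1 * g p.2))
    (by fun_prop) (Eventually.of_forall fun p => by simpa using mul_pos (hf0 _) (hg0 _))
    (Eventually.of_forall fun x => by simp)
  filter_upwards [hac h1, Measure.rnDeriv_pos hac, hac (Measure.rnDeriv_lt_top π (R01 n))]
    with p h1 h2 h3
  have h4 := (ENNReal.toReal_pos h2.ne' h3.ne).ne'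
  have hp := mul_pos (hf0 p.1) (hg0 p.2)
  rw [llr, schrod, h1, ENNReal.toReal_mul, ENNReal.toReal_inv, ENNReal.toReal_ofReal hp.le,
      Real.log_mul (inv_ne_zero hp.ne') h4, Real.log_inv, Real.log_mul (hf0 _).ne' (hg0 _).ne']
  ring

lemma schrod_ac_iff (hf : Measurable f) (hg : Measurable g) (hf0 : ∀ x, 0 < f x)
    (hg0 : ∀ x, 0 < g x) : π ≪ schrod n f g ↔ π ≪ R01 n :=
  ⟨fun h => h.trans (withDensity_absolutelyContinuous _ _), fun h => h.trans
    (withDensity_absolutelyContinuous' (by fun_prop)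
      (Eventually.of_forall fun p => by simpa using mul_pos (hf0 _) (hg0 _)))⟩

lemma le_relEnt (hf : Measurable f) (hg : Measurable g) (hf0 : ∀ x, 0 < f x)
    (hg0 : ∀ x, 0 < g x) [IsProbabilityMeasure (schrod n f g)]
    (hfi : Integrable (fun x => Real.log (f x)) μ0) (hgi : Integrable (fun x => Real.log (g x)) μ1)
    (hπ : Coupling π μ0 μ1) :
    ((∫ x, Real.log (f x) ∂μ0 + ∫ x, Real.log (g x) ∂μ1 : ℝ) : EReal) ≤ relEnt π (R01 n) := by
  have := hπ.1
  unfold relEnt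
  split_ifs with h
  swap
  · exact le_top
  have hr := llr_schrod hf hg hf0 hg0 h.1
  obtain ⟨a1, a2⟩ := coupling_integral_fst hπ (by fun_prop) hfi
  obtain ⟨b1, b2⟩ := coupling_integral_snd hπ (by fun_prop) hgi
  have hval := toReal_klDiv_of_measure_eq ((schrod_ac_iff hf hg hf0 hg0).2 h.1) (by simp)
  rw [integral_congr_ae hr, integral_sub h.2 (show Integrable (fun p => Real.log (f p.1) + Real.log (g p.2)) π from a1.add b1),
    integral_add a1 b1, a2, b2] at hval
  have : 0 ≤ (klDiv π (schrod n f g)).toReal := by positivity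
  exact_mod_cast (by linarith)

lemma relEnt_le (hf : Measurable f) (hg : Measurable g) (hf0 : ∀ x, 0 < f x)
    (hg0 : ∀ x, 0 < g x) [IsProbabilityMeasure (schrod n f g)]
    (hfi : Integrable (fun x => Real.log (f x)) μ0) (hgi : Integrable (fun x => Real.log (g x)) μ1)
    (hπ : Coupling π μ0 μ1) {h : ℝ} (h0 : 0 ≤ h)
    (hkl : klDiv π (schrod n f g) ≤ ENNReal.ofReal h) :
    relEnt π (R01 n) ≤
      ((∫ x, Real.log (f x) ∂μ0 + ∫ x, Real.log (g x) ∂μ1 + h : ℝ) : EReal) := by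
  have := hπ.1
  have htop : klDiv π (schrod n f g) ≠ ⊤ := ne_top_of_le_ne_top ENNReal.ofReal_ne_top hkl
  obtain ⟨hac, hi⟩ := klDiv_ne_top_iff.1 htop
  have hac' := (schrod_ac_iff hf hg hf0 hg0).1 hac
  have hr := llr_schrod hf hg hf0 hg0 hac'
  obtain ⟨a1, a2⟩ := coupling_integral_fst hπ (by fun_prop) hfi
  obtain ⟨b1, b2⟩ := coupling_integral_snd hπ (by fun_prop) hgi
  have hi2 : Integrable (fun p => Real.log (π.rnDeriv (R01 n) p).toReal) π := by
    refine (((integrable_congr hr).1 hi).add (a1.add b1)).congr (Eventually.of_forall fun p => ?_)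
    simp
  have hval := toReal_klDiv_of_measure_eq hac (by simp)
  rw [integral_congr_ae hr, integral_sub hi2 (show Integrable (fun p => Real.log (f p.1) + Real.log (g p.2)) π from a1.add b1),
    integral_add a1 b1, a2, b2] at hval
  have h3 : (klDiv π (schrod n f g)).toReal ≤ h := ENNReal.toReal_le_of_le_ofReal h0 hkl
  rw [relEnt, if_pos ⟨hac', hi2⟩]
  exact_mod_cast (by linarith)

lemma entCost_sandwich (hf : Measurable f) (hg : Measurable g) (hf0 : ∀ x, 0 < f x)
    (hg0 : ∀ x, 0 < g x) [IsProbabilityMeasure (schrod n f g)]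
    (hfi : Integrable (fun x => Real.log (f x)) μ0) (hgi : Integrable (fun x => Real.log (g x)) μ1)
    (hπ : Coupling π μ0 μ1) {h : ℝ} (h0 : 0 ≤ h)
    (hkl : klDiv π (schrod n f g) ≤ ENNReal.ofReal h) :
    ∫ x, Real.log (f x) ∂μ0 + ∫ x, Real.log (g x) ∂μ1 - (entLeb n μ0 + entLeb n μ1) / 2 ≤
      entCost n μ0 μ1 ∧ entCost n μ0 μ1 ≤
    ∫ x, Real.log (f x) ∂μ0 + ∫ x, Real.log (g x) ∂μ1 - (entLeb n μ0 + entLeb n μ1) / 2 + h := by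
  set L := ∫ x, Real.log (f x) ∂μ0 + ∫ x, Real.log (g x) ∂μ1
  have h1 : (L : EReal) ≤
      ⨅ π : {π : Measure (Eucl n × Eucl n) // Coupling π μ0 μ1}, relEnt (π.1) (R01 n) :=
    le_iInf fun π' => le_relEnt hf hg hf0 hg0 hfi hgi π'.2
  have h2 : ⨅ π : {π : Measure (Eucl n × Eucl n) // Coupling π μ0 μ1}, relEnt (π.1) (R01 n) ≤
      ((L + h : ℝ) : EReal) :=
    (iInf_le _ (⟨π, hπ⟩ : {π : Measure (Eucl n × Eucl n) // Coupling π μ0 μ1})).trans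
      (relEnt_le hf hg hf0 hg0 hfi hgi hπ h0 hkl)
  unfold entCost entCostE
  generalize (⨅ π : {π : Measure (Eucl n × Eucl n) // Coupling π μ0 μ1},
    relEnt (π.1) (R01 n)) = I at h1 h2
  lift I to ℝ using ⟨ne_top_of_le_ne_top (EReal.coe_ne_top _) h2,
    ne_bot_of_le_ne_bot (EReal.coe_ne_bot _) h1⟩
  rw [← EReal.coe_sub, EReal.toReal_coe]
  have h1' : L ≤ I := by exact_mod_cast h1
  have h2' : I ≤ L + h := by exact_mod_cast h2
  constructor <;> linarith

end sandwich
end KL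

lemma entLeb_densMeas {n : ℕ} {w : Eucl n → ℝ} (hw : Measurable w) (h0 : ∀ x, 0 ≤ w x) :
    entLeb n (densMeas n w) = entDens n w := by
  unfold entLeb entDens densMeas
  refine integral_congr_ae ?_
  filter_upwards [Measure.rnDeriv_withDensity (volume : Measure (Eucl n))
    (f := fun x => ENNReal.ofReal (w x)) (by fun_prop)] with x hx
  rw [hx, ENNReal.toReal_ofReal (h0 x)]

section

lemma second_diff_mvt {φ φ1 φ2 : ℝ → ℝ} (h1 : ∀ r, HasDerivAt φ (φ1 r) r)
    (h2 : ∀ r, HasDerivAt φ1 (φ2 r) r) {r : ℝ} (hr : 0 < r) :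
    ∃ ξ ∈ Ioo 0 r, φ r + φ (-r) - 2 * φ 0 = (φ2 ξ + φ2 (-ξ)) / 2 * r ^ 2 := by
  have d1 : ∀ s, HasDerivAt (fun s => φ s + φ (-s)) (φ1 s - φ1 (-s)) s := fun s =>
    ((h1 s).add ((h1 (-s)).comp s (hasDerivAt_neg s))).congr_deriv (by ring)
  have d2 : ∀ s, HasDerivAt (fun s => φ1 s - φ1 (-s)) (φ2 s + φ2 (-s)) s := fun s =>
    ((h2 s).sub ((h2 (-s)).comp s (hasDerivAt_neg s))).congr_deriv (by ring)
  have q1 : ∀ s : ℝ, HasDerivAt (fun s => s ^ 2) (2 * s) s := fun s => by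
    simpa using hasDerivAt_pow 2 s
  have q2 : ∀ s : ℝ, HasDerivAt (fun s => 2 * s) 2 s := fun s => by
    simpa using (hasDerivAt_id s).const_mul 2
  obtain ⟨η, hη, e1⟩ := exists_ratio_hasDerivAt_eq_ratio_slope _ _ hr
    (fun x _ => (d1 x).continuousAt.continuousWithinAt) (fun x _ => d1 x) _ _
    (fun x _ => (q1 x).continuousAt.continuousWithinAt) (fun x _ => q1 x)
  obtain ⟨ξ, hξ, e2⟩ := exists_ratio_hasDerivAt_eq_ratio_slope _ _ hη.1
    (fun x _ => (d2 x).continuousAt.continuousWithinAt) (fun x _ => d2 x) _ _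
    (fun x _ => (q2 x).continuousAt.continuousWithinAt) (fun x _ => q2 x)
  refine ⟨ξ, ⟨hξ.1, hξ.2.trans hη.2⟩, ?_⟩
  simp only [neg_zero, sub_self, sub_zero, mul_zero] at e1 e2
  have hη0 := hη.1.ne'
  have : φ1 η - φ1 (-η) = η * (φ2 ξ + φ2 (-ξ)) := by linarith
  rw [this] at e1
  have e3 : η * (r ^ 2 * (φ2 ξ + φ2 (-ξ))) = η * (2 * (φ r + φ (-r) - 2 * φ 0)) := by linarith
  have := mul_left_cancel₀ hη0 e3
  linarith

lemma schwartz_decay {n : ℕ} {F : Type*} [NormedAddCommGroup F] [NormedSpace ℝ F]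
    (G : SchwartzMap (Eucl n) F) (k : ℕ) :
    ∃ C, 0 ≤ C ∧ ∀ x, ‖G x‖ * (1 + ‖x‖) ^ k ≤ C := by
  have h := fun x => SchwartzMap.one_add_le_sup_seminorm_apply (𝕜 := ℝ) (m := (k, 0)) (k := k)
    (n := 0) le_rfl le_rfl G x
  obtain ⟨C, hC⟩ : ∃ C, ∀ x, (1 + ‖x‖) ^ k * ‖iteratedFDeriv ℝ 0 (⇑G) x‖ ≤ C := ⟨_, h⟩
  simp_rw [norm_iteratedFDeriv_zero, mul_comm _ ‖G _‖] at hC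
  exact ⟨C, le_trans (by positivity) (hC 0), hC⟩

/-- Second derivative of `r ↦ hk 1 (w - r z)`. -/
lemma hk_line {n : ℕ} (w z : Eucl n) (r : ℝ) :
    HasDerivAt (fun r : ℝ => hk n 1 (w - r • z)) (hk n 1 (w - r • z) * inner ℝ (w - r • z) z) r := by
  have h1 : HasDerivAt (fun r : ℝ => w - r • z) (-z) r := by
    have := ((hasDerivAt_id r).smul_const z).const_sub w
    simpa using this
  have h2 := h1.norm_sq
  unfold hk
  refine (((h2.neg.div_const (2 * 1)).exp).div_const _).congr_deriv ?_
  rw [inner_neg_right]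
  simp only [Pi.neg_apply]
  ring

lemma hk_line2 {n : ℕ} (w z : Eucl n) (r : ℝ) :
    HasDerivAt (fun r : ℝ => hk n 1 (w - r • z) * inner ℝ (w - r • z) z)
      (hk n 1 (w - r • z) * (inner ℝ (w - r • z) z ^ 2 - ‖z‖ ^ 2)) r := by
  have h1 : HasDerivAt (fun r : ℝ => w - r • z) (-z) r := by
    have := ((hasDerivAt_id r).smul_const z).const_sub w
    simpa using this
  have h3 := h1.inner ℝ (hasDerivAt_const r z)
  refine ((hk_line w z r).mul h3).congr_deriv ?_
  rw [inner_zero_right, inner_neg_left, real_inner_self_eq_norm_sq]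
  ring

lemma schwartz_line {n : ℕ} {F : Type*} [NormedAddCommGroup F] [NormedSpace ℝ F]
    (G : SchwartzMap (Eucl n) F) (y z : Eucl n) (r : ℝ) :
    HasDerivAt (fun r : ℝ => G (y + r • z)) (SchwartzMap.fderivCLM ℝ _ _ G (y + r • z) z) r := by
  have h1 : HasDerivAt (fun r : ℝ => y + r • z) z r := by
    have := ((hasDerivAt_id r).smul_const z).const_add y
    simpa using this
  have := (G.differentiableAt (x := y + r • z)).hasFDerivAt.comp_hasDerivAt r h1
  exact this

set_option maxHeartbeats 1000000 in
/-- Control of symmetric second differences of `y ↦ p₁(x - y) g(y)`. -/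
lemma second_diff {n : ℕ} {g : Eucl n → ℝ} (hg : IsSchwartz n g) :
    ∃ φ2 : Eucl n → Eucl n → Eucl n → ℝ → ℝ, (∀ x y z, Continuous (φ2 x y z)) ∧
      (∀ k : ℕ, ∃ C, 0 ≤ C ∧ ∀ x y z r, |r| ≤ 1 →
        |φ2 x y z r| * (1 + ‖y‖) ^ k ≤ C * (1 + ‖z‖) ^ (k + 4)) ∧
      (∀ x y z r, 0 < r → ∃ ξ ∈ Ioo 0 r,
        hk n 1 (x - (y + r • z)) * g (y + r • z) + hk n 1 (x - (y + (-r) • z)) * g (y + (-r) • z)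
          - 2 * (hk n 1 (x - y) * g y) = (φ2 x y z ξ + φ2 x y z (-ξ)) / 2 * r ^ 2) := by
  obtain ⟨G, rfl⟩ := hg
  set G1 := SchwartzMap.fderivCLM ℝ _ _ G with hG1
  set G2 := SchwartzMap.fderivCLM ℝ _ _ G1 with hG2
  have hkc := hk_cont n 1
  have hc0 := G.continuous
  have hc1 := G1.continuous
  have hc2 := G2.continuous
  refine ⟨fun x y z r => hk n 1 ((x - y) - r • z) * (inner ℝ ((x - y) - r • z) z ^ 2 - ‖z‖ ^ 2) *
      G (y + r • z) + 2 * (hk n 1 ((x - y) - r • z) * inner ℝ ((x - y) - r • z) z *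
      G1 (y + r • z) z) + hk n 1 ((x - y) - r • z) * G2 (y + r • z) z z, ?_, ?_, ?_⟩
  · intro x y z
    fun_prop
  · intro k
    obtain ⟨C, hC, hb⟩ := (hk_dec (n := n) one_pos).2 2
    obtain ⟨C0, hC0, hb0⟩ := schwartz_decay G k
    obtain ⟨C1, hC1, hb1⟩ := schwartz_decay G1 k
    obtain ⟨C2, hC2, hb2⟩ := schwartz_decay G2 k
    refine ⟨(C * C0 * 2 + 2 * (C * C1) + C * C2) * 2 ^ k, by positivity, fun x y z r hr => ?_⟩
    have hp := peetre_smul k hr y z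
    rw [one_add_one_eq_two] at hp
    set w := (x - y) - r • z
    set y' := y + r • z
    have ha := hb w
    rw [abs_of_pos (hk_pos one_pos w)] at ha
    have hP : 0 < hk n 1 w := hk_pos one_pos w
    set P := hk n 1 w
    set Z := 1 + ‖z‖ with hZ
    have hZ1 : 1 ≤ Z := by simp [hZ]
    have hzZ : ‖z‖ ≤ Z := by simp [hZ]
    have hin : |inner ℝ w z| ≤ (1 + ‖w‖) * Z :=
      (abs_real_inner_le_norm w z).trans (by gcongr; linarith)
    have b1 : |P * (inner ℝ w z ^ 2 - ‖z‖ ^ 2)| ≤ C * 2 * Z ^ 4 := by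
      rw [abs_mul, abs_of_pos hP]
      have h1 : |inner ℝ w z ^ 2 - ‖z‖ ^ 2| ≤ (1 + ‖w‖) ^ 2 * (2 * Z ^ 2) := by
        have e1 : |inner ℝ w z| ^ 2 ≤ ((1 + ‖w‖) * Z) ^ 2 := by gcongr
        rw [sq_abs] at e1
        have e2 : ‖z‖ ^ 2 ≤ ((1 + ‖w‖) * Z) ^ 2 := by
          gcongr
          nlinarith [norm_nonneg w]
        rw [abs_le]
        constructor <;> nlinarith [sq_nonneg (inner ℝ w z), sq_nonneg ‖z‖]
      calc _ ≤ P * ((1 + ‖w‖) ^ 2 * (2 * Z ^ 2)) := by gcongr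
        _ = P * (1 + ‖w‖) ^ 2 * (2 * Z ^ 2) := by ring
        _ ≤ C * (2 * Z ^ 4) := by
          gcongr
          · norm_num
        _ = _ := by ring
    have b2 : |P * inner ℝ w z| ≤ C * Z := by
      rw [abs_mul, abs_of_pos hP]
      calc _ ≤ P * ((1 + ‖w‖) * Z) := by gcongr
        _ ≤ P * ((1 + ‖w‖) ^ 2 * Z) := by
          gcongr
          nlinarith [norm_nonneg w]
        _ = P * (1 + ‖w‖) ^ 2 * Z := by ring
        _ ≤ _ := by gcongr
    have b3 : |P| ≤ C := by
      rw [abs_of_pos hP]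
      refine le_trans ?_ ha
      nlinarith [norm_nonneg w, sq_nonneg ‖w‖]
    have c1 : |G1 y' z| ≤ ‖G1 y'‖ * Z := by
      rw [← Real.norm_eq_abs]
      exact (ContinuousLinearMap.le_opNorm (G1 y') z).trans (by gcongr)
    have c2 : |G2 y' z z| ≤ ‖G2 y'‖ * Z * Z := by
      rw [← Real.norm_eq_abs]
      exact (ContinuousLinearMap.le_opNorm₂ (G2 y') z z).trans (by gcongr)
    have key : |P * (inner ℝ w z ^ 2 - ‖z‖ ^ 2) * G y' + 2 * (P * inner ℝ w z * G1 y' z) +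
        P * G2 y' z z| ≤ (C * 2 * ‖G y'‖ + 2 * (C * ‖G1 y'‖) + C * ‖G2 y'‖) * Z ^ 4 := by
      refine (abs_add_three _ _ _).trans ?_
      have e1 : |P * (inner ℝ w z ^ 2 - ‖z‖ ^ 2) * G y'| ≤ C * 2 * ‖G y'‖ * Z ^ 4 := by
        rw [abs_mul, ← Real.norm_eq_abs (G y')]
        calc _ ≤ C * 2 * Z ^ 4 * ‖G y'‖ := by gcongr
          _ = _ := by ring
      have e2 : |2 * (P * inner ℝ w z * G1 y' z)| ≤ 2 * (C * ‖G1 y'‖) * Z ^ 4 := by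
        rw [abs_mul, abs_mul, abs_two]
        calc _ ≤ 2 * (C * Z * (‖G1 y'‖ * Z)) := by gcongr
          _ = 2 * (C * ‖G1 y'‖) * Z ^ 2 := by ring
          _ ≤ _ := by gcongr; norm_num
      have e3 : |P * G2 y' z z| ≤ C * ‖G2 y'‖ * Z ^ 4 := by
        rw [abs_mul]
        calc _ ≤ C * (‖G2 y'‖ * Z * Z) := by gcongr
          _ = C * ‖G2 y'‖ * Z ^ 2 := by ring
          _ ≤ _ := by gcongr; norm_num
      linarith
    calc _ ≤ (C * 2 * ‖G y'‖ + 2 * (C * ‖G1 y'‖) + C * ‖G2 y'‖) * Z ^ 4 *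
          ((1 + ‖y'‖) ^ k * (2 ^ k * Z ^ k)) := by gcongr
      _ = (C * 2 * (‖G y'‖ * (1 + ‖y'‖) ^ k) + 2 * (C * (‖G1 y'‖ * (1 + ‖y'‖) ^ k)) +
          C * (‖G2 y'‖ * (1 + ‖y'‖) ^ k)) * 2 ^ k * Z ^ (k + 4) := by ring
      _ ≤ (C * 2 * C0 + 2 * (C * C1) + C * C2) * 2 ^ k * Z ^ (k + 4) := by
        gcongr
        · exact hb0 y'
        · exact hb1 y'
        · exact hb2 y'
      _ = _ := by ring
  · intro x y z r hr
    have d0 := fun s => schwartz_line G y z s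
    have d1 : ∀ s, HasDerivAt (fun r : ℝ => G1 (y + r • z) z) (G2 (y + s • z) z z) s := fun s => by
      have := (schwartz_line G1 y z s).clm_apply (hasDerivAt_const s z)
      rw [map_zero, add_zero] at this
      exact this
    have D1 : ∀ s, HasDerivAt (fun r : ℝ => hk n 1 ((x - y) - r • z) * G (y + r • z))
        (hk n 1 ((x - y) - s • z) * inner ℝ ((x - y) - s • z) z * G (y + s • z)
        + hk n 1 ((x - y) - s • z) * G1 (y + s • z) z) s :=
      fun s => (hk_line (x - y) z s).fun_mul (d0 s)
    have D2 : ∀ s, HasDerivAt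
        (fun r : ℝ => hk n 1 ((x - y) - r • z) * inner ℝ ((x - y) - r • z) z * G (y + r • z)
        + hk n 1 ((x - y) - r • z) * G1 (y + r • z) z)
        (hk n 1 ((x - y) - s • z) * (inner ℝ ((x - y) - s • z) z ^ 2 - ‖z‖ ^ 2) *
      G (y + s • z) + 2 * (hk n 1 ((x - y) - s • z) * inner ℝ ((x - y) - s • z) z *
      G1 (y + s • z) z) + hk n 1 ((x - y) - s • z) * G2 (y + s • z) z z) s :=
      fun s => (((hk_line2 (x - y) z s).fun_mul (d0 s)).fun_add
        ((hk_line (x - y) z s).fun_mul (d1 s))).congr_deriv (by ring)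
    obtain ⟨ξ, hξ, e⟩ := second_diff_mvt D1 D2 hr
    refine ⟨ξ, hξ, ?_⟩
    rw [← e]
    simp only [zero_smul, sub_zero, add_zero, sub_sub]

end

section

/-- The function `y ↦ p₁(x - y) g(y)`. -/
noncomputable def hker (n : ℕ) (g : Eucl n → ℝ) (x y : Eucl n) : ℝ := hk n 1 (x - y) * g y

lemma hker_bound {n : ℕ} {g : Eucl n → ℝ} (hg : Dec n g) (k : ℕ) :
    ∃ C, 0 ≤ C ∧ ∀ x y, |hker n g x y| * (1 + ‖y‖) ^ k ≤ C := by
  obtain ⟨C, hC, hb⟩ := hg.2 k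
  obtain ⟨C', hC', hb'⟩ := (hk_dec (n := n) one_pos).bdd
  refine ⟨C' * C, by positivity, fun x y => ?_⟩
  rw [hker, abs_mul, mul_assoc]
  exact mul_le_mul (hb' _) (hb y) (by positivity) hC'

lemma hker_cont {n : ℕ} {g : Eucl n → ℝ} (hg : Dec n g) {X : Type*} [TopologicalSpace X]
    {a b : X → Eucl n} (ha : Continuous a) (hb : Continuous b) :
    Continuous (fun p => hker n g (a p) (b p)) :=
  ((hk_cont n 1).comp (ha.sub hb)).mul (hg.1.comp hb)

lemma hker_dec {n : ℕ} {g : Eucl n → ℝ} (hg : Dec n g) (x : Eucl n) : Dec n (hker n g x) :=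
  ⟨hker_cont hg continuous_const continuous_id, fun k => by
    obtain ⟨C, hC, hb⟩ := hker_bound hg k
    exact ⟨C, hC, hb x⟩⟩

/-- The heat flow of `hker` in the second variable. -/
noncomputable def Kk (n : ℕ) (g : Eucl n → ℝ) (ε : ℝ) (x y : Eucl n) : ℝ :=
  heat n ε (hker n g x) y

lemma Kk_cont {n : ℕ} {g : Eucl n → ℝ} (hg : Dec n g) {ε : ℝ} (hε : 0 ≤ ε) {X : Type*}
    [TopologicalSpace X] [FirstCountableTopology X]
    {a b : X → Eucl n} (ha : Continuous a) (hb : Continuous b) :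
    Continuous (fun p => Kk n g ε (a p) (b p)) := by
  have : (fun p => Kk n g ε (a p) (b p)) =
      fun p => ∫ z, hker n g (a p) (b p + √ε • z) ∂(gam n) := by
    ext p; exact heat_gam hε _ _
  rw [this]
  obtain ⟨C, _, hbd⟩ := hker_bound hg 0
  refine continuous_of_dominated (bound := fun _ => C)
    (fun p => Continuous.aestronglyMeasurable ?_)
    (fun p => Eventually.of_forall fun z => by simpa using hbd _ _) (integrable_const _)
    (Eventually.of_forall fun z => ?_)
  · exact hker_cont hg (by fun_prop) (by fun_prop)
  · exact hker_cont hg (by fun_prop) (by fun_prop)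

lemma Kk_zero {n : ℕ} (g : Eucl n → ℝ) (x y : Eucl n) : Kk n g 0 x y = hker n g x y := by
  rw [Kk, heat_zero]

lemma gam_symm {n : ℕ} (F : Eucl n → ℝ) : ∫ z, F (-z) ∂(gam n) = ∫ z, F z ∂(gam n) := by
  rw [integral_gam, integral_gam, ← integral_neg_eq_self (fun z => F z * hk n 1 z)]
  simp_rw [hk_neg]

lemma Kk_sub {n : ℕ} {g : Eucl n → ℝ} (hg : Dec n g) {ε : ℝ} (hε : 0 ≤ ε) (x y : Eucl n) :
    Kk n g ε x y - hker n g x y = ∫ z, (hker n g x (y + √ε • z) + hker n g x (y + (-√ε) • z)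
      - 2 * hker n g x y) / 2 ∂(gam n) := by
  have i1 := gam_int_shift (hker_dec hg x) y (√ε)
  have i2 := gam_int_shift (hker_dec hg x) y (-√ε)
  rw [integral_div, integral_sub (show Integrable (fun z => hker n g x (y + √ε • z) +
    hker n g x (y + (-√ε) • z)) (gam n) from i1.add i2) (integrable_const _), integral_add i1 i2,
    ← gam_symm (fun z => hker n g x (y + (-√ε) • z)), Kk, heat_gam hε]
  simp only [smul_neg, neg_smul, neg_neg, integral_const, probReal_univ, one_smul]
  ring

lemma Kk_diff {n : ℕ} {g : Eucl n → ℝ} (hg : IsSchwartz n g) (k : ℕ) :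
    ∃ C, 0 ≤ C ∧ ∀ ε, 0 ≤ ε → ε ≤ 1 → ∀ x y,
      |Kk n g ε x y - hker n g x y| * (1 + ‖y‖) ^ k ≤ C * ε := by
  obtain ⟨φ2, _, hb, hS⟩ := second_diff hg
  obtain ⟨C, hC, hb⟩ := hb k
  refine ⟨C / 2 * ∫ z, (1 + ‖z‖) ^ (k + 4) ∂(gam n), by positivity, fun ε h0 h1 x y => ?_⟩
  rcases h0.eq_or_lt with rfl | h0
  · simp [Kk_zero]
  have hs0 : 0 < √ε := Real.sqrt_pos.2 h0
  have hs1 : √ε ≤ 1 := Real.sqrt_le_one.2 h1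
  rw [Kk_sub hg.dec h0.le, ← abs_of_nonneg (by positivity : 0 ≤ (1 + ‖y‖) ^ k), ← abs_mul,
    ← integral_mul_const]
  have hi := ((gam_moment n (k + 4)).const_mul (C / 2 * ε))
  have := norm_integral_le_of_norm_le (f := fun z => (hker n g x (y + √ε • z) +
    hker n g x (y + (-√ε) • z) - 2 * hker n g x y) / 2 * (1 + ‖y‖) ^ k) hi
    (Eventually.of_forall fun z => ?_)
  · rw [integral_const_mul] at this
    refine this.trans (le_of_eq ?_)
    ring
  · obtain ⟨ξ, hξ, e⟩ := hS x y z _ hs0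
    simp only [hker]
    rw [e, Real.sq_sqrt h0.le, Real.norm_eq_abs, abs_mul, abs_of_nonneg (by positivity : 0 ≤ (1 + ‖y‖) ^ k)]
    have c1 := hb x y z ξ (by rw [abs_of_pos hξ.1]; linarith [hξ.2])
    have c2 := hb x y z (-ξ) (by rw [abs_neg, abs_of_pos hξ.1]; linarith [hξ.2])
    rw [abs_div, abs_mul, abs_div, abs_two, abs_of_pos h0]
    have := abs_add_le (φ2 x y z ξ) (φ2 x y z (-ξ))
    have hk0 : 0 ≤ (1 + ‖y‖) ^ k := by positivity
    calc _ ≤ (|φ2 x y z ξ| + |φ2 x y z (-ξ)|) / 2 * ε / 2 * (1 + ‖y‖) ^ k := by gcongr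
      _ = (|φ2 x y z ξ| * (1 + ‖y‖) ^ k + |φ2 x y z (-ξ)| * (1 + ‖y‖) ^ k) / 4 * ε := by ring
      _ ≤ (C * (1 + ‖z‖) ^ (k + 4) + C * (1 + ‖z‖) ^ (k + 4)) / 4 * ε := by gcongr
      _ = _ := by ring

lemma Kk_lim {n : ℕ} {g : Eucl n → ℝ} (hg : IsSchwartz n g) :
    ∃ L : Eucl n → Eucl n → ℝ, ∀ x y,
      Tendsto (fun ε => (Kk n g ε x y - hker n g x y) / ε) (𝓝[>] 0) (𝓝 (L x y)) := by
  obtain ⟨φ2, hφc, hb, hS⟩ := second_diff hg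
  obtain ⟨C, hC, hb⟩ := hb 0
  refine ⟨fun x y => ∫ z, φ2 x y z 0 / 2 ∂(gam n), fun x y => ?_⟩
  have hev : ∀ᶠ ε : ℝ in 𝓝[>] 0, ε ∈ Ioo (0:ℝ) 1 := Ioo_mem_nhdsGT one_pos
  have heq : (fun ε => (Kk n g ε x y - hker n g x y) / ε) =ᶠ[𝓝[>] 0] fun ε =>
      ∫ z, (hker n g x (y + √ε • z) + hker n g x (y + (-√ε) • z)
      - 2 * hker n g x y) / 2 / ε ∂(gam n) := by
    filter_upwards [hev] with ε hε
    rw [Kk_sub hg.dec hε.1.le, ← integral_div]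
  rw [tendsto_congr' heq]
  have hcx := (hker_dec hg.dec x).1
  refine tendsto_integral_filter_of_dominated_convergence
    (fun z => C / 2 * (1 + ‖z‖) ^ 4) ?_ ?_ ((gam_moment n 4).const_mul _) ?_
  · exact Eventually.of_forall fun ε => Continuous.aestronglyMeasurable (by fun_prop)
  · filter_upwards [hev] with ε hε
    refine Eventually.of_forall fun z => ?_
    have hs0 : 0 < √ε := Real.sqrt_pos.2 hε.1
    have hs1 : √ε ≤ 1 := Real.sqrt_le_one.2 hε.2.le
    obtain ⟨ξ, hξ, e⟩ := hS x y z _ hs0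
    have c1 := hb x y z ξ (by rw [abs_of_pos hξ.1]; linarith [hξ.2])
    have c2 := hb x y z (-ξ) (by rw [abs_neg, abs_of_pos hξ.1]; linarith [hξ.2])
    simp only [pow_zero, mul_one, zero_add] at c1 c2
    simp only [hker]
    have hε0 := hε.1.ne'
    rw [e, Real.sq_sqrt hε.1.le, Real.norm_eq_abs]
    have : (φ2 x y z ξ + φ2 x y z (-ξ)) / 2 * ε / 2 / ε = (φ2 x y z ξ + φ2 x y z (-ξ)) / 4 := by
      field_simp; norm_num
    rw [this, abs_div, abs_of_pos (by norm_num : (0:ℝ) < 4)]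
    linarith [abs_add_le (φ2 x y z ξ) (φ2 x y z (-ξ))]
  · refine Eventually.of_forall fun z => ?_
    have hch : ∀ ε : ℝ, ∃ ξ, 0 < ε → ξ ∈ Ioo 0 √ε ∧
        hk n 1 (x - (y + √ε • z)) * g (y + √ε • z) + hk n 1 (x - (y + (-√ε) • z)) * g (y + (-√ε) • z)
          - 2 * (hk n 1 (x - y) * g y) = (φ2 x y z ξ + φ2 x y z (-ξ)) / 2 * √ε ^ 2 := by
      intro ε
      by_cases h : 0 < ε
      · obtain ⟨ξ, h1, h2⟩ := hS x y z _ (Real.sqrt_pos.2 h)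
        exact ⟨ξ, fun _ => ⟨h1, h2⟩⟩
      · exact ⟨0, fun h' => absurd h' h⟩
    choose ξ hξ using hch
    have hξ0 : Tendsto ξ (𝓝[>] 0) (𝓝 0) := by
      have h1 : Tendsto (fun ε : ℝ => √ε) (𝓝[>] 0) (𝓝 0) := by
        have := Real.continuous_sqrt.tendsto 0
        rw [Real.sqrt_zero] at this
        exact this.mono_left nhdsWithin_le_nhds
      refine tendsto_of_tendsto_of_tendsto_of_le_of_le' tendsto_const_nhds h1 ?_ ?_
      · filter_upwards [hev] with ε hε using (hξ ε hε.1).1.1.le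
      · filter_upwards [hev] with ε hε using (hξ ε hε.1).1.2.le
    have hlim : Tendsto (fun ε => (φ2 x y z (ξ ε) + φ2 x y z (-(ξ ε))) / 4) (𝓝[>] 0)
        (𝓝 ((φ2 x y z 0 + φ2 x y z (-0)) / 4)) :=
      ((((hφc x y z).tendsto 0).comp hξ0).add
        (((hφc x y z).tendsto (-0)).comp hξ0.neg)).div_const 4
    have e0 : (φ2 x y z 0 + φ2 x y z (-0)) / 4 = φ2 x y z 0 / 2 := by rw [neg_zero]; ring
    rw [e0] at hlim
    refine hlim.congr' ?_
    filter_upwards [hev] with ε hε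
    have e := (hξ ε hε.1).2
    simp only [hker]
    have hε0 := hε.1.ne'
    rw [e, Real.sq_sqrt hε.1.le]
    field_simp; norm_num

lemma hk_glb {n : ℕ} {t : ℝ} (ht : 0 < t) : GLB n (hk n t) := by
  refine ⟨1 / (2 * t), 1 / (2 * Real.pi * t) ^ ((n : ℝ) / 2), by positivity, by positivity,
    fun x => le_of_eq ?_⟩
  rw [hk]
  have : -(1 / (2 * t)) * ‖x‖ ^ 2 = -‖x‖ ^ 2 / (2 * t) := by ring
  rw [this]; ring

lemma Kk_lower {n : ℕ} {g : Eucl n → ℝ} (hg : Dec n g) (hl : GLB n g) :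
    ∃ α c : ℝ, 0 < α ∧ 0 < c ∧ ∀ ε, 0 ≤ ε → ε ≤ 1 → ∀ x y,
      c * Real.exp (-α * (‖x‖ + ‖y‖) ^ 2) ≤ Kk n g ε x y := by
  have hh : (0:ℝ) < 1 / 2 := by norm_num
  obtain ⟨α, c, hα, hc, hb⟩ := heat_glb_unif ((hk_dec hh).mul hg) ((hk_glb hh).mul hl) 1
  set κ := (2 * Real.pi * (1 / 2)) ^ ((n : ℝ) / 2) / (2 * Real.pi * 1) ^ ((n : ℝ) / 2) with hκ
  have hκ0 : 0 < κ := by positivity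
  refine ⟨1 + α, κ * c, by positivity, by positivity, fun ε h0 h1 x y => ?_⟩
  have key : ∀ y, κ * Real.exp (-‖x‖ ^ 2) * (hk n (1 / 2) y * g y) ≤ hker n g x y := by
    intro y
    rw [hker, ← mul_assoc]
    refine mul_le_mul_of_nonneg_right ?_ (hl.pos y).le
    unfold hk
    rw [hκ, show ∀ a b c d : ℝ, a / b * c * (d / a) = (a / a) * (c * d) / b by intros; ring,
      div_self (by positivity), one_mul, ← Real.exp_add]
    gcongr
    have := norm_add_sq_le x (-y)
    rw [norm_neg, ← sub_eq_add_neg] at this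
    linarith
  calc _ ≤ κ * Real.exp (-‖x‖ ^ 2) * (c * Real.exp (-α * ‖y‖ ^ 2)) := by
        rw [show κ * Real.exp (-‖x‖ ^ 2) * (c * Real.exp (-α * ‖y‖ ^ 2)) =
          κ * c * (Real.exp (-‖x‖ ^ 2) * Real.exp (-α * ‖y‖ ^ 2)) by ring, ← Real.exp_add]
        gcongr
        have h1 : ‖x‖ ^ 2 ≤ (‖x‖ + ‖y‖) ^ 2 := by gcongr; linarith [norm_nonneg y]
        have h2 : ‖y‖ ^ 2 ≤ (‖x‖ + ‖y‖) ^ 2 := by gcongr; linarith [norm_nonneg x]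
        nlinarith
    _ ≤ κ * Real.exp (-‖x‖ ^ 2) * heat n ε (fun y => hk n (1 / 2) y * g y) y := by
        gcongr
        exact hb ε h0 h1 y
    _ ≤ _ := by
        rw [Kk, heat_gam h0, heat_gam h0, ← integral_const_mul]
        exact integral_mono ((gam_int_shift ((hk_dec hh).mul hg) y _).const_mul _)
          (gam_int_shift (hker_dec hg x) y _) fun z => key _

lemma Kk_log {n : ℕ} {g : Eucl n → ℝ} (hg : IsSchwartz n g) (hl : GLB n g) :
    ∃ C, 0 ≤ C ∧ ∀ ε, 0 ≤ ε → ε ≤ 1 → ∀ x y,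
      |Real.log (Kk n g ε x y)| ≤ C * ((1 + ‖x‖) ^ 2 * (1 + ‖y‖) ^ 2) := by
  obtain ⟨α, c, hα, hc, hb⟩ := Kk_lower hg.dec hl
  obtain ⟨C, hC, hC'⟩ := hker_bound hg.dec 0
  obtain ⟨D, hD, hD'⟩ := Kk_diff hg 0
  refine ⟨_, by positivity, fun ε h0 h1 x y => (abs_log_le hα hc (hb ε h0 h1 x y) (C := C + D) ?_
    (by positivity)).trans (mul_le_mul_of_nonneg_left ?_ (by positivity))⟩
  · have a1 := hC' x y
    have a2 := hD' ε h0 h1 x y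
    rw [pow_zero, mul_one] at a1 a2
    have := le_abs_self (Kk n g ε x y - hker n g x y)
    have := le_abs_self (hker n g x y)
    nlinarith
  · rw [← mul_pow]
    gcongr
    nlinarith [norm_nonneg x, norm_nonneg y, mul_nonneg (norm_nonneg x) (norm_nonneg y)]

end

section

lemma withDens_map_fst {n : ℕ} {ρ : Eucl n × Eucl n → ℝ} (hm : Measurable ρ) (h0 : ∀ p, 0 ≤ ρ p)
    {u : Eucl n → ℝ} (hxi : ∀ x, Integrable fun y => ρ (x, y)) (hu : ∀ x, ∫ y, ρ (x, y) = u x) :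
    (volume.withDensity fun p => ENNReal.ofReal (ρ p)).map Prod.fst = densMeas n u := by
  ext s hs
  rw [Measure.map_apply measurable_fst hs, withDensity_apply _ (measurable_fst hs), densMeas,
    withDensity_apply _ hs, ← prod_univ, Measure.volume_eq_prod, ← Measure.prod_restrict,
    Measure.restrict_univ, lintegral_prod _ (by fun_prop)]
  refine lintegral_congr fun x => ?_
  rw [← hu, ofReal_integral_eq_lintegral_ofReal (hxi x) (Eventually.of_forall fun y => h0 _)]

lemma withDens_map_snd {n : ℕ} {ρ : Eucl n × Eucl n → ℝ} (hm : Measurable ρ) (h0 : ∀ p, 0 ≤ ρ p)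
    {w : Eucl n → ℝ} (hyi : ∀ y, Integrable fun x => ρ (x, y)) (hw : ∀ y, ∫ x, ρ (x, y) = w y) :
    (volume.withDensity fun p => ENNReal.ofReal (ρ p)).map Prod.snd = densMeas n w := by
  ext s hs
  rw [Measure.map_apply measurable_snd hs, withDensity_apply _ (measurable_snd hs), densMeas,
    withDensity_apply _ hs, ← univ_prod, Measure.volume_eq_prod, ← Measure.prod_restrict,
    Measure.restrict_univ, lintegral_prod_symm _ (by fun_prop)]
  refine lintegral_congr fun x => ?_
  rw [← hw, ofReal_integral_eq_lintegral_ofReal (hyi x) (Eventually.of_forall fun y => h0 _)]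

lemma coupling_of_dens {n : ℕ} {ρ : Eucl n × Eucl n → ℝ} (hm : Measurable ρ) (h0 : ∀ p, 0 ≤ ρ p)
    {u w : Eucl n → ℝ} (hxi : ∀ x, Integrable fun y => ρ (x, y)) (hu : ∀ x, ∫ y, ρ (x, y) = u x)
    (hyi : ∀ y, Integrable fun x => ρ (x, y)) (hw : ∀ y, ∫ x, ρ (x, y) = w y)
    (hU : IsProbabilityMeasure (densMeas n u)) :
    Coupling (volume.withDensity fun p => ENNReal.ofReal (ρ p)) (densMeas n u) (densMeas n w) := by
  have h1 := withDens_map_fst hm h0 hxi hu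
  refine ⟨⟨?_⟩, h1, withDens_map_snd hm h0 hyi hw⟩
  have := hU.measure_univ
  rwa [← h1, Measure.map_apply measurable_fst MeasurableSet.univ, preimage_univ] at this

lemma schrod_eq {n : ℕ} {f g : Eucl n → ℝ} (hf : Dec n f) (hg : Dec n g) :
    schrod n f g = volume.withDensity fun p => ENNReal.ofReal (f p.1 * hker n g p.1 p.2) := by
  have := hf.1
  have := hg.1
  have h2 : Measurable fun p : Eucl n × Eucl n => ENNReal.ofReal (f p.1 * g p.2) :=
    Measurable.ennreal_ofReal (Continuous.measurable (by fun_prop))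
  rw [schrod, R01, ← withDensity_mul _ (by fun_prop) h2]
  congr 1
  ext p
  simp only [Pi.mul_apply]
  rw [← ENNReal.ofReal_mul (by positivity), hker, hk]
  congr 1
  rw [mul_one, mul_one]
  ring

section t0
variable {n : ℕ} {f g : Eucl n → ℝ}

lemma dec_const_int (hf : Dec n f) {F : Eucl n → ℝ} (hF : Continuous F) {C : ℝ}
    (hC : ∀ x, |F x| ≤ C) : Integrable (fun x => f x * F x) :=
  hf.integrable'.mul_bdd (c := C) hF.aestronglyMeasurable (Eventually.of_forall fun x => hC x)

lemma V_eq (f g : Eucl n → ℝ) (y : Eucl n) :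
    g y * heat n 1 f y = ∫ x, f x * hker n g x y := by
  rw [heat_eq one_ne_zero, ← integral_const_mul]
  congr 1; ext x
  rw [hker, hk_sub_comm]; ring

lemma U_eq (hg : Dec n g) {ε : ℝ} (hε : 0 ≤ ε) (x : Eucl n) :
    f x * heat n 1 g x = ∫ y, f x * Kk n g ε x y := by
  rw [integral_const_mul]
  unfold Kk
  rw [heat_integral hε (hker_dec hg x), heat_eq one_ne_zero]
  congr 2; ext y
  rw [hker, mul_comm]

lemma Kk_bdd (hg : Dec n g) {ε : ℝ} (hε : 0 ≤ ε) : ∃ C, 0 ≤ C ∧ ∀ x y, |Kk n g ε x y| ≤ C := by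
  obtain ⟨C, hC, hb⟩ := hker_bound hg 0
  refine ⟨C, hC, fun x y => ?_⟩
  rw [Kk, heat_gam hε]
  have := norm_integral_le_of_norm_le (f := fun z => hker n g x (y + √ε • z))
    (integrable_const (μ := gam n) C) (Eventually.of_forall fun z => by simpa using hb _ _)
  simpa using this

lemma Vε_int (hf : Dec n f) (hg : Dec n g) {ε : ℝ} (hε : 0 ≤ ε) (y : Eucl n) :
    Integrable (fun x => f x * Kk n g ε x y) := by
  obtain ⟨C, hC, hb⟩ := Kk_bdd hg hε
  exact dec_const_int hf (Kk_cont hg hε continuous_id continuous_const)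
    (fun x => hb x y)

lemma Vε_eq (hf : Dec n f) (hg : Dec n g) {ε : ℝ} (hε : 0 ≤ ε) (y : Eucl n) :
    heat n ε (fun y => g y * heat n 1 f y) y = ∫ x, f x * Kk n g ε x y := by
  rw [heat_gam hε]
  simp_rw [V_eq]
  have hi : Integrable (fun p : Eucl n × Eucl n => f p.2 * hker n g p.2 (y + √ε • p.1))
      ((gam n).prod volume) := by
    obtain ⟨C, hC, hb⟩ := hker_bound hg 0
    refine (hf.integrable'.comp_snd (gam n)).mul_bdd (c := C) ?_
      (Eventually.of_forall fun p => by simpa using hb _ _)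
    exact (hker_cont hg (by fun_prop) (by fun_prop)).aestronglyMeasurable
  rw [integral_integral_swap hi]
  congr 1; ext x
  rw [integral_const_mul, Kk, heat_gam hε]

lemma V_diff (hf : Dec n f) (hg : IsSchwartz n g) (k : ℕ) :
    ∃ C, 0 ≤ C ∧ ∀ ε, 0 ≤ ε → ε ≤ 1 → ∀ y,
      |heat n ε (fun y => g y * heat n 1 f y) y - g y * heat n 1 f y| * (1 + ‖y‖) ^ k ≤ C * ε := by
  obtain ⟨C, hC, hb⟩ := Kk_diff hg k
  refine ⟨(∫ x, |f x|) * C, by positivity, fun ε h0 h1 y => ?_⟩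
  have i0 := Vε_int hf hg.dec le_rfl y
  simp_rw [Kk_zero] at i0
  rw [Vε_eq hf hg.dec h0, V_eq, ← integral_sub (Vε_int hf hg.dec h0 y) i0,
    ← abs_of_nonneg (by positivity : 0 ≤ (1 + ‖y‖) ^ k), ← abs_mul, ← integral_mul_const, mul_assoc,
    ← integral_mul_const]
  refine norm_integral_le_of_norm_le (f := fun x => (f x * Kk n g ε x y - f x * hker n g x y) *
    (1 + ‖y‖) ^ k) (hf.integrable'.abs.mul_const _) (Eventually.of_forall fun x => ?_)
  rw [← mul_sub, Real.norm_eq_abs, mul_assoc, abs_mul]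
  gcongr
  rw [abs_mul, abs_of_nonneg (by positivity : 0 ≤ (1 + ‖y‖) ^ k)]
  exact hb ε h0 h1 x y

lemma V_lim (hf : Dec n f) (hg : IsSchwartz n g) :
    ∃ L : Eucl n → ℝ, ∀ y, Tendsto (fun ε =>
      (heat n ε (fun y => g y * heat n 1 f y) y - g y * heat n 1 f y) / ε) (𝓝[>] 0) (𝓝 (L y)) := by
  obtain ⟨L, hL⟩ := Kk_lim hg
  obtain ⟨C, hC, hb⟩ := Kk_diff hg 0
  refine ⟨fun y => ∫ x, f x * L x y, fun y => ?_⟩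
  have hev : ∀ᶠ ε : ℝ in 𝓝[>] 0, ε ∈ Ioo (0:ℝ) 1 := Ioo_mem_nhdsGT one_pos
  have i0 := Vε_int hf hg.dec le_rfl y
  simp_rw [Kk_zero] at i0
  have heq : (fun ε => (heat n ε (fun y => g y * heat n 1 f y) y - g y * heat n 1 f y) / ε)
      =ᶠ[𝓝[>] 0] fun ε => ∫ x, f x * ((Kk n g ε x y - hker n g x y) / ε) := by
    filter_upwards [hev] with ε hε
    rw [Vε_eq hf hg.dec hε.1.le, V_eq, ← integral_sub (Vε_int hf hg.dec hε.1.le y) i0,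
      ← integral_div]
    congr 1; ext x; ring
  rw [tendsto_congr' heq]
  refine tendsto_integral_filter_of_dominated_convergence (fun x => |f x| * C) ?_ ?_
    (hf.integrable'.abs.mul_const _) (Eventually.of_forall fun x => (hL x y).const_mul _)
  · filter_upwards [hev] with ε hε
    have h1 := Kk_cont hg.dec hε.1.le continuous_id (continuous_const (y := y))
    have h2 := hker_cont hg.dec continuous_id (continuous_const (y := y))
    exact (hf.1.mul ((h1.sub h2).div_const _)).aestronglyMeasurable
  · filter_upwards [hev] with ε hε
    refine Eventually.of_forall fun x => ?_
    rw [Real.norm_eq_abs, abs_mul]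
    gcongr
    have := hb ε hε.1.le hε.2.le x y
    rw [pow_zero, mul_one] at this
    rw [abs_div, abs_of_pos hε.1, div_le_iff₀ hε.1]
    exact this

end t0

end

section

lemma integrable_inv_pow (n : ℕ) : Integrable (fun y : Eucl n => ((1 + ‖y‖) ^ (n + 1))⁻¹) := by
  refine (integrable_one_add_norm (μ := (volume : Measure (Eucl n))) (r := n + 1)
    (by simp)).congr (Eventually.of_forall fun y => ?_)
  have h0 : 0 < 1 + ‖y‖ := by positivity
  simp only
  rw [Real.rpow_neg h0.le, show ((n : ℝ) + 1) = ((n + 1 : ℕ) : ℝ) by push_cast; ring,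
    Real.rpow_natCast]

section t0
open InformationTheory
variable {n : ℕ} {f g : Eucl n → ℝ}

lemma dom_bound {a b c X Y C C' : ℝ} (hX : 0 < X) (hY : 0 < Y) (h1 : |b| * Y ^ (n + 3) ≤ C)
    (h2 : |c| ≤ C' * (X ^ 2 * Y ^ 2)) :
    |a * (b * c)| ≤ C * C' * (|a| * X ^ 2 * (Y ^ (n + 1))⁻¹) := by
  rw [abs_mul, abs_mul]
  have h3 : |b| ≤ C * (Y ^ (n + 3))⁻¹ := by
    rw [← div_eq_mul_inv, le_div_iff₀ (by positivity)]; exact h1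
  have hC : 0 ≤ C := le_trans (by positivity) h1
  calc _ ≤ |a| * (C * (Y ^ (n + 3))⁻¹ * (C' * (X ^ 2 * Y ^ 2))) := by gcongr
    _ = _ := by
      have : Y ^ (n + 3) = Y ^ (n + 1) * Y ^ 2 := by ring
      rw [this]
      field_simp

lemma dom_integrable (hf : Dec n f) :
    Integrable (fun p : Eucl n × Eucl n => |f p.1| * (1 + ‖p.1‖) ^ 2 * ((1 + ‖p.2‖) ^ (n + 1))⁻¹) := by
  have h1 : Integrable (fun x => |f x| * (1 + ‖x‖) ^ 2) := by
    refine (hf.integrable 2).norm.congr (Eventually.of_forall fun x => ?_)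
    simp only [norm_mul, Real.norm_eq_abs, norm_pow]
    rw [abs_of_nonneg (by positivity : 0 ≤ 1 + ‖x‖)]
  exact h1.mul_prod (integrable_inv_pow n)

lemma t0_competitor (hf : Dec n f) (hfl : GLB n f) (hg : IsSchwartz n g) (hgl : GLB n g)
    (hU : IsProbabilityMeasure (densMeas n fun x => f x * heat n 1 g x)) :
    ∃ h : ℝ → ℝ, Tendsto (fun ε => h ε / ε) (𝓝[>] 0) (𝓝 0) ∧
      ∀ ε, 0 ≤ ε → ε ≤ 1 → 0 ≤ h ε ∧ ∃ π,
        Coupling π (densMeas n fun x => f x * heat n 1 g x)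
          (densMeas n (heat n ε fun y => g y * heat n 1 f y)) ∧
        klDiv π (schrod n f g) ≤ ENNReal.ofReal (h ε) := by
  obtain ⟨C, hC, hb⟩ := hker_bound hg.dec (n + 3)
  obtain ⟨D, hD, hd⟩ := Kk_diff hg (n + 3)
  obtain ⟨C', hC', hl⟩ := Kk_log hg hgl
  obtain ⟨α, c, hα, hc, hlow⟩ := Kk_lower hg.dec hgl
  have hpos : ∀ ε, 0 ≤ ε → ε ≤ 1 → ∀ x y, 0 < Kk n g ε x y := fun ε h0 h1 x y =>
    lt_of_lt_of_le (by positivity) (hlow ε h0 h1 x y)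
  have hKc : ∀ ε, 0 ≤ ε → Continuous fun p : Eucl n × Eucl n => Kk n g ε p.1 p.2 := fun ε h0 =>
    Kk_cont hg.dec h0 continuous_fst continuous_snd
  have hlc : ∀ ε, 0 ≤ ε → ε ≤ 1 → Continuous fun p : Eucl n × Eucl n =>
      Real.log (Kk n g ε p.1 p.2) - Real.log (Kk n g 0 p.1 p.2) := fun ε h0 h1 =>
    ((hKc ε h0).log fun p => (hpos ε h0 h1 _ _).ne').sub
      ((hKc 0 le_rfl).log fun p => (hpos 0 le_rfl zero_le_one _ _).ne')
  have hlb : ∀ ε, 0 ≤ ε → ε ≤ 1 → ∀ x y, |Real.log (Kk n g ε x y) - Real.log (Kk n g 0 x y)| ≤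
      2 * C' * ((1 + ‖x‖) ^ 2 * (1 + ‖y‖) ^ 2) := fun ε h0 h1 x y => by
    have := hl ε h0 h1 x y
    have := hl 0 le_rfl zero_le_one x y
    refine (abs_sub _ _).trans ?_
    linarith
  have hd' : ∀ ε, 0 ≤ ε → ε ≤ 1 → ∀ x y,
      |Kk n g ε x y - Kk n g 0 x y| * (1 + ‖y‖) ^ (n + 3) ≤ D * ε := by
    simpa only [Kk_zero] using hd
  have hK : ∀ ε, 0 ≤ ε → ε ≤ 1 → ∀ x y, |Kk n g ε x y| * (1 + ‖y‖) ^ (n + 3) ≤ C + D := by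
    intro ε h0 h1 x y
    have e1 := hd ε h0 h1 x y
    have e2 := hb x y
    have e3 : |Kk n g ε x y| ≤ |Kk n g ε x y - hker n g x y| + |hker n g x y| := by
      have := abs_add_le (Kk n g ε x y - hker n g x y) (hker n g x y)
      rwa [sub_add_cancel] at this
    calc _ ≤ (|Kk n g ε x y - hker n g x y| + |hker n g x y|) * (1 + ‖y‖) ^ (n + 3) := by gcongr
      _ ≤ D * ε + C := by rw [add_mul]; exact add_le_add e1 e2
      _ ≤ _ := by nlinarith
  have hdom := dom_integrable hf
  have hfc : Continuous fun p : Eucl n × Eucl n => f p.1 := hf.1.comp continuous_fst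
  -- integrability of the Kullback-Leibler integrands
  have hi : ∀ ε, 0 ≤ ε → ε ≤ 1 → ∀ δ, 0 ≤ δ → δ ≤ 1 → Integrable fun p : Eucl n × Eucl n =>
      f p.1 * (Kk n g δ p.1 p.2 * (Real.log (Kk n g ε p.1 p.2) - Real.log (Kk n g 0 p.1 p.2))) := by
    intro ε h0 h1 δ d0 d1
    refine (hdom.const_mul ((C + D) * (2 * C'))).mono'
      (hfc.mul ((hKc δ d0).mul (hlc ε h0 h1))).aestronglyMeasurable (Eventually.of_forall fun p => ?_)
    exact dom_bound (by positivity) (by positivity) (hK δ d0 d1 _ _) (hlb ε h0 h1 _ _)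
  have hcoup : ∀ ε, 0 ≤ ε → ε ≤ 1 → Coupling
      (volume.withDensity fun p : Eucl n × Eucl n => ENNReal.ofReal (f p.1 * Kk n g ε p.1 p.2))
      (densMeas n fun x => f x * heat n 1 g x)
      (densMeas n (heat n ε fun y => g y * heat n 1 f y)) := fun ε h0 h1 =>
    coupling_of_dens (ρ := fun p => f p.1 * Kk n g ε p.1 p.2) (hfc.mul (hKc ε h0)).measurable
      (fun p => (mul_pos (hfl.pos _) (hpos ε h0 h1 _ _)).le)
      (fun x => show Integrable (fun y => f x * Kk n g ε x y) volume from
        (heat_dec (hker_dec hg.dec x) h0).integrable'.const_mul (f x))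
      (fun x => (U_eq hg.dec h0 x).symm) (fun y => Vε_int hf hg.dec h0 y)
      (fun y => (Vε_eq hf hg.dec h0 y).symm) hU
  have hs : schrod n f g = volume.withDensity fun p : Eucl n × Eucl n =>
      ENNReal.ofReal (f p.1 * Kk n g 0 p.1 p.2) := by
    rw [schrod_eq hf hg.dec]; simp_rw [Kk_zero]
  set h : ℝ → ℝ := fun ε => ∫ p : Eucl n × Eucl n, f p.1 * ((Kk n g ε p.1 p.2 - Kk n g 0 p.1 p.2) *
    (Real.log (Kk n g ε p.1 p.2) - Real.log (Kk n g 0 p.1 p.2))) with hh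
  refine ⟨h, ?_, ?_⟩
  · have hev : ∀ᶠ ε : ℝ in 𝓝[>] 0, ε ∈ Ioo (0:ℝ) 1 := Ioo_mem_nhdsGT one_pos
    simp_rw [hh, ← integral_div]
    suffices H : Tendsto (fun ε : ℝ => ∫ p : Eucl n × Eucl n, f p.1 *
        ((Kk n g ε p.1 p.2 - Kk n g 0 p.1 p.2) *
        (Real.log (Kk n g ε p.1 p.2) - Real.log (Kk n g 0 p.1 p.2))) / ε) (𝓝[>] 0)
        (𝓝 (∫ _ : Eucl n × Eucl n, (0:ℝ))) by rwa [integral_zero] at H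
    refine tendsto_integral_filter_of_dominated_convergence _ ?_ ?_
      (hdom.const_mul (D * (2 * C'))) (Eventually.of_forall fun p => ?_)
    · filter_upwards [hev] with ε hε
      exact ((hfc.mul (((hKc ε hε.1.le).sub (hKc 0 le_rfl)).mul
        (hlc ε hε.1.le hε.2.le))).div_const _).aestronglyMeasurable
    · filter_upwards [hev] with ε hε
      refine Eventually.of_forall fun p => ?_
      rw [norm_div, Real.norm_eq_abs, Real.norm_eq_abs, abs_of_pos hε.1, div_le_iff₀ hε.1]
      refine (dom_bound (by positivity) (by positivity) (hd' ε hε.1.le hε.2.le _ _)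
        (hlb ε hε.1.le hε.2.le _ _)).trans (le_of_eq ?_)
      ring
    · set x := p.1
      set y := p.2
      have hK0 : Tendsto (fun ε => Kk n g ε x y) (𝓝[>] 0) (𝓝 (Kk n g 0 x y)) := by
        have hz : Tendsto (fun ε : ℝ => D * ε) (𝓝[>] 0) (𝓝 0) := by
          have : Tendsto (fun ε : ℝ => D * ε) (𝓝 0) (𝓝 (D * 0)) := tendsto_id.const_mul D
          rw [mul_zero] at this
          exact this.mono_left nhdsWithin_le_nhds
        rw [tendsto_iff_norm_sub_tendsto_zero]
        refine tendsto_of_tendsto_of_tendsto_of_le_of_le' tendsto_const_nhds hz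
          (Eventually.of_forall fun _ => norm_nonneg _) ?_
        filter_upwards [hev] with ε hε
        refine le_trans ?_ (hd' ε hε.1.le hε.2.le x y)
        rw [Real.norm_eq_abs]
        exact le_mul_of_one_le_right (abs_nonneg _) (one_le_pow₀ (by simp))
      have hlog : Tendsto (fun ε => |f x| * D * |Real.log (Kk n g ε x y) - Real.log (Kk n g 0 x y)|)
          (𝓝[>] 0) (𝓝 0) := by
        have := (((hK0.log (hpos 0 le_rfl zero_le_one x y).ne').sub_const
          (Real.log (Kk n g 0 x y))).abs).const_mul (|f x| * D)
        simpa using this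
      rw [tendsto_zero_iff_norm_tendsto_zero]
      refine tendsto_of_tendsto_of_tendsto_of_le_of_le' tendsto_const_nhds hlog
          (Eventually.of_forall fun _ => norm_nonneg _) ?_
      filter_upwards [hev] with ε hε
      have e1 : |Kk n g ε x y - Kk n g 0 x y| ≤ D * ε := by
        refine le_trans ?_ (hd' ε hε.1.le hε.2.le x y)
        exact le_mul_of_one_le_right (abs_nonneg _) (one_le_pow₀ (by simp))
      rw [norm_div, Real.norm_eq_abs, Real.norm_eq_abs, abs_of_pos hε.1, div_le_iff₀ hε.1,
        abs_mul, abs_mul]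
      calc _ ≤ |f x| * (D * ε * |Real.log (Kk n g ε x y) - Real.log (Kk n g 0 x y)|) := by gcongr
        _ = _ := by ring
  · intro ε h0 h1
    have hc1 := hcoup ε h0 h1
    have hc0 := hcoup 0 le_rfl zero_le_one
    have hp1 := hc1.1
    have hp0 := hc0.1
    have hA : Measurable fun p : Eucl n × Eucl n => f p.1 * Kk n g ε p.1 p.2 :=
      (hfc.mul (hKc ε h0)).measurable
    have hB : Measurable fun p : Eucl n × Eucl n => f p.1 * Kk n g 0 p.1 p.2 :=
      (hfc.mul (hKc 0 le_rfl)).measurable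
    have hA0 : ∀ p : Eucl n × Eucl n, 0 < f p.1 * Kk n g ε p.1 p.2 := fun p =>
      mul_pos (hfl.pos _) (hpos ε h0 h1 _ _)
    have hB0 : ∀ p : Eucl n × Eucl n, 0 < f p.1 * Kk n g 0 p.1 p.2 := fun p =>
      mul_pos (hfl.pos _) (hpos 0 le_rfl zero_le_one _ _)
    have hlogs : ∀ p : Eucl n × Eucl n, Real.log (f p.1 * Kk n g ε p.1 p.2) -
        Real.log (f p.1 * Kk n g 0 p.1 p.2) =
        Real.log (Kk n g ε p.1 p.2) - Real.log (Kk n g 0 p.1 p.2) := fun p => by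
      rw [Real.log_mul (hfl.pos _).ne' (hpos ε h0 h1 _ _).ne',
        Real.log_mul (hfl.pos _).ne' (hpos 0 le_rfl zero_le_one _ _).ne']
      ring
    have I1 := hi ε h0 h1 ε h0 h1
    have I0 := hi ε h0 h1 0 le_rfl zero_le_one
    have k1 := klDiv_withDensity hA hB hA0 hB0 hp1 hp0
      (by simp_rw [hlogs, mul_assoc]; exact I1)
    have k0 := klDiv_withDensity hB hA hB0 hA0 hp0 hp1
      (by simp_rw [← neg_sub (Real.log (f _ * Kk n g ε _ _)), hlogs, mul_assoc, mul_neg]; exact I0.neg)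
    have hsum : h ε = (∫ p : Eucl n × Eucl n, f p.1 * Kk n g ε p.1 p.2 *
        (Real.log (f p.1 * Kk n g ε p.1 p.2) - Real.log (f p.1 * Kk n g 0 p.1 p.2))) +
        ∫ p : Eucl n × Eucl n, f p.1 * Kk n g 0 p.1 p.2 *
        (Real.log (f p.1 * Kk n g 0 p.1 p.2) - Real.log (f p.1 * Kk n g ε p.1 p.2)) := by
      simp_rw [← neg_sub (Real.log (f _ * Kk n g ε _ _)), hlogs, mul_assoc, mul_neg]
      rw [integral_neg, ← sub_eq_add_neg, ← integral_sub I1 I0]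
      simp only [hh]
      congr 1; ext p; ring
    refine ⟨by rw [hsum]; exact add_nonneg k1.2 k0.2, _, hc1, ?_⟩
    rw [hs, k1.1, hsum]
    exact ENNReal.ofReal_le_ofReal (le_add_of_nonneg_right k0.2)

end t0

end

section

/-- Density of the triple (increment, endpoint, starting point) used to compare heat flows. -/
noncomputable def tripDens (n : ℕ) (q : Eucl n × Eucl n → ℝ) (V : Eucl n → ℝ) (t a : ℝ)
    (p : Eucl n × Eucl n × Eucl n) : ℝ :=
  q (p.2.1, p.2.2 + a • p.1) * (V p.2.2 * (a ^ n * hk n t (a • p.1)))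

noncomputable def trip (n : ℕ) (q : Eucl n × Eucl n → ℝ) (V : Eucl n → ℝ) (t a : ℝ) :
    Measure (Eucl n × Eucl n × Eucl n) :=
  volume.withDensity fun p => ENNReal.ofReal (tripDens n q V t a p)

section
variable {n : ℕ} {q : Eucl n × Eucl n → ℝ} {V : Eucl n → ℝ} {t a : ℝ}

lemma tripDens_cont (hq : Continuous q) (hV : Continuous V) : Continuous (tripDens n q V t a) := by
  have := hk_cont n t
  unfold tripDens
  fun_prop

lemma heat_eq_scaled (ht : 0 < t) (ha : 0 < a) (y : Eucl n) :
    ∫ ζ, V (y - a • ζ) * (a ^ n * hk n t (a • ζ)) = heat n t V y := by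
  have h := Measure.integral_comp_smul (volume : Measure (Eucl n))
    (fun ζ => V (y - ζ) * (a ^ n * hk n t ζ)) a
  simp only [finrank_euclideanSpace_fin] at h
  rw [h, heat_eq ht.ne']
  have e : ∀ ζ, V (y - ζ) * (a ^ n * hk n t ζ) = a ^ n * (V (y - ζ) * hk n t ζ) := fun ζ => by ring
  simp_rw [e]
  rw [integral_const_mul, abs_of_pos (by positivity), smul_eq_mul,
    inv_mul_cancel_left₀ (by positivity),
    ← integral_sub_left_eq_self (fun ζ => V ζ * hk n t (y - ζ)) volume y]
  simp only [sub_sub_cancel]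

lemma int_scaled (hV : Dec n V) (ht : 0 < t) (ha : 0 < a) (r : ℝ) (y : Eucl n) :
    Integrable fun ζ => V (y - r • ζ) * (a ^ n * hk n t (a • ζ)) := by
  obtain ⟨C, hC, hb⟩ := hV.bdd
  have hc := hV.1
  exact (((hk_integrable ht).comp_smul ha.ne').const_mul _).bdd_mul (c := C)
    (Continuous.aestronglyMeasurable (by fun_prop)) (Eventually.of_forall fun ζ => hb _)

lemma trip_map (hq : Continuous q) (hq0 : ∀ p, 0 ≤ q p) (hV : Dec n V) (hV0 : ∀ y, 0 ≤ V y)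
    (ht : 0 < t) (ha : 0 < a) :
    (trip n q V t a).map (fun p => (p.2.1, p.2.2 + a • p.1)) =
      volume.withDensity fun p => ENNReal.ofReal (q p * heat n t V p.2) := by
  have hVc := hV.1
  have hkc := hk_cont n t
  have hm : Measurable fun p : Eucl n × Eucl n × Eucl n => (p.2.1, p.2.2 + a • p.1) := by fun_prop
  ext s hs
  rw [Measure.map_apply hm hs, trip, withDensity_apply _ (hm hs), withDensity_apply _ hs,
    ← lintegral_indicator (hm hs), ← lintegral_indicator hs]
  set G : Eucl n → Eucl n × Eucl n → ℝ≥0∞ := fun ζ p => s.indicator (fun p => ENNReal.ofReal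
    (q p * (V (p.2 - a • ζ) * (a ^ n * hk n t (a • ζ))))) p with hG
  have hGm : Measurable (Function.uncurry G) := by
    have : Function.uncurry G = (Prod.snd ⁻¹' s).indicator
        (fun r : Eucl n × Eucl n × Eucl n => ENNReal.ofReal
          (q r.2 * (V (r.2.2 - a • r.1) * (a ^ n * hk n t (a • r.1))))) := by
      ext r; rfl
    rw [this]
    refine Measurable.indicator (Measurable.ennreal_ofReal (Continuous.measurable ?_))
      (measurable_snd hs)
    fun_prop
  have h1 : ∀ ζ : Eucl n, ∀ p : Eucl n × Eucl n,
      ((fun p : Eucl n × Eucl n × Eucl n => (p.2.1, p.2.2 + a • p.1)) ⁻¹' s).indicator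
      (fun p => ENNReal.ofReal (tripDens n q V t a p)) (ζ, p) = G ζ (p + (0, a • ζ)) := by
    intro ζ p
    have : p + (0, a • ζ) = (p.1, p.2 + a • ζ) := by ext1 <;> simp
    rw [this]
    simp only [hG, indicator, tripDens, add_sub_cancel_right]
    rfl
  rw [Measure.volume_eq_prod, lintegral_prod]
  swap
  · exact ((Measurable.ennreal_ofReal (tripDens_cont hq hVc).measurable).indicator
      (hm hs)).aemeasurable
  simp_rw [h1]
  have : (volume : Measure (Eucl n × Eucl n)).IsAddRightInvariant := by
    rw [Measure.volume_eq_prod]; infer_instance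
  have h2 : ∀ ζ : Eucl n, ∫⁻ p, G ζ (p + (0, a • ζ)) = ∫⁻ p, G ζ p := fun ζ =>
    lintegral_add_right_eq_self (G ζ) _
  simp_rw [h2]
  rw [lintegral_lintegral_swap hGm.aemeasurable]
  congr 1; ext p
  by_cases hp : p ∈ s
  · simp only [hG, indicator_of_mem hp]
    rw [← ofReal_integral_eq_lintegral_ofReal ((int_scaled hV ht ha a p.2).const_mul _),
      integral_const_mul, heat_eq_scaled ht ha]
    exact Eventually.of_forall fun ζ => mul_nonneg (hq0 _) (mul_nonneg (hV0 _)
      (mul_nonneg (by positivity) (hk_pos ht _).le))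
  · simp [hG, indicator_of_notMem hp]

lemma trip_proj (hq : Continuous q) (hq0 : ∀ p, 0 ≤ q p) (hqi : ∀ y, Integrable fun x => q (x, y))
    (hq1 : ∀ y, ∫ x, q (x, y) = 1) (hV : Continuous V) (hV0 : ∀ y, 0 ≤ V y) (ht : 0 < t) :
    (trip n q V t 1).map (fun p => (p.1, p.2.2)) =
      volume.withDensity fun p : Eucl n × Eucl n => ENNReal.ofReal (V p.2 * hk n t p.1) := by
  have hkc := hk_cont n t
  have hm : Measurable fun p : Eucl n × Eucl n × Eucl n => (p.1, p.2.2) := by fun_prop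
  ext s hs
  rw [Measure.map_apply hm hs, trip, withDensity_apply _ (hm hs), withDensity_apply _ hs,
    ← lintegral_indicator (hm hs), ← lintegral_indicator hs]
  have hM := (Measurable.ennreal_ofReal (tripDens_cont (t := t) (a := 1) hq hV).measurable).indicator
      (hm hs)
  have hM2 : Measurable (s.indicator
      fun p : Eucl n × Eucl n => ENNReal.ofReal (V p.2 * hk n t p.1)) :=
    (Measurable.ennreal_ofReal (Continuous.measurable (by fun_prop))).indicator hs
  rw [Measure.volume_eq_prod, lintegral_prod _ hM.aemeasurable, Measure.volume_eq_prod (Eucl n),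
    lintegral_prod _ hM2.aemeasurable]
  congr 1; ext ζ
  have hM3 := hM.comp (measurable_prodMk_left (x := ζ))
  rw [lintegral_prod_symm]
  swap
  · exact hM3.aemeasurable
  congr 1; ext z
  by_cases hp : (ζ, z) ∈ s
  · rw [indicator_of_mem hp]
    have : ∀ x, ((fun p : Eucl n × Eucl n × Eucl n => (p.1, p.2.2)) ⁻¹' s).indicator
        (fun p => ENNReal.ofReal (tripDens n q V t 1 p)) (ζ, x, z) =
        ENNReal.ofReal (q (x, z + ζ) * (V z * hk n t ζ)) := fun x => by
      rw [indicator_of_mem (by simpa using hp)]; simp [tripDens]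
    simp_rw [this]
    rw [← ofReal_integral_eq_lintegral_ofReal ((hqi _).mul_const _), integral_mul_const, hq1,
      one_mul]
    exact Eventually.of_forall fun x => mul_nonneg (hq0 _) (mul_nonneg (hV0 _) (hk_pos ht _).le)
  · rw [indicator_of_notMem hp]
    have : ∀ x, ((fun p : Eucl n × Eucl n × Eucl n => (p.1, p.2.2)) ⁻¹' s).indicator
        (fun p => ENNReal.ofReal (tripDens n q V t 1 p)) (ζ, x, z) = 0 := fun x => by
      rw [indicator_of_notMem (by simpa using hp)]
    simp [this]

lemma heat_eq_dilated (ht : 0 < t) (ha : 0 < a) (y : Eucl n) :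
    ∫ ζ, V (y - a • ζ) * hk n t ζ = heat n (a ^ 2 * t) V y := by
  rw [heat_gam (by positivity), integral_hk_scale ht fun ζ => V (y - a • ζ), ← integral_gam,
    ← gam_symm, Real.sqrt_mul (by positivity), Real.sqrt_sq ha.le]
  simp only [smul_neg, smul_smul, sub_neg_eq_add]

lemma dilate_map (hV : Dec n V) (hV0 : ∀ y, 0 ≤ V y) (ht : 0 < t) (ha : 0 < a) :
    (volume.withDensity fun p : Eucl n × Eucl n => ENNReal.ofReal (V p.2 * hk n t p.1)).map
      (fun p => p.2 + a • p.1) = densMeas n (heat n (a ^ 2 * t) V) := by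
  have hVc := hV.1
  have hkc := hk_cont n t
  have hm : Measurable fun p : Eucl n × Eucl n => p.2 + a • p.1 := by fun_prop
  ext s hs
  rw [Measure.map_apply hm hs, withDensity_apply _ (hm hs), densMeas, withDensity_apply _ hs,
    ← lintegral_indicator (hm hs), ← lintegral_indicator hs]
  set G : Eucl n → Eucl n → ℝ≥0∞ := fun ζ y => s.indicator (fun y => ENNReal.ofReal
    (V (y - a • ζ) * hk n t ζ)) y with hG
  have hGm : Measurable (Function.uncurry G) := by
    have : Function.uncurry G = (Prod.snd ⁻¹' s).indicator
        (fun r : Eucl n × Eucl n => ENNReal.ofReal (V (r.2 - a • r.1) * hk n t r.1)) := by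
      ext r; rfl
    rw [this]
    refine Measurable.indicator (Measurable.ennreal_ofReal (Continuous.measurable ?_))
      (measurable_snd hs)
    fun_prop
  have h1 : ∀ ζ z : Eucl n, ((fun p : Eucl n × Eucl n => p.2 + a • p.1) ⁻¹' s).indicator
      (fun p => ENNReal.ofReal (V p.2 * hk n t p.1)) (ζ, z) = G ζ (z + a • ζ) := by
    intro ζ z
    simp only [hG, indicator, add_sub_cancel_right]
    rfl
  rw [Measure.volume_eq_prod, lintegral_prod]
  swap
  · exact ((Measurable.ennreal_ofReal (Continuous.measurable (by fun_prop))).indicator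
      (hm hs)).aemeasurable
  simp_rw [h1]
  have h2 : ∀ ζ : Eucl n, ∫⁻ z, G ζ (z + a • ζ) = ∫⁻ z, G ζ z := fun ζ =>
    lintegral_add_right_eq_self (G ζ) _
  simp_rw [h2]
  rw [lintegral_lintegral_swap hGm.aemeasurable]
  congr 1; ext y
  by_cases hp : y ∈ s
  · simp only [hG, indicator_of_mem hp]
    have hi := int_scaled hV ht one_pos a y
    simp only [one_pow, one_mul, one_smul] at hi
    rw [← ofReal_integral_eq_lintegral_ofReal hi, heat_eq_dilated ht ha]
    exact Eventually.of_forall fun ζ => mul_nonneg (hV0 _) (hk_pos ht _).le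
  · simp [hG, indicator_of_notMem hp]
end

end

section
variable {n : ℕ} {f g V : Eucl n → ℝ} {t a : ℝ}

lemma hk_tilt (w ζ : Eucl n) (a : ℝ) : Real.exp (a * inner ℝ w ζ) * hk n 1 w =
    Real.exp (a ^ 2 * ‖ζ‖ ^ 2 / 2) * hk n 1 (w - a • ζ) := by
  unfold hk
  rw [← mul_div_assoc, ← mul_div_assoc, ← Real.exp_add, ← Real.exp_add]
  congr 2
  rw [norm_sub_sq_real, inner_smul_right, norm_smul, mul_pow, Real.norm_eq_abs, sq_abs]
  ring

/-- Along a line, the logarithm of a heat evolution plus the Gaussian quadratic is a cumulant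
generating function. -/
lemma log_heat_line (hf : Dec n f) (hfl : GLB n f) (y ζ : Eucl n) :
    ConvexOn ℝ univ (fun a : ℝ => Real.log (heat n 1 f (y + a • ζ)) + a ^ 2 * ‖ζ‖ ^ 2 / 2) ∧
    Differentiable ℝ (fun a : ℝ => Real.log (heat n 1 f (y + a • ζ)) + a ^ 2 * ‖ζ‖ ^ 2 / 2) := by
  have hfc := hf.1
  have hkc := hk_cont n 1
  set w : Eucl n → ℝ := fun x => f x * hk n 1 (x - y) with hw
  have hwc : Continuous w := by fun_prop
  have hw0 : ∀ x, 0 ≤ w x := fun x => mul_nonneg (hfl.pos x).le (hk_pos one_pos _).le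
  set X : Eucl n → ℝ := fun x => inner ℝ (x - y) ζ with hX
  have key : ∀ a x, Real.exp (a * X x) * w x =
      Real.exp (a ^ 2 * ‖ζ‖ ^ 2 / 2) * (f x * hk n 1 (y + a • ζ - x)) := fun a x => by
    have := hk_tilt (x - y) ζ a
    rw [hk_sub_comm (y + a • ζ), ← sub_sub]
    simp only [hX, hw]
    linear_combination f x * this
  have hInt : ∀ a : ℝ, Integrable (fun x => Real.exp (a * X x)) (densMeas n w) := fun a => by
    rw [integrable_densMeas hw0 hwc.measurable]
    simp_rw [key]
    obtain ⟨C, hC, hb⟩ := (hk_dec (n := n) one_pos).bdd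
    exact (dec_const_int hf (F := fun x => hk n 1 (y + a • ζ - x)) (by fun_prop)
      (fun x => hb _)).const_mul _
  have hmgf : ∀ a, ProbabilityTheory.mgf X (densMeas n w) a =
      Real.exp (a ^ 2 * ‖ζ‖ ^ 2 / 2) * heat n 1 f (y + a • ζ) := fun a => by
    rw [ProbabilityTheory.mgf, integral_densMeas hw0 hwc.measurable]
    simp_rw [key]
    rw [integral_const_mul, heat_eq one_ne_zero]
  have hcgf : (fun a : ℝ => Real.log (heat n 1 f (y + a • ζ)) + a ^ 2 * ‖ζ‖ ^ 2 / 2) =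
      ProbabilityTheory.cgf X (densMeas n w) := by
    ext a
    rw [ProbabilityTheory.cgf, hmgf, Real.log_mul (Real.exp_ne_zero _)
      ((heat_glb hf hfl zero_le_one).pos _).ne', Real.log_exp, add_comm]
  have hset : ∀ a, a ∈ interior (ProbabilityTheory.integrableExpSet X (densMeas n w)) := fun a => by
    have : ProbabilityTheory.integrableExpSet X (densMeas n w) = univ := eq_univ_of_forall hInt
    simp [this]
  rw [hcgf]
  have han : ∀ a, AnalyticAt ℝ (ProbabilityTheory.cgf X (densMeas n w)) a := fun a =>
    ProbabilityTheory.analyticAt_cgf (hset a)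
  have hd : Differentiable ℝ (ProbabilityTheory.cgf X (densMeas n w)) := fun a =>
    (han a).differentiableAt
  refine ⟨convexOn_univ_of_deriv2_nonneg hd (fun a => (han a).deriv.differentiableAt) fun a => ?_, hd⟩
  rw [← iteratedDeriv_eq_iterate, ProbabilityTheory.iteratedDeriv_two_cgf_eq_integral (hset a)]
  exact div_nonneg (integral_nonneg fun x => by positivity) ProbabilityTheory.mgf_nonneg

lemma second_diff_convex {c : ℝ → ℝ} (hc : ConvexOn ℝ univ c) (hd : Differentiable ℝ c) :
    (∀ δ, 0 ≤ c (1 + δ) + c (1 - δ) - 2 * c 1) ∧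
    (∀ δ, |δ| ≤ 1 / 2 → c (1 + δ) + c (1 - δ) - 2 * c 1 ≤
      |δ| * (2 * (c (3 / 2) + c (1 / 2) - 2 * c 1))) ∧
    Tendsto (fun δ => (c (1 + δ) + c (1 - δ) - 2 * c 1) / δ) (𝓝[≠] 0) (𝓝 0) := by
  refine ⟨fun δ => ?_, fun δ hδ => ?_, ?_⟩
  · have := hc.2 (mem_univ (1 + δ)) (mem_univ (1 - δ)) (show (0:ℝ) ≤ 1 / 2 by norm_num)
      (show (0:ℝ) ≤ 1 / 2 by norm_num) (by norm_num)
    simp only [smul_eq_mul] at this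
    ring_nf at this ⊢
    linarith
  · have key : ∀ δ, 0 ≤ δ → δ ≤ 1 / 2 → c (1 + δ) + c (1 - δ) - 2 * c 1 ≤
      δ * (2 * (c (3 / 2) + c (1 / 2) - 2 * c 1)) := by
      intro δ h0 h1
      have e1 := hc.2 (mem_univ (3 / 2)) (mem_univ 1) (show 0 ≤ 2 * δ by linarith)
        (show 0 ≤ 1 - 2 * δ by linarith) (by ring)
      have e2 := hc.2 (mem_univ (1 / 2)) (mem_univ 1) (show 0 ≤ 2 * δ by linarith)
        (show 0 ≤ 1 - 2 * δ by linarith) (by ring)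
      simp only [smul_eq_mul] at e1 e2
      have a1 : 2 * δ * (3 / 2) + (1 - 2 * δ) * 1 = 1 + δ := by ring
      have a2 : 2 * δ * (1 / 2) + (1 - 2 * δ) * 1 = 1 - δ := by ring
      rw [a1] at e1
      rw [a2] at e2
      linarith
    rcases le_total 0 δ with h | h
    · rw [abs_of_nonneg h] at hδ ⊢; exact key δ h hδ
    · rw [abs_of_nonpos h] at hδ ⊢
      have := key (-δ) (by linarith) hδ
      rw [sub_neg_eq_add, ← sub_eq_add_neg] at this
      linarith
  · have h1 : HasDerivAt (fun δ => c (1 + δ) + c (1 - δ) - 2 * c 1) 0 0 := by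
      have d0 := (hd 1).hasDerivAt
      have d1 : HasDerivAt (fun δ => c (1 + δ)) (deriv c 1) 0 :=
        HasDerivAt.comp_const_add (f := c) 1 0 (by simpa using d0)
      have d2 : HasDerivAt (fun δ => c (1 - δ)) (-deriv c 1) 0 :=
        HasDerivAt.comp_const_sub (f := c) 1 0 (by simpa using d0)
      have := (d1.fun_add d2).sub_const (2 * c 1)
      simpa using this
    have h2 := hasDerivAt_iff_tendsto_slope.1 h1
    refine h2.congr fun δ => ?_
    rw [slope_def_field]
    simp only [add_zero, sub_zero]
    ring

lemma schrod_coupling (hf : Dec n f) (hf0 : ∀ x, 0 < f x) (hg : Dec n g) (hg0 : ∀ x, 0 < g x)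
    (hU : IsProbabilityMeasure (densMeas n fun x => f x * heat n 1 g x)) :
    Coupling (schrod n f g) (densMeas n fun x => f x * heat n 1 g x)
      (densMeas n fun y => g y * heat n 1 f y) := by
  have hfc := hf.1
  have hgc := hg.1
  have hkc := hk_cont n 1
  have hm : Continuous fun p : Eucl n × Eucl n => f p.1 * hker n g p.1 p.2 := by
    unfold hker; fun_prop
  have hxi : ∀ x, Integrable fun y => f x * hker n g x y := fun x =>
    (hker_dec hg x).integrable'.const_mul (f x)
  have hyi : ∀ y, Integrable fun x => f x * hker n g x y := fun y => by
    have := Vε_int hf hg le_rfl y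
    simp_rw [Kk_zero] at this
    exact this
  have hu : ∀ x, ∫ y, f x * hker n g x y = f x * heat n 1 g x := fun x => by
    rw [U_eq hg le_rfl]; simp_rw [Kk_zero]
  rw [schrod_eq hf hg]
  refine coupling_of_dens (ρ := fun p => f p.1 * hker n g p.1 p.2) hm.measurable (fun p => ?_)
    hxi hu hyi (fun y => (V_eq f g y).symm) hU
  exact mul_nonneg (hf0 _).le (mul_nonneg (hk_pos one_pos _).le (hg0 _).le)

end

section
variable {n : ℕ} {f g V : Eucl n → ℝ} {t a : ℝ}

/-- Backward transition density associated with `f`. -/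
noncomputable def backDens (n : ℕ) (f : Eucl n → ℝ) (p : Eucl n × Eucl n) : ℝ :=
  f p.1 * hk n 1 (p.1 - p.2) / heat n 1 f p.2

lemma backDens_cont (hf : Dec n f) (hfl : GLB n f) : Continuous (backDens n f) := by
  have hfc := hf.1
  have hkc := hk_cont n 1
  have hF := (heat_dec hf zero_le_one).1
  have hF0 := fun y => ((heat_glb hf hfl zero_le_one).pos y).ne'
  unfold backDens
  exact Continuous.div (by fun_prop) (by fun_prop) fun p => hF0 _

lemma backDens_pos (hf : Dec n f) (hfl : GLB n f) (p : Eucl n × Eucl n) : 0 < backDens n f p :=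
  div_pos (mul_pos (hfl.pos _) (hk_pos one_pos _)) ((heat_glb hf hfl zero_le_one).pos _)

lemma backDens_int (hf : Dec n f) (y : Eucl n) : Integrable fun x => backDens n f (x, y) := by
  have hkc := hk_cont n 1
  obtain ⟨C, hC, hb⟩ := (hk_dec (n := n) one_pos).bdd
  exact (dec_const_int hf (F := fun x => hk n 1 (x - y)) (by fun_prop) fun x => hb _).div_const
    (heat n 1 f y)

lemma backDens_integral (hf : Dec n f) (hfl : GLB n f) (y : Eucl n) :
    ∫ x, backDens n f (x, y) = 1 := by
  simp only [backDens]
  rw [integral_div, heat_eq one_ne_zero, div_eq_one_iff_eq]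
  · simp_rw [hk_sub_comm y]
  · rw [← heat_eq one_ne_zero]; exact ((heat_glb hf hfl zero_le_one).pos y).ne.symm

/-- Log-likelihood ratio between the triple measures. -/
noncomputable def tripLog (n : ℕ) (f V : Eucl n → ℝ) (t a : ℝ) (p : Eucl n × Eucl n × Eucl n) : ℝ :=
  Real.log (tripDens n (backDens n f) V t 1 p) - Real.log (tripDens n (backDens n f) V t a p)

lemma log_hk (ht : 0 < t) (w : Eucl n) : Real.log (hk n t w) =
    -‖w‖ ^ 2 / (2 * t) - Real.log ((2 * Real.pi * t) ^ ((n : ℝ) / 2)) := by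
  rw [hk, Real.log_div (Real.exp_ne_zero _) (by positivity), Real.log_exp]

lemma tripLog_eq (hf : Dec n f) (hfl : GLB n f) (hV0 : ∀ y, 0 < V y) (ht : 0 < t) (ha : 0 < a)
    (ζ x z : Eucl n) : tripLog n f V t a (ζ, x, z) =
      Real.log (heat n 1 f (z + a • ζ)) - Real.log (heat n 1 f (z + (1:ℝ) • ζ)) +
      (‖x - (z + a • ζ)‖ ^ 2 - ‖x - (z + (1:ℝ) • ζ)‖ ^ 2) / 2 + (a ^ 2 - 1) * ‖ζ‖ ^ 2 / (2 * t) -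
      n * Real.log a := by
  have hF0 := fun y => ((heat_glb hf hfl zero_le_one).pos y).ne'
  have key : ∀ a : ℝ, 0 < a → Real.log (tripDens n (backDens n f) V t a (ζ, x, z)) =
      Real.log (f x) + Real.log (hk n 1 (x - (z + a • ζ))) - Real.log (heat n 1 f (z + a • ζ)) +
      (Real.log (V z) + (n * Real.log a + Real.log (hk n t (a • ζ)))) := fun a ha => by
    have h1 := (hfl.pos x).ne'
    have h2 := (hk_pos one_pos (x - (z + a • ζ))).ne'
    have h3 := (hk_pos ht (a • ζ)).ne'
    have h4 := pow_ne_zero n ha.ne'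
    simp only [tripDens, backDens]
    rw [Real.log_mul (div_ne_zero (mul_ne_zero h1 h2) (hF0 _))
      (mul_ne_zero (hV0 z).ne' (mul_ne_zero h4 h3)), Real.log_div (mul_ne_zero h1 h2) (hF0 _),
      Real.log_mul h1 h2, Real.log_mul (hV0 z).ne' (mul_ne_zero h4 h3), Real.log_mul h4 h3,
      Real.log_pow]
  rw [tripLog, key 1 one_pos, key a ha, log_hk one_pos, log_hk one_pos, log_hk ht, log_hk ht,
    norm_smul, norm_smul, mul_pow, mul_pow, Real.norm_eq_abs, Real.norm_eq_abs, sq_abs, sq_abs,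
    Real.log_one]
  field_simp
  ring

lemma tripLog_bound (hf : Dec n f) (hfl : GLB n f) (hV0 : ∀ y, 0 < V y) (ht : 0 < t) (ha : 0 < a)
    (ha2 : a ≤ 2) : ∃ C, 0 ≤ C ∧ ∀ ζ x z : Eucl n, |tripLog n f V t a (ζ, x, z)| ≤
      C * (‖x‖ ^ 2 + (1 + ‖z‖) ^ 2 * (1 + ‖ζ‖) ^ 2) := by
  obtain ⟨C, hC, hb⟩ := log_bound (heat_dec hf zero_le_one) (heat_glb hf hfl zero_le_one)
  refine ⟨18 * C + 20 + 5 / (2 * t) + n * |Real.log a|, by positivity, fun ζ x z => ?_⟩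
  rw [tripLog_eq hf hfl hV0 ht ha]
  set M := (1 + ‖z‖) ^ 2 * (1 + ‖ζ‖) ^ 2 with hM
  have hz := norm_nonneg z
  have hζ := norm_nonneg ζ
  have hM1 : 1 ≤ M := by
    rw [hM, ← mul_pow]
    exact one_le_pow₀ (by nlinarith)
  have hzζ : ∀ b : ℝ, 0 < b → b ≤ 2 → (1 + ‖z + b • ζ‖) ^ 2 ≤ 9 * M := fun b h0 h1 => by
    have e1 : ‖z + b • ζ‖ ≤ ‖z‖ + 2 * ‖ζ‖ := by
      refine (norm_add_le _ _).trans ?_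
      rw [norm_smul, Real.norm_eq_abs, abs_of_pos h0]
      nlinarith
    have e2 : 1 + ‖z + b • ζ‖ ≤ 3 * ((1 + ‖z‖) * (1 + ‖ζ‖)) := by nlinarith
    calc _ ≤ (3 * ((1 + ‖z‖) * (1 + ‖ζ‖))) ^ 2 := by gcongr
      _ = _ := by rw [hM]; ring
  have hsq : ∀ b : ℝ, 0 < b → b ≤ 2 → ‖x - (z + b • ζ)‖ ^ 2 ≤ 2 * ‖x‖ ^ 2 + 18 * M :=
    fun b h0 h1 => by
    have e1 := norm_add_sq_le x (-(z + b • ζ))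
    rw [← sub_eq_add_neg, norm_neg] at e1
    have e2 := hzζ b h0 h1
    nlinarith [norm_nonneg (z + b • ζ)]
  have hL : ∀ b : ℝ, 0 < b → b ≤ 2 → |Real.log (heat n 1 f (z + b • ζ))| ≤ 9 * C * M :=
    fun b h0 h1 => by
    refine (hb _).trans ?_
    nlinarith [hzζ b h0 h1]
  have hζM : ‖ζ‖ ^ 2 ≤ M := by rw [hM]; nlinarith [sq_nonneg ‖z‖, mul_nonneg hz hζ, sq_nonneg (1 + ‖ζ‖), mul_nonneg hz (sq_nonneg (1 + ‖ζ‖)), mul_nonneg (sq_nonneg ‖z‖) (sq_nonneg (1 + ‖ζ‖))]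
  have l1 := hL a ha ha2
  have l2 := hL 1 one_pos one_le_two
  have s1 := hsq a ha ha2
  have s2 := hsq 1 one_pos one_le_two
  have q1 : |(‖x - (z + a • ζ)‖ ^ 2 - ‖x - (z + (1:ℝ) • ζ)‖ ^ 2) / 2| ≤ 2 * ‖x‖ ^ 2 + 18 * M := by
    rw [abs_le]
    constructor <;> nlinarith [sq_nonneg ‖x - (z + a • ζ)‖, sq_nonneg ‖x - (z + (1:ℝ) • ζ)‖]
  have q2 : |(a ^ 2 - 1) * ‖ζ‖ ^ 2 / (2 * t)| ≤ 5 / (2 * t) * M := by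
    rw [abs_div, abs_mul, abs_of_pos (show 0 < 2 * t by positivity), abs_of_nonneg (sq_nonneg ‖ζ‖),
      div_mul_eq_mul_div]
    gcongr
    rw [abs_le]; constructor <;> nlinarith
  have q3 : |n * Real.log a| ≤ n * |Real.log a| * M := by
    rw [abs_mul, Nat.abs_cast]
    exact le_mul_of_one_le_right (by positivity) hM1
  have tri : ∀ b c d e h : ℝ, |b - c + d + e - h| ≤ |b| + |c| + |d| + |e| + |h| := fun b c d e h => by
    refine (abs_sub _ _).trans ?_
    gcongr
    refine (abs_add_le _ _).trans ?_
    gcongr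
    refine (abs_add_le _ _).trans ?_
    gcongr
    exact abs_sub _ _
  refine (tri _ _ _ _ _).trans ?_
  have hx := sq_nonneg ‖x‖
  have p1 : 0 ≤ C * ‖x‖ ^ 2 := by positivity
  have p2 : 0 ≤ 5 / (2 * t) * ‖x‖ ^ 2 := by positivity
  have p3 : 0 ≤ n * |Real.log a| * ‖x‖ ^ 2 := by positivity
  nlinarith

lemma tripLog_second (hf : Dec n f) (hfl : GLB n f) (hV0 : ∀ y, 0 < V y) (ht : 0 < t) :
    (∃ C, 0 ≤ C ∧ ∀ δ : ℝ, |δ| ≤ 1 / 2 → ∀ ζ x z : Eucl n,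
      |tripLog n f V t (1 + δ) (ζ, x, z) + tripLog n f V t (1 - δ) (ζ, x, z)| ≤
      |δ| * (C * ((1 + ‖z‖) ^ 2 * (1 + ‖ζ‖) ^ 2))) ∧
    ∀ ζ x z : Eucl n, Tendsto (fun δ => (tripLog n f V t (1 + δ) (ζ, x, z) +
      tripLog n f V t (1 - δ) (ζ, x, z)) / δ) (𝓝[≠] 0) (𝓝 0) := by
  obtain ⟨C, hC, hb⟩ := log_bound (heat_dec hf zero_le_one) (heat_glb hf hfl zero_le_one)
  have hEq : ∀ δ : ℝ, |δ| ≤ 1 / 2 → ∀ ζ x z : Eucl n,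
      tripLog n f V t (1 + δ) (ζ, x, z) + tripLog n f V t (1 - δ) (ζ, x, z) =
      ((Real.log (heat n 1 f (z + (1 + δ) • ζ)) + (1 + δ) ^ 2 * ‖ζ‖ ^ 2 / 2) +
      (Real.log (heat n 1 f (z + (1 - δ) • ζ)) + (1 - δ) ^ 2 * ‖ζ‖ ^ 2 / 2) -
      2 * (Real.log (heat n 1 f (z + (1:ℝ) • ζ)) + (1:ℝ) ^ 2 * ‖ζ‖ ^ 2 / 2)) +
      δ ^ 2 * (‖ζ‖ ^ 2 / t) - n * Real.log (1 - δ ^ 2) := fun δ hδ ζ x z => by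
    have hδ' := abs_le.1 hδ
    have h1 : 0 < 1 + δ := by linarith
    have h2 : 0 < 1 - δ := by linarith
    have e : Real.log (1 - δ ^ 2) = Real.log (1 + δ) + Real.log (1 - δ) := by
      rw [← Real.log_mul h1.ne' h2.ne']; congr 1; ring
    rw [tripLog_eq hf hfl hV0 ht h1, tripLog_eq hf hfl hV0 ht h2, e]
    have n1 : ∀ b : ℝ, ‖x - (z + b • ζ)‖ ^ 2 =
        ‖x - z‖ ^ 2 - 2 * (b * inner ℝ (x - z) ζ) + b ^ 2 * ‖ζ‖ ^ 2 := fun b => by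
      rw [← sub_sub, norm_sub_sq_real, inner_smul_right, norm_smul, mul_pow, Real.norm_eq_abs,
        sq_abs]
    rw [n1, n1, n1]
    field_simp
    ring
  have hlog : ∀ δ : ℝ, |δ| ≤ 1 / 2 → |Real.log (1 - δ ^ 2)| ≤ 2 * δ ^ 2 := fun δ hδ => by
    have hδ' : δ ^ 2 ≤ 1 / 4 := by
      rw [← sq_abs]
      calc _ ≤ (1 / 2 : ℝ) ^ 2 := by gcongr
        _ = _ := by norm_num
    have h0 := sq_nonneg δ
    have hp : 0 < 1 - δ ^ 2 := by linarith
    rw [abs_of_nonpos (Real.log_nonpos hp.le (by linarith))]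
    have := Real.one_sub_inv_le_log_of_pos hp
    have h2 : (1 - δ ^ 2)⁻¹ ≤ 1 + 2 * δ ^ 2 := by
      rw [inv_le_iff_one_le_mul₀ hp]; nlinarith
    linarith
  refine ⟨⟨2 * (36 * C + 1) + 1 / t + 2 * n, by positivity, fun δ hδ ζ x z => ?_⟩, fun ζ x z => ?_⟩
  · obtain ⟨c1, c2, -⟩ := second_diff_convex (log_heat_line hf hfl z ζ).1
      (log_heat_line hf hfl z ζ).2
    have c1 := c1 δ
    have c2 := c2 δ hδ
    rw [hEq δ hδ]
    set M := (1 + ‖z‖) ^ 2 * (1 + ‖ζ‖) ^ 2 with hM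
    have hz := norm_nonneg z
    have hζ := norm_nonneg ζ
    have hM1 : 1 ≤ M := by
      rw [hM, ← mul_pow]
      exact one_le_pow₀ (by nlinarith)
    have hL : ∀ b : ℝ, 0 < b → b ≤ 2 → |Real.log (heat n 1 f (z + b • ζ))| ≤ 9 * C * M :=
      fun b h0 h1 => by
      have e1 : ‖z + b • ζ‖ ≤ ‖z‖ + 2 * ‖ζ‖ := by
        refine (norm_add_le _ _).trans ?_
        rw [norm_smul, Real.norm_eq_abs, abs_of_pos h0]
        nlinarith
      have e2 : 1 + ‖z + b • ζ‖ ≤ 3 * ((1 + ‖z‖) * (1 + ‖ζ‖)) := by nlinarith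
      refine (hb _).trans ?_
      calc _ ≤ C * (3 * ((1 + ‖z‖) * (1 + ‖ζ‖))) ^ 2 := by gcongr
        _ = _ := by rw [hM]; ring
    have hζM : ‖ζ‖ ^ 2 ≤ M := by
      rw [hM]
      nlinarith [mul_nonneg hz (sq_nonneg (1 + ‖ζ‖)), mul_nonneg (sq_nonneg ‖z‖) (sq_nonneg (1 + ‖ζ‖))]
    have l1 := abs_le.1 (hL (3 / 2) (by norm_num) (by norm_num))
    have l2 := abs_le.1 (hL (1 / 2) (by norm_num) (by norm_num))
    have l3 := abs_le.1 (hL 1 (by norm_num) (by norm_num))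
    have l4 := hlog δ hδ
    set D := (Real.log (heat n 1 f (z + (1 + δ) • ζ)) + (1 + δ) ^ 2 * ‖ζ‖ ^ 2 / 2) +
      (Real.log (heat n 1 f (z + (1 - δ) • ζ)) + (1 - δ) ^ 2 * ‖ζ‖ ^ 2 / 2) -
      2 * (Real.log (heat n 1 f (z + (1:ℝ) • ζ)) + (1:ℝ) ^ 2 * ‖ζ‖ ^ 2 / 2)
    have hδ2 : δ ^ 2 ≤ |δ| := by
      rw [← sq_abs]; nlinarith [abs_nonneg δ]
    have b1 : |D| ≤ |δ| * (2 * (36 * C + 1) * M) := by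
      rw [abs_of_nonneg c1]
      refine c2.trans (mul_le_mul_of_nonneg_left ?_ (abs_nonneg δ))
      linarith
    have b2 : |δ ^ 2 * (‖ζ‖ ^ 2 / t)| ≤ |δ| * (1 / t * M) := by
      rw [abs_of_nonneg (by positivity), one_div_mul_eq_div]
      gcongr
    have b3 : |n * Real.log (1 - δ ^ 2)| ≤ |δ| * (2 * n * M) := by
      rw [abs_mul, Nat.abs_cast]
      calc _ ≤ (n:ℝ) * (2 * |δ|) := by gcongr; linarith
        _ ≤ (n:ℝ) * (2 * |δ|) * M := le_mul_of_one_le_right (by positivity) hM1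
        _ = _ := by ring
    refine (abs_sub _ _).trans ((add_le_add_left (abs_add_le _ _) _).trans ?_)
    linarith
  · obtain ⟨-, -, c3⟩ := second_diff_convex (log_heat_line hf hfl z ζ).1
      (log_heat_line hf hfl z ζ).2
    have hid : Tendsto (fun δ : ℝ => δ) (𝓝[≠] 0) (𝓝 0) := tendsto_id.mono_left nhdsWithin_le_nhds
    have h2 : Tendsto (fun δ : ℝ => n * (Real.log (1 - δ ^ 2) / δ)) (𝓝[≠] 0) (𝓝 0) := by
      have : Tendsto (fun δ : ℝ => n * (2 * |δ|)) (𝓝[≠] 0) (𝓝 0) := by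
        simpa using (hid.abs.const_mul 2).const_mul (n:ℝ)
      refine squeeze_zero_norm' ?_ this
      have hev : ∀ᶠ δ : ℝ in 𝓝[≠] 0, |δ| ≤ 1 / 2 ∧ δ ≠ 0 := by
        refine (Filter.Eventually.filter_mono nhdsWithin_le_nhds ?_).and self_mem_nhdsWithin
        filter_upwards [Metric.closedBall_mem_nhds (0:ℝ) (show (0:ℝ) < 1 / 2 by norm_num)] with δ hδ
        simpa using hδ
      filter_upwards [hev] with δ hδ
      rw [norm_mul, norm_div, Real.norm_eq_abs, Real.norm_eq_abs, Real.norm_eq_abs, Nat.abs_cast]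
      gcongr
      rw [div_le_iff₀ (abs_pos.2 hδ.2), mul_assoc, ← sq, sq_abs]
      exact hlog δ hδ.1
    have h3 := (c3.add (hid.mul_const (‖ζ‖ ^ 2 / t))).sub h2
    simp only [zero_mul, add_zero, sub_zero] at h3
    refine h3.congr' ?_
    have hev : ∀ᶠ δ : ℝ in 𝓝[≠] 0, |δ| ≤ 1 / 2 ∧ δ ≠ 0 := by
      refine (Filter.Eventually.filter_mono nhdsWithin_le_nhds ?_).and self_mem_nhdsWithin
      filter_upwards [Metric.closedBall_mem_nhds (0:ℝ) (show (0:ℝ) < 1 / 2 by norm_num)] with δ hδ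
      simpa using hδ
    filter_upwards [hev] with δ hδ
    rw [hEq δ hδ.1]
    have := hδ.2
    field_simp

end

section
variable {n : ℕ} {f g V : Eucl n → ℝ} {t a : ℝ}

lemma trip_map_schrod (hf : Dec n f) (hfl : GLB n f) (hg : Dec n g) (hV : Dec n V)
    (hV0 : ∀ y, 0 < V y) (ht : 0 < t) (hE : ∀ y, heat n t V y = g y * heat n 1 f y) (ha : 0 < a) :
    (trip n (backDens n f) V t a).map (fun p => (p.2.1, p.2.2 + a • p.1)) = schrod n f g := by
  rw [trip_map (backDens_cont hf hfl) (fun p => (backDens_pos hf hfl p).le) hV (fun y => (hV0 y).le)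
    ht ha, schrod_eq hf hg]
  congr 1; ext p
  have hF0 := ((heat_glb hf hfl zero_le_one).pos p.2).ne'
  congr 1
  rw [hE, backDens, hker]
  field_simp

lemma tripDens_pos (hf : Dec n f) (hfl : GLB n f) (hV0 : ∀ y, 0 < V y) (ht : 0 < t) (ha : 0 < a)
    (p : Eucl n × Eucl n × Eucl n) : 0 < tripDens n (backDens n f) V t a p :=
  mul_pos (backDens_pos hf hfl _) (mul_pos (hV0 _) (mul_pos (by positivity) (hk_pos ht _)))

lemma trip_integrable (hf : Dec n f) (hfl : GLB n f) (hV : Continuous V) (hV0 : ∀ y, 0 < V y)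
    (ht : 0 < t) {F : Eucl n × Eucl n × Eucl n → ℝ} :
    Integrable F (trip n (backDens n f) V t 1) ↔
    Integrable fun p => tripDens n (backDens n f) V t 1 p * F p := by
  have hm := (tripDens_cont (t := t) (a := 1) (backDens_cont hf hfl) hV).measurable
  rw [trip, integrable_withDensity_iff_integrable_smul' (by fun_prop) (by simp)]
  refine integrable_congr (Eventually.of_forall fun x => ?_)
  simp only [ENNReal.toReal_ofReal (tripDens_pos hf hfl hV0 ht one_pos x).le, smul_eq_mul]

lemma trip_moment (hf : Dec n f) (hfl : GLB n f) (hV : Dec n V) (hV0 : ∀ y, 0 < V y) (ht : 0 < t) :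
    Integrable (fun p => (1 + ‖p.2.2‖) ^ 2 * (1 + ‖p.1‖) ^ 2) (trip n (backDens n f) V t 1) := by
  have hVc := hV.1
  have hkc := hk_cont n t
  have hm : Measurable fun p : Eucl n × Eucl n × Eucl n => (p.1, p.2.2) := by fun_prop
  have h := trip_proj (backDens_cont hf hfl) (fun p => (backDens_pos hf hfl p).le)
    (backDens_int hf) (backDens_integral hf hfl) hVc (fun y => (hV0 y).le) ht
  have h2 : Integrable (fun r : Eucl n × Eucl n => (1 + ‖r.2‖) ^ 2 * (1 + ‖r.1‖) ^ 2)
      (volume.withDensity fun p : Eucl n × Eucl n => ENNReal.ofReal (V p.2 * hk n t p.1)) := by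
    have hmm : Measurable fun p : Eucl n × Eucl n => V p.2 * hk n t p.1 :=
      Continuous.measurable (by fun_prop)
    rw [integrable_withDensity_iff_integrable_smul' (by fun_prop) (by simp)]
    have := Integrable.mul_prod ((hk_dec (n := n) ht).integrable 2) (hV.integrable 2)
    refine this.congr (Eventually.of_forall fun r => ?_)
    simp only [ENNReal.toReal_ofReal (mul_pos (hV0 r.2) (hk_pos ht r.1)).le, smul_eq_mul]
    ring
  rw [← h] at h2
  exact h2.comp_measurable hm

/-- Competitors for the entropic cost along the heat flow at a positive time. -/
lemma pos_competitor (hf : Dec n f) (hfl : GLB n f) (hg : Dec n g) (hgl : GLB n g)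
    (hV : Dec n V) (hVl : GLB n V) (ht : 0 < t)
    (hE : ∀ y, heat n t V y = g y * heat n 1 f y)
    (hU : IsProbabilityMeasure (densMeas n fun x => f x * heat n 1 g x)) :
    ∃ h : ℝ → ℝ, Tendsto (fun δ => h δ / δ) (𝓝[≠] 0) (𝓝 0) ∧ ∀ δ, |δ| ≤ 1 / 2 → 0 ≤ h δ ∧
      ∃ π, Coupling π (densMeas n fun x => f x * heat n 1 g x)
        (densMeas n (heat n ((1 + δ) ^ 2 * t) V)) ∧
        InformationTheory.klDiv π (schrod n f g) ≤ ENNReal.ofReal (h δ) := by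
  have hV0 := hVl.pos
  have hsc := schrod_coupling hf hfl.pos hg hgl.pos hU
  have hsp := hsc.1
  set N := trip n (backDens n f) V t 1 with hN
  set A := tripDens n (backDens n f) V t 1 with hA
  have hqc := backDens_cont hf hfl
  have hDc : ∀ a, Continuous (tripDens n (backDens n f) V t a) := fun a => tripDens_cont hqc hV.1
  have hΦ : ∀ a : ℝ, Measurable fun p : Eucl n × Eucl n × Eucl n => (p.2.1, p.2.2 + a • p.1) :=
    fun a => by fun_prop
  have hms : ∀ a : ℝ, 0 < a → (trip n (backDens n f) V t a).map
      (fun p => (p.2.1, p.2.2 + a • p.1)) = schrod n f g := fun a ha =>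
    trip_map_schrod hf hfl hg hV hV0 ht hE ha
  have hprob : ∀ a : ℝ, 0 < a → IsProbabilityMeasure (trip n (backDens n f) V t a) := fun a ha => by
    constructor
    have h1 := hsp.measure_univ
    rwa [← hms a ha, Measure.map_apply (hΦ a) MeasurableSet.univ, preimage_univ] at h1
  have hNp := hprob 1 one_pos
  have hfst : N.map (fun p => p.2.1) = densMeas n fun x => f x * heat n 1 g x := by
    rw [← hsc.2.1, ← hms 1 one_pos, Measure.map_map measurable_fst (hΦ 1)]
    rfl
  have hsnd : ∀ a : ℝ, 0 < a → N.map (fun p => p.2.2 + a • p.1) =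
      densMeas n (heat n (a ^ 2 * t) V) := fun a ha => by
    rw [← dilate_map hV (fun y => (hV0 y).le) ht ha, ← trip_proj hqc
      (fun p => (backDens_pos hf hfl p).le) (backDens_int hf) (backDens_integral hf hfl) hV.1
      (fun y => (hV0 y).le) ht, Measure.map_map (by fun_prop) (by fun_prop)]
    rfl
  have hmom := trip_moment hf hfl hV hV0 ht
  have hx2 : Integrable (fun p : Eucl n × Eucl n × Eucl n => ‖p.2.1‖ ^ 2) N := by
    have hUd := hf.mul (heat_dec hg zero_le_one)
    have : Integrable (fun x : Eucl n => ‖x‖ ^ 2) (densMeas n fun x => f x * heat n 1 g x) := by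
      rw [integrable_densMeas (fun x => (mul_pos (hfl.pos x)
        ((heat_glb hg hgl zero_le_one).pos x)).le) hUd.1.measurable]
      refine (hUd.integrable 2).norm.mono' ((continuous_norm.pow 2).mul hUd.1).aestronglyMeasurable
        (Eventually.of_forall fun x => ?_)
      have h1 : ‖x‖ ^ 2 ≤ (1 + ‖x‖) ^ 2 := pow_le_pow_left₀ (norm_nonneg x) (by linarith) 2
      simp only [norm_mul, norm_pow, norm_norm]
      rw [mul_comm, Real.norm_of_nonneg (by positivity : 0 ≤ 1 + ‖x‖)]
      exact mul_le_mul_of_nonneg_left h1 (by positivity)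
    rw [← hfst] at this
    exact this.comp_measurable (by fun_prop)
  have hlogm : ∀ a, Measurable (tripLog n f V t a) := fun a =>
    ((hDc 1).measurable.log).sub ((hDc a).measurable.log)
  have hInt : ∀ a : ℝ, 0 < a → a ≤ 2 → Integrable fun p => A p * tripLog n f V t a p :=
    fun a ha ha2 => by
    rw [← trip_integrable hf hfl hV.1 hV0 ht]
    obtain ⟨C, hC, hb⟩ := tripLog_bound hf hfl hV0 ht ha ha2
    exact ((hx2.add hmom).const_mul C).mono' (hlogm a).aestronglyMeasurable
      (Eventually.of_forall fun p => hb p.1 p.2.1 p.2.2)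
  have hkl : ∀ a : ℝ, 0 < a → a ≤ 2 → InformationTheory.klDiv N (trip n (backDens n f) V t a) =
      ENNReal.ofReal (∫ p, A p * tripLog n f V t a p) ∧ 0 ≤ ∫ p, A p * tripLog n f V t a p :=
    fun a ha ha2 => klDiv_withDensity (hDc 1).measurable (hDc a).measurable
      (tripDens_pos hf hfl hV0 ht one_pos) (tripDens_pos hf hfl hV0 ht ha) hNp (hprob a ha)
      (hInt a ha ha2)
  obtain ⟨⟨C, hC, hCb⟩, hlim⟩ := tripLog_second hf hfl hV0 ht
  have hM := (trip_integrable hf hfl hV.1 hV0 ht).1 (hmom.const_mul C)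
  refine ⟨fun δ => ∫ p, A p * (tripLog n f V t (1 + δ) p + tripLog n f V t (1 - δ) p), ?_,
    fun δ hδ => ?_⟩
  · have hev : ∀ᶠ δ : ℝ in 𝓝[≠] 0, |δ| ≤ 1 / 2 ∧ δ ≠ 0 := by
      refine (Filter.Eventually.filter_mono nhdsWithin_le_nhds ?_).and self_mem_nhdsWithin
      filter_upwards [Metric.closedBall_mem_nhds (0:ℝ) (show (0:ℝ) < 1 / 2 by norm_num)] with δ hδ
      simpa using hδ
    simp_rw [← integral_div]
    suffices H : Tendsto (fun δ : ℝ => ∫ p, A p * (tripLog n f V t (1 + δ) p +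
        tripLog n f V t (1 - δ) p) / δ) (𝓝[≠] 0) (𝓝 (∫ _ : Eucl n × Eucl n × Eucl n, (0:ℝ))) by
      rwa [integral_zero] at H
    refine tendsto_integral_filter_of_dominated_convergence _ ?_ ?_ hM
      (Eventually.of_forall fun p => ?_)
    · exact Eventually.of_forall fun δ => (((hDc 1).measurable.mul
        ((hlogm _).add (hlogm _))).div_const δ).aestronglyMeasurable
    · filter_upwards [hev] with δ hδ
      refine Eventually.of_forall fun p => ?_
      have hA0 := tripDens_pos hf hfl hV0 ht one_pos p
      rw [norm_div, norm_mul, Real.norm_eq_abs, Real.norm_eq_abs, Real.norm_eq_abs,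
        abs_of_pos hA0, div_le_iff₀ (abs_pos.2 hδ.2), mul_assoc]
      refine mul_le_mul_of_nonneg_left ?_ hA0.le
      rw [mul_comm _ |δ|]
      exact hCb δ hδ.1 p.1 p.2.1 p.2.2
    · have := (hlim p.1 p.2.1 p.2.2).const_mul (A p)
      simpa [mul_div_assoc] using this
  · have hδ' := abs_le.1 hδ
    have p1 : 0 < 1 + δ := by linarith
    have p2 : 0 < 1 - δ := by linarith
    have k1 := hkl (1 + δ) p1 (by linarith)
    have k2 := hkl (1 - δ) p2 (by linarith)
    have hsum : ∫ p, A p * (tripLog n f V t (1 + δ) p + tripLog n f V t (1 - δ) p) =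
        (∫ p, A p * tripLog n f V t (1 + δ) p) + ∫ p, A p * tripLog n f V t (1 - δ) p := by
      rw [← integral_add (hInt _ p1 (by linarith)) (hInt _ p2 (by linarith))]
      simp_rw [mul_add]
    refine ⟨by beta_reduce; rw [hsum]; exact add_nonneg k1.2 k2.2,
      N.map (fun p => (p.2.1, p.2.2 + (1 + δ) • p.1)), ⟨?_, ?_, ?_⟩, ?_⟩
    · exact Measure.isProbabilityMeasure_map (hΦ _).aemeasurable
    · rw [Measure.map_map measurable_fst (hΦ _), ← hfst]; rfl
    · rw [Measure.map_map measurable_snd (hΦ _), ← hsnd _ p1]; rfl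
    · rw [← hms _ p1]
      have := hprob _ p1
      refine (InformationTheory.klDiv_map_le _ _ (hΦ _)).trans ?_
      beta_reduce
      rw [k1.1, hsum]
      exact ENNReal.ofReal_le_ofReal (le_add_of_nonneg_right k2.2)

end

section

/-- Differentiation under the integral sign along an arbitrary set of parameters. -/
lemma hasDerivWithinAt_integral_of_lipschitz {X : Type*} [MeasurableSpace X] {μ : Measure X}
    {F : ℝ → X → ℝ} {L B : X → ℝ} {S : Set ℝ} {s₀ : ℝ} (h₀ : s₀ ∈ S)
    (hF : ∀ s ∈ S, Integrable (F s) μ) (hB : Integrable B μ)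
    (hb : ∀ s ∈ S, ∀ x, |F s x - F s₀ x| ≤ |s - s₀| * B x)
    (hd : ∀ x, HasDerivWithinAt (fun s => F s x) (L x) S s₀) :
    HasDerivWithinAt (fun s => ∫ x, F s x ∂μ) (∫ x, L x ∂μ) S s₀ := by
  rw [hasDerivWithinAt_iff_tendsto_slope]
  have hev : ∀ᶠ s in 𝓝[S \ {s₀}] s₀, s ∈ S ∧ s ≠ s₀ := self_mem_nhdsWithin
  have key : Tendsto (fun s => ∫ x, slope (fun s => F s x) s₀ s ∂μ) (𝓝[S \ {s₀}] s₀)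
      (𝓝 (∫ x, L x ∂μ)) := by
    refine tendsto_integral_filter_of_dominated_convergence B ?_ ?_ hB
      (Eventually.of_forall fun x => hasDerivWithinAt_iff_tendsto_slope.1 (hd x))
    · filter_upwards [hev] with s hs
      simp only [slope_def_field]
      exact (((hF s hs.1).sub (hF s₀ h₀)).div_const _).aestronglyMeasurable
    · filter_upwards [hev] with s hs
      refine Eventually.of_forall fun x => ?_
      have : 0 < |s - s₀| := abs_pos.2 (sub_ne_zero.2 hs.2)
      rw [slope_def_field, Real.norm_eq_abs, abs_div, div_le_iff₀ this, mul_comm]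
      exact hb s hs.1 x
  refine key.congr' ?_
  filter_upwards [hev] with s hs
  simp only [slope_def_field]
  rw [integral_div, integral_sub (hF s hs.1) (hF s₀ h₀)]

lemma mul_log_tangent {a b : ℝ} (ha : 0 < a) (hb : 0 < b) :
    b * Real.log b + (1 + Real.log b) * (a - b) ≤ a * Real.log a := by
  have h := Real.one_sub_inv_le_log_of_pos (div_pos ha hb)
  rw [Real.log_div ha.ne' hb.ne', inv_div] at h
  have h2 := mul_le_mul_of_nonneg_left h ha.le
  have : a * (1 - b / a) = a - b := by field_simp
  nlinarith

lemma abs_mul_log_sub_le {a b : ℝ} (ha : 0 < a) (hb : 0 < b) :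
    |a * Real.log a - b * Real.log b| ≤ |a - b| * (1 + |Real.log a| + |Real.log b|) := by
  have h1 := mul_log_tangent ha hb
  have h2 := mul_log_tangent hb ha
  have e1 : |(1 + Real.log b) * (a - b)| ≤ |a - b| * (1 + |Real.log a| + |Real.log b|) := by
    rw [abs_mul, mul_comm]
    refine mul_le_mul_of_nonneg_left ((abs_add_le _ _).trans ?_) (abs_nonneg _)
    rw [abs_one]; linarith [abs_nonneg (Real.log a)]
  have e2 : |(1 + Real.log a) * (a - b)| ≤ |a - b| * (1 + |Real.log a| + |Real.log b|) := by
    rw [abs_mul, mul_comm]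
    refine mul_le_mul_of_nonneg_left ((abs_add_le _ _).trans ?_) (abs_nonneg _)
    rw [abs_one]; linarith [abs_nonneg (Real.log b)]
  rw [abs_le] at e1 e2 ⊢
  constructor <;> nlinarith

variable {n : ℕ} {f g V : Eucl n → ℝ} {t : ℝ}

/-- A family of densities that is differentiable in its parameter, with rapidly decaying
difference quotients and logarithms of quadratic growth. -/
structure SmoothAt (n : ℕ) (W : ℝ → Eucl n → ℝ) (S : Set ℝ) (s₀ : ℝ) : Prop where
  mem : s₀ ∈ S
  dec : ∀ s ∈ S, Dec n (W s)
  pos : ∀ s ∈ S, ∀ y, 0 < W s y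
  lip : ∀ k : ℕ, ∃ C, 0 ≤ C ∧ ∀ s ∈ S, ∀ y, |W s y - W s₀ y| * (1 + ‖y‖) ^ k ≤ C * |s - s₀|
  log : ∃ C, 0 ≤ C ∧ ∀ s ∈ S, ∀ y, |Real.log (W s y)| ≤ C * (1 + ‖y‖) ^ 2
  deriv : ∃ L : Eucl n → ℝ, ∀ y, HasDerivWithinAt (fun s => W s y) (L y) S s₀

lemma one_add_norm_inv_integrable (n : ℕ) :
    Integrable (fun y : Eucl n => ((1 + ‖y‖) ^ (n + 1))⁻¹) := by
  have := integrable_one_add_norm (E := Eucl n) (μ := volume) (r := (n + 1 : ℕ)) (by simp)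
  refine this.congr (Eventually.of_forall fun y => ?_)
  simp only
  rw [Real.rpow_neg (by positivity), Real.rpow_natCast]

lemma SmoothAt.lip_weight {W : ℝ → Eucl n → ℝ} {S : Set ℝ} {s₀ : ℝ} (h : SmoothAt n W S s₀) :
    ∃ B : Eucl n → ℝ, Integrable B ∧
      ∀ s ∈ S, ∀ y, |W s y - W s₀ y| * (1 + ‖y‖) ^ 2 ≤ |s - s₀| * B y := by
  obtain ⟨C, hC, hb⟩ := h.lip (2 + (n + 1))
  refine ⟨_, (one_add_norm_inv_integrable n).const_mul C, fun s hs y => ?_⟩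
  have h1 := hb s hs y
  have hp : 0 < (1 + ‖y‖) ^ (n + 1) := by positivity
  rw [pow_add, ← mul_assoc, ← le_div_iff₀ hp] at h1
  refine h1.trans (le_of_eq ?_)
  rw [div_eq_mul_inv]; ring

lemma Dec.integrable_of_le {w F : Eucl n → ℝ} (hw : Dec n w) (hF : AEStronglyMeasurable F volume)
    {C : ℝ} (hb : ∀ y, |F y| ≤ C * (1 + ‖y‖) ^ 2) : Integrable fun y => w y * F y := by
  refine ((hw.integrable 2).norm.const_mul C).mono' (hw.1.aestronglyMeasurable.mul hF)
    (Eventually.of_forall fun y => ?_)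
  rw [norm_mul, norm_mul, Real.norm_eq_abs, Real.norm_eq_abs, Real.norm_eq_abs,
    abs_of_nonneg (by positivity : (0:ℝ) ≤ (1 + ‖y‖) ^ 2)]
  calc |w y| * |F y| ≤ |w y| * (C * (1 + ‖y‖) ^ 2) :=
        mul_le_mul_of_nonneg_left (hb y) (abs_nonneg _)
    _ = _ := by ring

lemma SmoothAt.differentiable_integral {W : ℝ → Eucl n → ℝ} {S : Set ℝ} {s₀ : ℝ}
    (h : SmoothAt n W S s₀) {F : Eucl n → ℝ} (hF : AEStronglyMeasurable F volume)
    {C : ℝ} (hC : 0 ≤ C) (hb : ∀ y, |F y| ≤ C * (1 + ‖y‖) ^ 2) :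
    DifferentiableWithinAt ℝ (fun s => ∫ y, W s y * F y) S s₀ := by
  obtain ⟨B, hB, hBb⟩ := h.lip_weight
  obtain ⟨L, hL⟩ := h.deriv
  refine (hasDerivWithinAt_integral_of_lipschitz h.mem
    (fun s hs => (h.dec s hs).integrable_of_le hF hb) (hB.const_mul C) (fun s hs y => ?_)
    (fun y => (hL y).mul_const (F y))).differentiableWithinAt
  rw [← sub_mul, abs_mul]
  calc |W s y - W s₀ y| * |F y| ≤ |W s y - W s₀ y| * (C * (1 + ‖y‖) ^ 2) :=
        mul_le_mul_of_nonneg_left (hb y) (abs_nonneg _)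
    _ = C * (|W s y - W s₀ y| * (1 + ‖y‖) ^ 2) := by ring
    _ ≤ C * (|s - s₀| * B y) := mul_le_mul_of_nonneg_left (hBb s hs y) hC
    _ = _ := by ring

lemma SmoothAt.differentiable_entDens {W : ℝ → Eucl n → ℝ} {S : Set ℝ} {s₀ : ℝ}
    (h : SmoothAt n W S s₀) : DifferentiableWithinAt ℝ (fun s => entDens n (W s)) S s₀ := by
  obtain ⟨B, hB, hBb⟩ := h.lip_weight
  obtain ⟨L, hL⟩ := h.deriv
  obtain ⟨C, hC, hb⟩ := h.log
  have hm : ∀ s ∈ S, AEStronglyMeasurable (fun y => Real.log (W s y)) volume := fun s hs =>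
    (h.dec s hs).1.measurable.log.aestronglyMeasurable
  refine (hasDerivWithinAt_integral_of_lipschitz h.mem
    (fun s hs => (h.dec s hs).integrable_of_le (hm s hs) (hb s hs))
    (hB.const_mul (1 + 2 * C)) (fun s hs y => ?_)
    (fun y => (hL y).mul ((hL y).log (h.pos _ h.mem y).ne'))).differentiableWithinAt
  refine (abs_mul_log_sub_le (h.pos s hs y) (h.pos _ h.mem y)).trans ?_
  have h1 : (1:ℝ) ≤ (1 + ‖y‖) ^ 2 := one_le_pow₀ (by linarith [norm_nonneg y])
  calc |W s y - W s₀ y| * (1 + |Real.log (W s y)| + |Real.log (W s₀ y)|)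
      ≤ |W s y - W s₀ y| * ((1 + 2 * C) * (1 + ‖y‖) ^ 2) := by
        refine mul_le_mul_of_nonneg_left ?_ (abs_nonneg _)
        linarith [hb s hs y, hb _ h.mem y]
    _ = (1 + 2 * C) * (|W s y - W s₀ y| * (1 + ‖y‖) ^ 2) := by ring
    _ ≤ (1 + 2 * C) * (|s - s₀| * B y) := mul_le_mul_of_nonneg_left (hBb s hs y) (by linarith)
    _ = _ := by ring

lemma smoothAt_zero (hf : Dec n f) (hfl : GLB n f) (hg : IsSchwartz n g) (hgl : GLB n g) :
    SmoothAt n (fun s => heat n s fun y => g y * heat n 1 f y) (Icc 0 1) 0 := by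
  have hV : Dec n fun y => g y * heat n 1 f y := hg.dec.mul (heat_dec hf zero_le_one)
  have hVl : GLB n fun y => g y * heat n 1 f y := hgl.mul (heat_glb hf hfl zero_le_one)
  refine ⟨by simp, fun s hs => heat_dec hV hs.1, fun s hs => (heat_glb hV hVl hs.1).pos,
    fun k => ?_, ?_, ?_⟩
  · obtain ⟨C, hC, hb⟩ := V_diff hf hg k
    refine ⟨C, hC, fun s hs y => ?_⟩
    rw [heat_zero, sub_zero, abs_of_nonneg hs.1]
    exact hb s hs.1 hs.2 y
  · obtain ⟨C, hC, hb⟩ := heat_log_unif hV hVl 1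
    exact ⟨C, hC, fun s hs => hb s hs.1 hs.2⟩
  · obtain ⟨L, hL⟩ := V_lim hf hg
    refine ⟨L, fun y => ?_⟩
    rw [hasDerivWithinAt_iff_tendsto_slope]
    have hsub : Icc (0:ℝ) 1 \ {0} ⊆ Ioi 0 := fun s hs => lt_of_le_of_ne hs.1.1 (Ne.symm hs.2)
    refine ((hL y).mono_left (nhdsWithin_mono _ hsub)).congr fun s => ?_
    rw [slope_def_field, heat_zero, sub_zero]

lemma hk_hasDerivAt {s : ℝ} (hs : 0 < s) (x : Eucl n) :
    HasDerivAt (fun s => hk n s x) (hk n s x * (‖x‖ ^ 2 / (2 * s ^ 2) - n / (2 * s))) s := by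
  have hform : ∀ r : ℝ, 0 < r →
      hk n r x = Real.exp (-‖x‖ ^ 2 / 2 * r⁻¹ - Real.log (2 * Real.pi * r) * (n / 2)) := by
    intro r hr
    rw [hk, Real.rpow_def_of_pos (by positivity), ← Real.exp_sub]
    congr 2
    field_simp
  have h2 : HasDerivAt (fun r : ℝ => 2 * Real.pi * r) (2 * Real.pi) s := by
    simpa using (hasDerivAt_id s).const_mul (2 * Real.pi)
  have h3 := (((hasDerivAt_inv hs.ne').const_mul (-‖x‖ ^ 2 / 2)).sub
    ((h2.log (by positivity)).mul_const ((n : ℝ) / 2))).exp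
  refine (h3.congr_of_eventuallyEq ?_).congr_deriv ?_
  · filter_upwards [lt_mem_nhds hs] with r hr
    simpa using hform r hr
  · rw [hform s hs]
    simp only [Pi.sub_apply]
    congr 1
    have := Real.pi_pos.ne'
    field_simp

lemma hk_deriv_bound (ht : 0 < t) : ∃ C, 0 ≤ C ∧ ∀ s ∈ Icc (t / 2) (2 * t), ∀ x : Eucl n,
    |hk n s x * (‖x‖ ^ 2 / (2 * s ^ 2) - n / (2 * s))| ≤ C * hk n (4 * t) x := by
  refine ⟨8 ^ ((n:ℝ) / 2) * ((16 + n) / t), by positivity, fun s hs x => ?_⟩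
  have hs0 : 0 < s := lt_of_lt_of_le (by positivity) hs.1
  set r := ‖x‖ ^ 2 with hr
  have hr0 : 0 ≤ r := by positivity
  set e := Real.exp (-r / (8 * t)) with he
  have he0 : 0 < e := Real.exp_pos _
  have he1 : e ≤ 1 := Real.exp_le_one_iff.2 (div_nonpos_of_nonpos_of_nonneg (by linarith) (by positivity))
  have hre : r * e ≤ 8 * t := by
    have h1 := Real.add_one_le_exp (r / (8 * t))
    have h2 : e * Real.exp (r / (8 * t)) = 1 := by
      rw [he, ← Real.exp_add, ← Real.exp_zero]; congr 1; ring
    have h3 : r / (8 * t) * e ≤ 1 := by nlinarith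
    rw [div_mul_eq_mul_div, div_le_one (by positivity)] at h3
    exact h3
  have hhk : hk n s x ≤ 8 ^ ((n:ℝ) / 2) * hk n (4 * t) x * e := by
    have hd : (2 * Real.pi * (4 * t)) ^ ((n:ℝ) / 2) ≤
        8 ^ ((n:ℝ) / 2) * (2 * Real.pi * s) ^ ((n:ℝ) / 2) := by
      rw [← Real.mul_rpow (by norm_num) (by positivity)]
      refine Real.rpow_le_rpow (by positivity) ?_ (by positivity)
      nlinarith [Real.pi_pos, hs.1]
    have hee : Real.exp (-r / (2 * s)) ≤ e * e := by
      rw [he, ← Real.exp_add, Real.exp_le_exp]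
      have : -r / (8 * t) + -r / (8 * t) = -(r / (4 * t)) := by field_simp; ring
      rw [this, neg_div, neg_le_neg_iff]
      exact div_le_div_of_nonneg_left hr0 (by positivity) (by linarith [hs.2])
    have hD : 0 < (2 * Real.pi * s) ^ ((n:ℝ) / 2) := by positivity
    have hD' : 0 < (2 * Real.pi * (4 * t)) ^ ((n:ℝ) / 2) := by positivity
    have heq : hk n (4 * t) x = e / (2 * Real.pi * (4 * t)) ^ ((n:ℝ) / 2) := by
      rw [hk, he]; congr 3; ring
    rw [heq, hk, div_le_iff₀ hD]
    refine hee.trans ?_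
    have : e * e = 1 * (e * e) := by ring
    rw [this]
    have h1 : 1 ≤ 8 ^ ((n:ℝ) / 2) * (2 * Real.pi * s) ^ ((n:ℝ) / 2) /
        (2 * Real.pi * (4 * t)) ^ ((n:ℝ) / 2) := (one_le_div hD').2 hd
    refine (mul_le_mul_of_nonneg_right h1 (by positivity)).trans (le_of_eq ?_)
    ring
  have hfac : |r / (2 * s ^ 2) - n / (2 * s)| ≤ 2 * r / t ^ 2 + n / t := by
    have h1 : r / (2 * s ^ 2) ≤ 2 * r / t ^ 2 := by
      rw [div_le_div_iff₀ (by positivity) (by positivity)]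
      have : t ^ 2 ≤ 4 * s ^ 2 := by nlinarith [hs.1]
      nlinarith
    have h2 : (n:ℝ) / (2 * s) ≤ n / t :=
      div_le_div_of_nonneg_left (by positivity) ht (by linarith [hs.1])
    have h3 : 0 ≤ r / (2 * s ^ 2) := by positivity
    have h4 : (0:ℝ) ≤ n / (2 * s) := by positivity
    rw [abs_le]; constructor <;> linarith
  rw [abs_mul, abs_of_pos (hk_pos hs0 x)]
  have hH := (hk_pos (n := n) (show 0 < 4 * t by positivity) x).le
  calc hk n s x * |r / (2 * s ^ 2) - n / (2 * s)|
      ≤ (8 ^ ((n:ℝ) / 2) * hk n (4 * t) x * e) * (2 * r / t ^ 2 + n / t) :=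
        mul_le_mul hhk hfac (abs_nonneg _) (by positivity)
    _ = 8 ^ ((n:ℝ) / 2) * hk n (4 * t) x * (2 * (r * e) / t ^ 2 + n / t * e) := by ring
    _ ≤ 8 ^ ((n:ℝ) / 2) * hk n (4 * t) x * (2 * (8 * t) / t ^ 2 + n / t * 1) := by
        refine mul_le_mul_of_nonneg_left (add_le_add ?_ ?_) (by positivity)
        · gcongr
        · exact mul_le_mul_of_nonneg_left he1 (by positivity)
    _ = _ := by field_simp; ring

lemma hk_lip (ht : 0 < t) : ∃ C, 0 ≤ C ∧ ∀ s ∈ Icc (t / 2) (2 * t), ∀ x : Eucl n,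
    |hk n s x - hk n t x| ≤ C * hk n (4 * t) x * |s - t| := by
  obtain ⟨C, hC, hb⟩ := hk_deriv_bound (n := n) ht
  refine ⟨C, hC, fun s hs x => ?_⟩
  have := Convex.norm_image_sub_le_of_norm_hasDerivWithin_le (f := fun s => hk n s x)
    (s := Icc (t / 2) (2 * t)) (C := C * hk n (4 * t) x) (x := t) (y := s)
    (fun r hr => (hk_hasDerivAt (lt_of_lt_of_le (by positivity) hr.1) x).hasDerivWithinAt)
    (fun r hr => hb r hr x) (convex_Icc _ _) ⟨by linarith, by linarith⟩ hs
  exact this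

lemma smoothAt_pos (hV : Dec n V) (hVl : GLB n V) (ht : 0 < t) :
    SmoothAt n (fun s => heat n s V) (Icc (t / 2) (2 * t)) t := by
  have hs0 : ∀ s ∈ Icc (t / 2) (2 * t), 0 < s := fun s hs => lt_of_lt_of_le (by positivity) hs.1
  have htS : t ∈ Icc (t / 2) (2 * t) := ⟨by linarith, by linarith⟩
  obtain ⟨C, hC, hb⟩ := hk_lip (n := n) ht
  have hInt : ∀ s, 0 < s → ∀ y, Integrable fun z => V z * hk n s (y - z) := fun s hs y => by
    obtain ⟨M, hM⟩ := hV.bdd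
    refine ((hk_integrable (n := n) hs).comp_sub_left y).bdd_mul hV.1.aestronglyMeasurable
      (c := M) (Eventually.of_forall fun z => ?_)
    simpa using hM.2 z
  have h4 : 0 < 4 * t := by positivity
  have hpt : ∀ s ∈ Icc (t / 2) (2 * t), ∀ y z,
      |V z * hk n s (y - z) - V z * hk n t (y - z)| ≤
        |s - t| * (C * (V z * hk n (4 * t) (y - z))) := fun s hs y z => by
    rw [← mul_sub, abs_mul, abs_of_pos (hVl.pos z)]
    calc V z * |hk n s (y - z) - hk n t (y - z)|
        ≤ V z * (C * hk n (4 * t) (y - z) * |s - t|) :=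
          mul_le_mul_of_nonneg_left (hb s hs _) (hVl.pos z).le
      _ = _ := by ring
  refine ⟨htS, fun s hs => heat_dec hV (hs0 s hs).le,
    fun s hs => (heat_glb hV hVl (hs0 s hs).le).pos, fun k => ?_, ?_, ?_⟩
  · obtain ⟨D, hD, hDb⟩ := (heat_dec hV h4.le).2 k
    refine ⟨C * D, by positivity, fun s hs y => ?_⟩
    have h1 : |heat n s V y - heat n t V y| ≤ |s - t| * (C * heat n (4 * t) V y) := by
      rw [heat_eq (hs0 s hs).ne', heat_eq ht.ne', heat_eq h4.ne',
        ← integral_sub (hInt s (hs0 s hs) y) (hInt t ht y), ← integral_const_mul,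
        ← integral_const_mul]
      exact norm_integral_le_of_norm_le
        (f := fun z => V z * hk n s (y - z) - V z * hk n t (y - z))
        (((hInt _ h4 y).const_mul C).const_mul _)
        (Eventually.of_forall fun z => hpt s hs y z)
    calc |heat n s V y - heat n t V y| * (1 + ‖y‖) ^ k
        ≤ |s - t| * (C * heat n (4 * t) V y) * (1 + ‖y‖) ^ k :=
          mul_le_mul_of_nonneg_right h1 (by positivity)
      _ = |s - t| * C * (heat n (4 * t) V y * (1 + ‖y‖) ^ k) := by ring
      _ ≤ |s - t| * C * (|heat n (4 * t) V y| * (1 + ‖y‖) ^ k) := by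
          refine mul_le_mul_of_nonneg_left (mul_le_mul_of_nonneg_right (le_abs_self _)
            (by positivity)) (by positivity)
      _ ≤ |s - t| * C * D := mul_le_mul_of_nonneg_left (hDb y) (by positivity)
      _ = _ := by ring
  · obtain ⟨C, hC, hb⟩ := heat_log_unif hV hVl (2 * t)
    exact ⟨C, hC, fun s hs => hb s (hs0 s hs).le hs.2⟩
  · refine ⟨fun y => ∫ z, V z * (hk n t (y - z) * (‖y - z‖ ^ 2 / (2 * t ^ 2) - n / (2 * t))),
      fun y => ?_⟩
    have := hasDerivWithinAt_integral_of_lipschitz (μ := volume) (S := Icc (t / 2) (2 * t))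
      (F := fun s z => V z * hk n s (y - z)) htS (fun s hs => hInt s (hs0 s hs) y)
      ((hInt _ h4 y).const_mul C) (fun s hs z => hpt s hs y z)
      (fun z => ((hk_hasDerivAt ht (y - z)).const_mul (V z)).hasDerivWithinAt)
    exact this.congr (fun s hs => heat_eq (hs0 s hs).ne' V y) (heat_eq ht.ne' V y)

lemma Dec.mul_log {w : Eucl n → ℝ} (hw : Dec n w) (hl : GLB n w) :
    Dec n fun y => w y * Real.log (w y) := by
  refine ⟨hw.1.mul (hw.1.log fun y => (hl.pos y).ne'), fun k => ?_⟩
  obtain ⟨C, hC, hb⟩ := log_bound hw hl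
  obtain ⟨D, hD, hDb⟩ := hw.2 (2 + k)
  refine ⟨C * D, by positivity, fun x => ?_⟩
  rw [abs_mul]
  calc |w x| * |Real.log (w x)| * (1 + ‖x‖) ^ k
      ≤ |w x| * (C * (1 + ‖x‖) ^ 2) * (1 + ‖x‖) ^ k :=
        mul_le_mul_of_nonneg_right (mul_le_mul_of_nonneg_left (hb x) (abs_nonneg _))
          (by positivity)
    _ = C * (|w x| * (1 + ‖x‖) ^ (2 + k)) := by ring
    _ ≤ C * D := mul_le_mul_of_nonneg_left (hDb x) hC

/-- The entropy is nonincreasing along the heat flow. -/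
lemma entDens_heat_antitone (hV : Dec n V) (hVl : GLB n V) {s t : ℝ} (hs : 0 ≤ s) (hst : s ≤ t) :
    entDens n (heat n t V) ≤ entDens n (heat n s V) := by
  have hDs := heat_dec hV hs
  have hls := heat_glb hV hVl hs
  rcases hst.eq_or_lt with rfl | hlt
  · rfl
  have hr : 0 < t - s := sub_pos.2 hlt
  set W := heat n s V with hW
  have hWt : heat n t V = heat n (t - s) W := by
    rw [hW, heat_heat hr.le hs hV]; congr 1; ring
  rw [hWt]
  have hDt := heat_dec hDs hr.le
  have hlt' := heat_glb hDs hls hr.le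
  set Z := heat n (t - s) W with hZ
  have hφ : Dec n fun y => W y * Real.log (W y) := hDs.mul_log hls
  have hφZ : Dec n fun y => Z y * Real.log (Z y) := hDt.mul_log hlt'
  have hInt : ∀ {w : Eucl n → ℝ}, Dec n w → ∀ y, Integrable fun z => w z * hk n (t - s) (y - z) :=
    fun hw y => by
      obtain ⟨M, hM⟩ := hw.bdd
      refine ((hk_integrable (n := n) hr).comp_sub_left y).bdd_mul hw.1.aestronglyMeasurable
        (c := M) (Eventually.of_forall fun z => ?_)
      simpa using hM.2 z
  have hk1 : ∀ x, ∫ y, hk n (t - s) (x - y) = 1 := fun x => by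
    rw [integral_sub_left_eq_self (hk n (t - s)) volume x]; exact hk_integral hr
  unfold entDens
  rw [← heat_integral hr.le hφ]
  refine integral_mono hφZ.integrable' (heat_dec hφ hr.le).integrable' fun x => ?_
  have hki : Integrable fun y => hk n (t - s) (x - y) := (hk_integrable (n := n) hr).comp_sub_left x
  have hsub : Integrable fun y => W y * hk n (t - s) (x - y) - Z x * hk n (t - s) (x - y) :=
    (hInt hDs x).sub (hki.const_mul _)
  have e1 : Z x * Real.log (Z x) = ∫ y, ((Z x * Real.log (Z x)) * hk n (t - s) (x - y) +
      (1 + Real.log (Z x)) * (W y * hk n (t - s) (x - y) - Z x * hk n (t - s) (x - y))) := by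
    rw [integral_add (hki.const_mul _) (hsub.const_mul _),
      integral_const_mul, integral_const_mul, integral_sub (hInt hDs x) (hki.const_mul _),
      integral_const_mul, hk1, ← heat_eq hr.ne' W x]
    ring
  simp only
  rw [e1, heat_eq hr.ne']
  refine integral_mono ((hki.const_mul _).add (hsub.const_mul _))
    (hInt hφ x) fun y => ?_
  have h := mul_le_mul_of_nonneg_right (mul_log_tangent (hls.pos y) (hlt'.pos x))
    (hk_pos hr (x - y)).le
  simp only
  linarith
end

section

lemma differentiableWithinAt_of_sandwich {E l h : ℝ → ℝ} {S : Set ℝ} {s₀ : ℝ}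
    (hl : DifferentiableWithinAt ℝ l S s₀) (h₀ : E s₀ = l s₀)
    (hb : ∀ᶠ s in 𝓝[S \ {s₀}] s₀, l s ≤ E s ∧ E s ≤ l s + h s)
    (hh : Tendsto (fun s => h s / (s - s₀)) (𝓝[S \ {s₀}] s₀) (𝓝 0)) :
    DifferentiableWithinAt ℝ E S s₀ := by
  have hd : HasDerivWithinAt (fun s => E s - l s) 0 S s₀ := by
    rw [hasDerivWithinAt_iff_tendsto_slope]
    have hh' := hh.norm
    rw [norm_zero] at hh'
    refine squeeze_zero_norm' ?_ hh'
    filter_upwards [hb] with s hs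
    rw [slope_def_field, h₀, sub_self, sub_zero, norm_div, norm_div]
    refine div_le_div_of_nonneg_right ?_ (norm_nonneg _)
    rw [Real.norm_eq_abs, Real.norm_eq_abs, abs_of_nonneg (by linarith)]
    exact le_abs.2 (Or.inl (by linarith))
  have := hl.add hd.differentiableWithinAt
  refine this.congr (fun s _ => ?_) ?_ <;> simp

variable {n : ℕ} {f g V W : Eucl n → ℝ} {t : ℝ}

/-- The value of the dual problem at the pair of potentials `(log f, log g)`. -/
noncomputable def dualVal (n : ℕ) (f g W : Eucl n → ℝ) : ℝ :=
  (∫ x, Real.log (f x) ∂(densMeas n fun x => f x * heat n 1 g x)) +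
    (∫ y, W y * Real.log (g y)) - (entDens n (fun x => f x * heat n 1 g x) + entDens n W) / 2

lemma entCost_dualVal (hf : Dec n f) (hfl : GLB n f) (hg : Dec n g) (hgl : GLB n g)
    (hW : Dec n W) (hW0 : ∀ y, 0 < W y)
    (hU : IsProbabilityMeasure (densMeas n fun x => f x * heat n 1 g x))
    {π : Measure (Eucl n × Eucl n)}
    (hπ : Coupling π (densMeas n fun x => f x * heat n 1 g x) (densMeas n W)) {h : ℝ} (h0 : 0 ≤ h)
    (hkl : InformationTheory.klDiv π (schrod n f g) ≤ ENNReal.ofReal h) :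
    dualVal n f g W ≤ entCost n (densMeas n fun x => f x * heat n 1 g x) (densMeas n W) ∧
      entCost n (densMeas n fun x => f x * heat n 1 g x) (densMeas n W) ≤
        dualVal n f g W + h := by
  have hsp := (schrod_coupling hf hfl.pos hg hgl.pos hU).1
  have hUd : Dec n fun x => f x * heat n 1 g x := hf.mul (heat_dec hg zero_le_one)
  have hU0 : ∀ x, 0 ≤ f x * heat n 1 g x := fun x =>
    (mul_pos (hfl.pos x) ((heat_glb hg hgl zero_le_one).pos x)).le
  obtain ⟨C, hC, hb⟩ := log_bound hf hfl
  obtain ⟨C', hC', hb'⟩ := log_bound hg hgl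
  have hi0 : Integrable (fun x => Real.log (f x)) (densMeas n fun x => f x * heat n 1 g x) := by
    rw [integrable_densMeas hU0 hUd.1.measurable]
    refine (hUd.integrable_of_le hf.1.measurable.log.aestronglyMeasurable hb).congr
      (Eventually.of_forall fun x => mul_comm _ _)
  have hi1 : Integrable (fun x => Real.log (g x)) (densMeas n W) := by
    rw [integrable_densMeas (fun y => (hW0 y).le) hW.1.measurable]
    refine (hW.integrable_of_le hg.1.measurable.log.aestronglyMeasurable hb').congr
      (Eventually.of_forall fun x => mul_comm _ _)
  have := entCost_sandwich hf.1.measurable hg.1.measurable hfl.pos hgl.pos hi0 hi1 hπ h0 hkl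
  rw [entLeb_densMeas hUd.1.measurable hU0,
    entLeb_densMeas hW.1.measurable (fun y => (hW0 y).le),
    integral_densMeas (fun y => (hW0 y).le) hW.1.measurable] at this
  simp_rw [mul_comm _ (W _)] at this
  exact this

lemma entCost_eq_dualVal (hf : Dec n f) (hfl : GLB n f) (hg : Dec n g) (hgl : GLB n g)
    (hU : IsProbabilityMeasure (densMeas n fun x => f x * heat n 1 g x)) :
    entCost n (densMeas n fun x => f x * heat n 1 g x) (densMeas n fun y => g y * heat n 1 f y) =
      dualVal n f g fun y => g y * heat n 1 f y := by
  have hs := schrod_coupling hf hfl.pos hg hgl.pos hU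
  have hsp := hs.1
  have := entCost_dualVal hf hfl hg hgl (hg.mul (heat_dec hf zero_le_one))
    (hgl.mul (heat_glb hf hfl zero_le_one)).pos hU hs le_rfl
    (by rw [InformationTheory.klDiv_self]; simp)
  exact le_antisymm (by simpa using this.2) this.1

lemma SmoothAt.differentiable_dualVal {W : ℝ → Eucl n → ℝ} {S : Set ℝ} {s₀ : ℝ}
    (h : SmoothAt n W S s₀) (hg : Dec n g) (hgl : GLB n g) :
    DifferentiableWithinAt ℝ (fun s => dualVal n f g (W s)) S s₀ := by
  obtain ⟨C, hC, hb⟩ := log_bound hg hgl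
  exact ((h.differentiable_integral hg.1.measurable.log.aestronglyMeasurable hC hb).const_add
    _).sub ((h.differentiable_entDens.const_add _).div_const 2)

lemma entCost_differentiable_zero (hf : Dec n f) (hfl : GLB n f) (hg : IsSchwartz n g)
    (hgl : GLB n g) (hU : IsProbabilityMeasure (densMeas n fun x => f x * heat n 1 g x)) :
    DifferentiableWithinAt ℝ (fun τ => entCost n (densMeas n fun x => f x * heat n 1 g x)
      (densMeas n (heat n τ fun y => g y * heat n 1 f y))) (Ici 0) 0 := by
  have hV : Dec n fun y => g y * heat n 1 f y := hg.dec.mul (heat_dec hf zero_le_one)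
  have hVl : GLB n fun y => g y * heat n 1 f y := hgl.mul (heat_glb hf hfl zero_le_one)
  obtain ⟨h, hlim, hh⟩ := t0_competitor hf hfl hg hgl hU
  have hsub : Icc (0:ℝ) 1 \ {0} ⊆ Ioi 0 := fun s hs => lt_of_le_of_ne hs.1.1 (Ne.symm hs.2)
  have key := differentiableWithinAt_of_sandwich (h := h)
    ((smoothAt_zero hf hfl hg hgl).differentiable_dualVal (f := f) hg.dec hgl)
    (E := fun τ => entCost n (densMeas n fun x => f x * heat n 1 g x)
      (densMeas n (heat n τ fun y => g y * heat n 1 f y)))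
    (by simp only [heat_zero]; exact entCost_eq_dualVal hf hfl hg.dec hgl hU)
    (by
      filter_upwards [self_mem_nhdsWithin] with s hs
      obtain ⟨h0, π, hπ, hkl⟩ := hh s hs.1.1 hs.1.2
      exact entCost_dualVal hf hfl hg.dec hgl (heat_dec hV hs.1.1) (heat_glb hV hVl hs.1.1).pos
        hU hπ h0 hkl)
    (by simpa using hlim.mono_left (nhdsWithin_mono _ hsub))
  exact key.mono_of_mem_nhdsWithin (Icc_mem_nhdsGE zero_lt_one)

lemma entCost_differentiable_pos (hf : Dec n f) (hfl : GLB n f) (hg : Dec n g)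
    (hgl : GLB n g) (hV : Dec n V) (hVl : GLB n V) (ht : 0 < t)
    (hE : ∀ y, heat n t V y = g y * heat n 1 f y)
    (hU : IsProbabilityMeasure (densMeas n fun x => f x * heat n 1 g x)) :
    DifferentiableWithinAt ℝ (fun τ => entCost n (densMeas n fun x => f x * heat n 1 g x)
      (densMeas n (heat n τ V))) (Ici 0) t := by
  obtain ⟨h, hlim, hh⟩ := pos_competitor hf hfl hg hgl hV hVl ht hE hU
  set S := Icc (t / 2) (2 * t) with hS
  have hS0 : ∀ s ∈ S, 0 < s := fun s hs => lt_of_lt_of_le (by positivity) hs.1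
  have hE' : heat n t V = fun y => g y * heat n 1 f y := funext hE
  set d : ℝ → ℝ := fun s => √(s / t) - 1 with hd
  have hds : ∀ s ∈ S, (1 + d s) ^ 2 * t = s := fun s hs => by
    have : 0 ≤ s / t := div_nonneg (hS0 s hs).le ht.le
    simp only [hd]
    rw [add_sub_cancel, Real.sq_sqrt this, div_mul_cancel₀ _ ht.ne']
  have hdt : Tendsto d (𝓝[S \ {t}] t) (𝓝 0) := by
    have hc : Continuous d := by fun_prop
    have := hc.tendsto t
    simp only [hd, div_self ht.ne', Real.sqrt_one, sub_self] at this
    exact this.mono_left nhdsWithin_le_nhds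
  have hdne : ∀ s ∈ S \ {t}, d s ≠ 0 := fun s hs h0 => hs.2 (by
    have := hds s hs.1
    rw [h0] at this
    simpa using this.symm)
  have hdt' : Tendsto d (𝓝[S \ {t}] t) (𝓝[≠] 0) :=
    tendsto_nhdsWithin_iff.2 ⟨hdt, by filter_upwards [self_mem_nhdsWithin] with s hs using hdne s hs⟩
  have key := differentiableWithinAt_of_sandwich (h := fun s => h (d s)) (S := S)
    ((smoothAt_pos hV hVl ht).differentiable_dualVal (f := f) hg hgl)
    (E := fun τ => entCost n (densMeas n fun x => f x * heat n 1 g x) (densMeas n (heat n τ V)))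
    (by simp only [hE']; exact entCost_eq_dualVal hf hfl hg hgl hU)
    (by
      filter_upwards [self_mem_nhdsWithin,
        hdt (Metric.closedBall_mem_nhds (0:ℝ) (show (0:ℝ) < 1 / 2 by norm_num))] with s hs hs2
      obtain ⟨h0, π, hπ, hkl⟩ := hh (d s) (by simpa using hs2)
      rw [hds s hs.1] at hπ
      exact entCost_dualVal hf hfl hg hgl (heat_dec hV (hS0 s hs.1).le)
        (heat_glb hV hVl (hS0 s hs.1).le).pos hU hπ h0 hkl)
    (by
      have h1 : Tendsto (fun s => (t * (2 + d s))⁻¹) (𝓝[S \ {t}] t) (𝓝 (t * (2 + 0))⁻¹) :=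
        ((hdt.const_add 2).const_mul t).inv₀ (by positivity)
      have h2 := (hlim.comp hdt').mul h1
      rw [zero_mul] at h2
      refine h2.congr' ?_
      filter_upwards [self_mem_nhdsWithin] with s hs
      have e : s - t = d s * (t * (2 + d s)) := by
        have := hds s hs.1
        linear_combination -this
      simp only [Function.comp]
      rw [e, ← div_eq_mul_inv, div_div])
  have hmem : S ∈ 𝓝 t := Icc_mem_nhds (by linarith) (by linarith)
  exact (key.differentiableAt hmem).differentiableWithinAt

end

section
variable {n : ℕ} {u v : Eucl n → ℝ}

lemma eq_of_densMeas_eq {a b : Eucl n → ℝ} (ha : Continuous a) (hb : Continuous b)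
    (ha0 : ∀ x, 0 < a x) (hb0 : ∀ x, 0 < b x) (h : densMeas n a = densMeas n b) : a = b := by
  have h1 := (withDensity_eq_iff_of_sigmaFinite
    ha.measurable.ennreal_ofReal.aemeasurable hb.measurable.ennreal_ofReal.aemeasurable).1 h
  refine (Continuous.ae_eq_iff_eq volume ha hb).1 ?_
  filter_upwards [h1] with x hx
  exact (ENNReal.ofReal_eq_ofReal_iff (ha0 x).le (hb0 x).le).1 hx

lemma heat_congr_ae {a b : Eucl n → ℝ} (h : a =ᵐ[volume] b) {t : ℝ} (ht : t ≠ 0) :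
    heat n t a = heat n t b := by
  ext x
  rw [heat_eq ht, heat_eq ht]
  refine integral_congr_ae ?_
  filter_upwards [h] with y hy
  rw [hy]

lemma aemeasurable_of_heat_ne_zero {x : Eucl n} {t : ℝ} (ht : 0 < t) (h : heat n t v x ≠ 0) :
    AEMeasurable v := by
  rw [heat_eq ht.ne'] at h
  have hi : Integrable fun y => v y * hk n t (x - y) := by
    by_contra hc
    exact h (integral_undef hc)
  have hm : Measurable fun y => (hk n t (x - y))⁻¹ :=
    ((hk_cont n t).measurable.comp (measurable_const.sub measurable_id)).inv
  refine (hi.1.aemeasurable.mul hm.aemeasurable).congr (Eventually.of_forall fun y => ?_)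
  simp only [Pi.mul_apply]
  rw [mul_assoc, mul_inv_cancel₀ (hk_pos ht _).ne', mul_one]

lemma densMeas_ne_zero {a : Eucl n → ℝ} (ha : Measurable a) (h : ∀ x, 0 < a x) :
    densMeas n a ≠ 0 := by
  intro h0
  have := (withDensity_eq_zero_iff ha.ennreal_ofReal.aemeasurable).1 h0
  obtain ⟨x, hx⟩ := this.exists
  have := h x
  simp only [Pi.zero_apply, ENNReal.ofReal_eq_zero] at hx
  linarith

/-- The data of `PiS` in the form used here. -/
lemma PiS.data {μ₀ μ₁ : Measure (Eucl n)} (h : PiS n μ₀ μ₁) :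
    ∃ f g : Eucl n → ℝ, Dec n f ∧ GLB n f ∧ IsSchwartz n g ∧ GLB n g ∧
      μ₀ = densMeas n (fun x => f x * heat n 1 g x) ∧
      μ₁ = densMeas n (fun y => g y * heat n 1 f y) := by
  obtain ⟨f, g, hf, hg, -, -, ⟨α, c, hα, hc, hfl, hgl⟩, h0, h1⟩ := h
  exact ⟨f, g, hf.dec, ⟨α, c, hα, hc, hfl⟩, hg, ⟨α, c, hα, hc, hgl⟩, h0, h1⟩

lemma ae_eq_of_PiS (h0 : PiS n (densMeas n u) (densMeas n v))
    (h1 : PiS n (densMeas n u) (densMeas n (heat n 1 v))) :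
    ∃ f g : Eucl n → ℝ, Dec n f ∧ GLB n f ∧ IsSchwartz n g ∧ GLB n g ∧
      densMeas n u = densMeas n (fun x => f x * heat n 1 g x) ∧
      v =ᵐ[volume] fun y => g y * heat n 1 f y := by
  obtain ⟨f, g, hf, hfl, hg, hgl, e0, e1⟩ := h0.data
  obtain ⟨f', g', hf', hfl', hg', hgl', -, e1'⟩ := h1.data
  refine ⟨f, g, hf, hfl, hg, hgl, e0, ?_⟩
  have hV : Dec n fun y => g y * heat n 1 f y := hg.dec.mul (heat_dec hf zero_le_one)
  have hVl : GLB n fun y => g y * heat n 1 f y := hgl.mul (heat_glb hf hfl zero_le_one)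
  have hne : ∃ x, heat n 1 v x ≠ 0 := by
    by_contra hc
    push Not at hc
    refine densMeas_ne_zero (hg'.dec.mul (heat_dec hf' zero_le_one)).1.measurable
      (hgl'.mul (heat_glb hf' hfl' zero_le_one)).pos (e1'.symm.trans ?_)
    rw [densMeas, funext hc]
    simp
  obtain ⟨x, hx⟩ := hne
  have hvm := aemeasurable_of_heat_ne_zero one_pos hx
  have := (withDensity_eq_iff_of_sigmaFinite hvm.ennreal_ofReal
    hV.1.measurable.ennreal_ofReal.aemeasurable).1 e1
  filter_upwards [this] with y hy
  have hp := hVl.pos y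
  have hv0 : 0 < v y := by
    by_contra hc
    rw [ENNReal.ofReal_of_nonpos (not_lt.1 hc)] at hy
    exact (ENNReal.ofReal_pos.2 hp).ne hy
  exact (ENNReal.ofReal_eq_ofReal_iff hv0.le hp.le).1 hy

/-- The regularity of the entropic cost and of the entropy along an admissible heat flow. -/
structure FlowRegular (n : ℕ) (u v : Eucl n → ℝ) : Prop where
  prob : ∀ t, 0 ≤ t → IsProbabilityMeasure (densMeas n (heat n t v))
  semigroup : ∀ s t, 0 ≤ s → 0 ≤ t → heat n s (heat n t v) = heat n (s + t) v
  diff : ∀ t, 0 ≤ t → DifferentiableWithinAt ℝ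
    (fun τ => entCost n (densMeas n u) (densMeas n (heat n τ v))) (Ici 0) t
  anti : ∀ s t, 0 ≤ s → s ≤ t → entDens n (heat n t v) ≤ entDens n (heat n s v)
  cont : ContinuousWithinAt (fun t => entDens n (heat n t v)) (Ici 0) 0

lemma flowRegular (hu : IsProbabilityMeasure (densMeas n u))
    (hv : IsProbabilityMeasure (densMeas n v))
    (hP : ∀ t : ℝ, 0 ≤ t → PiS n (densMeas n u) (densMeas n (heat n t v))) :
    FlowRegular n u v := by
  have hP0 := hP 0 le_rfl
  rw [heat_zero] at hP0
  obtain ⟨f, g, hf, hfl, hg, hgl, e0, hvV⟩ := ae_eq_of_PiS hP0 (hP 1 zero_le_one)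
  set V : Eucl n → ℝ := fun y => g y * heat n 1 f y with hVdef
  have hV : Dec n V := hg.dec.mul (heat_dec hf zero_le_one)
  have hVl : GLB n V := hgl.mul (heat_glb hf hfl zero_le_one)
  have hheat : ∀ t, t ≠ 0 → heat n t v = heat n t V := fun t ht => heat_congr_ae hvV ht
  have hae : ∀ t, heat n t v =ᵐ[volume] heat n t V := fun t => by
    rcases eq_or_ne t 0 with rfl | ht
    · simpa only [heat_zero] using hvV
    · rw [hheat t ht]
  have hdens : ∀ t, densMeas n (heat n t v) = densMeas n (heat n t V) := fun t => by
    refine withDensity_congr_ae ?_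
    filter_upwards [hae t] with y hy
    rw [hy]
  have hent : ∀ t, entDens n (heat n t v) = entDens n (heat n t V) := fun t => by
    refine integral_congr_ae ?_
    filter_upwards [hae t] with y hy
    rw [hy]
  refine ⟨fun t ht => ?_, fun s t hs ht => ?_, fun t ht => ?_, fun s t hs hst => ?_, ?_⟩
  · rcases eq_or_ne t 0 with rfl | h0
    · rwa [heat_zero]
    obtain ⟨f', g', hf', hfl', hg', hgl', e0', e1'⟩ := (hP t ht).data
    rw [e1']
    rw [e0'] at hu
    have hs := schrod_coupling hf' hfl'.pos hg'.dec hgl'.pos hu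
    have := hs.1
    rw [← hs.2.2]
    exact Measure.isProbabilityMeasure_map measurable_snd.aemeasurable
  · rcases eq_or_ne s 0 with rfl | hs0
    · rw [heat_zero, zero_add]
    have hst : s + t ≠ 0 := (add_pos_of_pos_of_nonneg (hs.lt_of_ne' hs0) ht).ne'
    rw [heat_congr_ae (hae t) hs0, hheat _ hst, heat_heat hs ht hV]
  · simp_rw [hdens]
    rcases eq_or_ne t 0 with rfl | h0
    · rw [e0] at hu ⊢
      exact entCost_differentiable_zero hf hfl hg hgl hu
    obtain ⟨f', g', hf', hfl', hg', hgl', e0', e1'⟩ := (hP t ht).data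
    rw [hdens] at e1'
    rw [e0'] at hu ⊢
    refine entCost_differentiable_pos hf' hfl' hg'.dec hgl' hV hVl (ht.lt_of_ne' h0) (fun y => ?_) hu
    exact congrFun (eq_of_densMeas_eq (heat_dec hV ht).1
      (hg'.dec.mul (heat_dec hf' zero_le_one)).1 (heat_glb hV hVl ht).pos
      (hgl'.mul (heat_glb hf' hfl' zero_le_one)).pos e1') y
  · rw [hent, hent]
    exact entDens_heat_antitone hV hVl hs hst
  · simp_rw [hent]
    exact (smoothAt_zero hf hfl hg hgl).differentiable_entDens.continuousWithinAt.mono_of_mem_nhdsWithin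
      (Icc_mem_nhdsGE zero_lt_one)

lemma FlowRegular.shift (h : FlowRegular n u v) {t : ℝ} (ht : 0 ≤ t) :
    derivWithin (fun τ => entCost n (densMeas n u) (densMeas n (heat n τ (heat n t v)))) (Ici 0) 0 =
      derivWithin (fun τ => entCost n (densMeas n u) (densMeas n (heat n τ v))) (Ici 0) t := by
  have h1 := (h.diff t ht).hasDerivWithinAt
  have h2 : HasDerivWithinAt (fun τ : ℝ => τ + t) 1 (Ici 0) 0 :=
    ((hasDerivAt_id (0:ℝ)).add_const t).hasDerivWithinAt
  have h3 := HasDerivWithinAt.comp (h₂ := fun τ => entCost n (densMeas n u) (densMeas n (heat n τ v)))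
    (s' := Ici 0) (0:ℝ) (by rw [zero_add]; exact h1) h2 (fun τ hτ => add_nonneg hτ ht)
  rw [mul_one] at h3
  refine HasDerivWithinAt.derivWithin (h3.congr (fun τ hτ => ?_) ?_)
    (uniqueDiffOn_Ici 0 0 self_mem_Ici)
  · simp only [Function.comp]; rw [h.semigroup τ t hτ ht]
  · simp only [Function.comp]; rw [h.semigroup 0 t le_rfl ht]

lemma evi_bound_mono (n : ℕ) {h a b : ℝ} (hab : b ≤ a) :
    ((n:ℝ) / 2) * (1 - Real.exp (-(1 / n) * (h - a))) ≤
      (n / 2) * (1 - Real.exp (-(1 / n) * (h - b))) := by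
  refine mul_le_mul_of_nonneg_left (sub_le_sub_left (Real.exp_le_exp.2 ?_) 1) (by positivity)
  have : (0:ℝ) ≤ 1 / n := by positivity
  nlinarith

lemma FlowRegular.integral_form (h : FlowRegular n u v)
    (hd : ∀ t : ℝ, 0 ≤ t →
      derivWithin (fun τ => entCost n (densMeas n u) (densMeas n (heat n τ v))) (Ici 0) t
        ≤ (n / 2) * (1 - Real.exp (-(1 / n) * (entDens n u - entDens n (heat n t v)))))
    {t : ℝ} (ht : 0 ≤ t) :
    entCost n (densMeas n u) (densMeas n (heat n t v)) - entCost n (densMeas n u) (densMeas n v)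
      ≤ (n / 2) * t * (1 - Real.exp (-(1 / n) * (entDens n u - entDens n (heat n t v)))) := by
  have key := Convex.image_sub_le_mul_sub_of_deriv_le (convex_Icc 0 t)
    (f := fun τ => entCost n (densMeas n u) (densMeas n (heat n τ v)))
    (C := (n / 2) * (1 - Real.exp (-(1 / n) * (entDens n u - entDens n (heat n t v)))))
    (fun s hs => (h.diff s hs.1).continuousWithinAt.mono Icc_subset_Ici_self)
    (fun s hs => by
      rw [interior_Icc] at hs ⊢
      exact (h.diff s hs.1.le).mono fun r hr => hr.1.le)
    (fun s hs => by
      rw [interior_Icc] at hs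
      rw [← derivWithin_of_mem_nhds (Ici_mem_nhds hs.1)]
      exact (hd s hs.1.le).trans (evi_bound_mono n (h.anti s t hs.1.le hs.2.le)))
    0 ⟨le_rfl, ht⟩ t ⟨ht, le_rfl⟩ ht
  simp only [heat_zero, sub_zero] at key
  linarith

lemma FlowRegular.deriv_zero_form (h : FlowRegular n u v)
    (hi : ∀ t : ℝ, 0 ≤ t →
      entCost n (densMeas n u) (densMeas n (heat n t v)) - entCost n (densMeas n u) (densMeas n v)
        ≤ (n / 2) * t * (1 - Real.exp (-(1 / n) * (entDens n u - entDens n (heat n t v))))) :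
    derivWithin (fun τ => entCost n (densMeas n u) (densMeas n (heat n τ v))) (Ici 0) 0
      ≤ (n / 2) * (1 - Real.exp (-(1 / n) * (entDens n u - entDens n v))) := by
  have h1 := hasDerivWithinAt_iff_tendsto_slope.1 (h.diff 0 le_rfl).hasDerivWithinAt
  have hcont : ContinuousWithinAt (fun t => ((n:ℝ) / 2) *
      (1 - Real.exp (-(1 / n) * (entDens n u - entDens n (heat n t v))))) (Ici 0) 0 :=
    continuousWithinAt_const.mul (continuousWithinAt_const.sub
      (continuousWithinAt_const.mul (continuousWithinAt_const.sub h.cont)).rexp)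
  have h2 := hcont.tendsto.mono_left
    (nhdsWithin_mono (0:ℝ) (sdiff_subset : Ici (0:ℝ) \ {0} ⊆ Ici 0))
  simp only [heat_zero] at h2
  have hbot : (𝓝[Ici (0:ℝ) \ {0}] 0).NeBot := by
    rw [Ici_sdiff_left]; infer_instance
  refine le_of_tendsto_of_tendsto h1 h2 ?_
  filter_upwards [self_mem_nhdsWithin] with t ht
  have ht0 : 0 < t := lt_of_le_of_ne ht.1 (Ne.symm ht.2)
  rw [slope_def_field, sub_zero, div_le_iff₀ ht0, heat_zero]
  linarith [hi t ht0.le]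

lemma FlowRegular.deriv_form
    (h : ∀ u v : Eucl n → ℝ, IsProbabilityMeasure (densMeas n u) →
      IsProbabilityMeasure (densMeas n v) →
      (∀ t : ℝ, 0 ≤ t → PiS n (densMeas n u) (densMeas n (heat n t v))) →
      derivWithin (fun τ => entCost n (densMeas n u) (densMeas n (heat n τ v))) (Ici 0) 0
        ≤ (n / 2) * (1 - Real.exp (-(1 / n) * (entDens n u - entDens n v))))
    (hu : IsProbabilityMeasure (densMeas n u)) (hv : IsProbabilityMeasure (densMeas n v))
    (hP : ∀ t : ℝ, 0 ≤ t → PiS n (densMeas n u) (densMeas n (heat n t v))) {t : ℝ} (ht : 0 ≤ t) :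
    derivWithin (fun τ => entCost n (densMeas n u) (densMeas n (heat n τ v))) (Ici 0) t
      ≤ (n / 2) * (1 - Real.exp (-(1 / n) * (entDens n u - entDens n (heat n t v)))) := by
  have hR := flowRegular hu hv hP
  rw [← hR.shift ht]
  refine h u (heat n t v) hu (hR.prob t ht) fun s hs => ?_
  rw [hR.semigroup s t hs ht]
  exact hP _ (add_nonneg hs ht)

end

end

/-- Equivalence of the differential, the `t = 0`, and the integral forms of the EVI
inequality for the entropic cost. -/
theorem EVI_entropic_cost_equivalent_forms (n : ℕ) (hn : 1 ≤ n) :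
    ((∀ u v : Eucl n → ℝ, IsProbabilityMeasure (densMeas n u) →
        IsProbabilityMeasure (densMeas n v) →
        (∀ t : ℝ, 0 ≤ t → PiS n (densMeas n u) (densMeas n (heat n t v))) →
        ∀ t : ℝ, 0 ≤ t →
          derivWithin (fun τ => entCost n (densMeas n u) (densMeas n (heat n τ v)))
              (Set.Ici 0) t
            ≤ (n / 2) * (1 - Real.exp (-(1 / n) * (entDens n u - entDens n (heat n t v)))))
      ↔ (∀ u v : Eucl n → ℝ, IsProbabilityMeasure (densMeas n u) →
          IsProbabilityMeasure (densMeas n v) →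
          (∀ t : ℝ, 0 ≤ t → PiS n (densMeas n u) (densMeas n (heat n t v))) →
          derivWithin (fun τ => entCost n (densMeas n u) (densMeas n (heat n τ v)))
              (Set.Ici 0) 0
            ≤ (n / 2) * (1 - Real.exp (-(1 / n) * (entDens n u - entDens n v)))))
    ∧ ((∀ u v : Eucl n → ℝ, IsProbabilityMeasure (densMeas n u) →
          IsProbabilityMeasure (densMeas n v) →
          (∀ t : ℝ, 0 ≤ t → PiS n (densMeas n u) (densMeas n (heat n t v))) →
          derivWithin (fun τ => entCost n (densMeas n u) (densMeas n (heat n τ v)))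
              (Set.Ici 0) 0
            ≤ (n / 2) * (1 - Real.exp (-(1 / n) * (entDens n u - entDens n v))))
      ↔ (∀ u v : Eucl n → ℝ, IsProbabilityMeasure (densMeas n u) →
          IsProbabilityMeasure (densMeas n v) →
          (∀ t : ℝ, 0 ≤ t → PiS n (densMeas n u) (densMeas n (heat n t v))) →
          ∀ t : ℝ, 0 ≤ t →
            entCost n (densMeas n u) (densMeas n (heat n t v))
                - entCost n (densMeas n u) (densMeas n v)
              ≤ (n / 2) * t *
                  (1 - Real.exp (-(1 / n) * (entDens n u - entDens n (heat n t v)))))) := by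
  refine ⟨⟨fun h u v hu hv hP => ?_, fun h u v hu hv hP t ht => ?_⟩,
    fun h u v hu hv hP t ht => ?_, fun h u v hu hv hP => ?_⟩
  · simpa only [heat_zero] using h u v hu hv hP 0 le_rfl
  · exact FlowRegular.deriv_form h hu hv hP ht
  · exact (flowRegular hu hv hP).integral_form
      (fun s hs => FlowRegular.deriv_form h hu hv hP hs) ht
  · exact (flowRegular hu hv hP).deriv_zero_form (h u v hu hv hP)
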